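/- Let G be a 2-connected finite simple graph. The following are equivalent: (1) G has pathwidth equal to two; (2) G has special treewidth equal to two; (3) G has directed spaghetti treewidth equal to two; (4) G has no minor isomorphic to K_4, D_3, or S_3; (5) the cell completion G̃ of G is a path of cycles. -/

import Mathlib

open SimpleGraph

/-- The cycle graph on `ZMod n` (for `3 ≤ n` this is a cycle of length `n`). -/
def cycGraph (n : ℕ) : SimpleGraph (ZMod n) :=
  SimpleGraph.fromRel (fun x y => x = y + 1)

/-- The set `s` of nodes induces a path in the graph `H`. -/
def IsPathSet {ι : Type} (H : SimpleGraph ι) (s : Set ι) : Prop :=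
  (H.induce s).Connected ∧ ∀ x ∈ s, {y | y ∈ s ∧ H.Adj x y}.ncard ≤ 2

/-- The set `s` of nodes induces a directed path in `H` with respect to the
orientation `o` of the edges of `H`. -/
def IsDirPathSet {ι : Type} (H : SimpleGraph ι) (o : ι → ι → Prop) (s : Set ι) : Prop :=
  IsPathSet H s ∧ (∀ x ∈ s, {y | y ∈ s ∧ o x y}.ncard ≤ 1) ∧
    (∀ x ∈ s, {y | y ∈ s ∧ o y x}.ncard ≤ 1)

/-- A tree decomposition of a finite simple graph `G`. -/
structure TreeDecomp {V : Type} (G : SimpleGraph V) where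
  ι : Type
  finι : Finite ι
  tree : SimpleGraph ι
  isTree : tree.IsTree
  bag : ι → Set V
  bag_cover : ∀ v : V, ∃ x, v ∈ bag x
  bag_edge : ∀ ⦃u v : V⦄, G.Adj u v → ∃ x, u ∈ bag x ∧ v ∈ bag x
  bag_conn : ∀ v : V, (tree.induce {x | v ∈ bag x}).Connected

/-- A spaghetti tree decomposition: for every vertex `v` of `G`, the nodes whose
bags contain `v` induce a path in the tree. -/
structure SpaghettiTD {V : Type} (G : SimpleGraph V) extends TreeDecomp G where
  bag_path : ∀ v : V, IsPathSet tree {x | v ∈ bag x}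

/-- A directed spaghetti tree decomposition: the tree edges are oriented, and for
every vertex `v` of `G` the nodes whose bags contain `v` induce a directed path. -/
structure DirSpaghettiTD {V : Type} (G : SimpleGraph V) extends TreeDecomp G where
  orient : ι → ι → Prop
  orient_iff : ∀ x y : ι, tree.Adj x y ↔ (orient x y ∨ orient y x)
  orient_asymm : ∀ x y : ι, orient x y → ¬ orient y x
  bag_dirpath : ∀ v : V, IsDirPathSet tree orient {x | v ∈ bag x}

/-- A special tree decomposition: the tree is rooted, and for every vertex `v` of
`G` the nodes whose bags contain `v` induce a vertical path, i.e. a directed path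
with respect to the orientation of every tree edge towards the root. -/
structure SpecialTD {V : Type} (G : SimpleGraph V) extends TreeDecomp G where
  root : ι
  bag_vertical : ∀ v : V,
    IsDirPathSet tree (fun x y => tree.Adj x y ∧ tree.dist y root < tree.dist x root)
      {x | v ∈ bag x}

/-- A path decomposition of a finite simple graph `G`. -/
structure PathDecomp {V : Type} (G : SimpleGraph V) where
  m : ℕ
  hm : 0 < m
  bag : Fin m → Set V
  bag_cover : ∀ v : V, ∃ i, v ∈ bag i
  bag_edge : ∀ ⦃u v : V⦄, G.Adj u v → ∃ i, u ∈ bag i ∧ v ∈ bag i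
  bag_convex : ∀ (v : V) (i j k : Fin m), i ≤ j → j ≤ k → v ∈ bag i → v ∈ bag k → v ∈ bag j

/-- Treewidth: minimal width of a tree decomposition. -/
noncomputable def treewidth {V : Type} (G : SimpleGraph V) : ℕ :=
  sInf {k | ∃ td : TreeDecomp G, ∀ x, (td.bag x).ncard ≤ k + 1}

/-- Spaghetti treewidth: minimal width of a spaghetti tree decomposition. -/
noncomputable def sptw {V : Type} (G : SimpleGraph V) : ℕ :=
  sInf {k | ∃ td : SpaghettiTD G, ∀ x, (td.bag x).ncard ≤ k + 1}

/-- Directed spaghetti treewidth: minimal width of a directed spaghetti tree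
decomposition. -/
noncomputable def dptw {V : Type} (G : SimpleGraph V) : ℕ :=
  sInf {k | ∃ td : DirSpaghettiTD G, ∀ x, (td.bag x).ncard ≤ k + 1}

/-- Special treewidth: minimal width of a special tree decomposition. -/
noncomputable def spctw {V : Type} (G : SimpleGraph V) : ℕ :=
  sInf {k | ∃ td : SpecialTD G, ∀ x, (td.bag x).ncard ≤ k + 1}

/-- Pathwidth: minimal width of a path decomposition. -/
noncomputable def pw {V : Type} (G : SimpleGraph V) : ℕ :=
  sInf {k | ∃ pd : PathDecomp G, ∀ i, (pd.bag i).ncard ≤ k + 1}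

/-- A graph is chordal iff it has no induced (i.e. chordless) cycle of length at
least four. -/
def IsChordal {V : Type} (G : SimpleGraph V) : Prop :=
  ∀ (S : Set V) (n : ℕ), 4 ≤ n → ¬ Nonempty ((G.induce S) ≃g cycGraph n)

/-- A graph is strongly chordal if it is chordal and every even cycle of length at
least six has an odd chord: a chord splitting the cycle into two odd paths of
length at least three. -/
def IsStronglyChordal {V : Type} (G : SimpleGraph V) : Prop :=
  IsChordal G ∧ ∀ n : ℕ, 6 ≤ n → Even n → ∀ f : ZMod n → V,
    Function.Injective f → (∀ i : ZMod n, G.Adj (f i) (f (i + 1))) →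
      ∃ (i : ZMod n) (d : ℕ), Odd d ∧ 3 ≤ d ∧ d + 3 ≤ n ∧ G.Adj (f i) (f (i + (d : ZMod n)))

/-- Strongly chordal treewidth: the minimum of `ω(H) - 1` over all strongly chordal
supergraphs `H` of `G` (on the same vertex set; here `ω(H) ≤ k + 1` is expressed as
`H.CliqueFree (k + 2)`). -/
noncomputable def sctw {V : Type} (G : SimpleGraph V) : ℕ :=
  sInf {k | ∃ H : SimpleGraph V, G ≤ H ∧ IsStronglyChordal H ∧ H.CliqueFree (k + 2)}

/-- `H` is a minor of `G`: there is a family of nonempty, pairwise disjoint,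
connected branch sets in `G`, one for each vertex of `H`, such that every edge of
`H` is realized by an edge of `G` between the corresponding branch sets. -/
def IsMinorOf {W V : Type} (H : SimpleGraph W) (G : SimpleGraph V) : Prop :=
  ∃ f : W → Set V,
    (∀ w, (f w).Nonempty) ∧ (∀ w, (G.induce (f w)).Connected) ∧
    (Pairwise fun w w' => Disjoint (f w) (f w')) ∧
    ∀ ⦃w w'⦄, H.Adj w w' → ∃ u ∈ f w, ∃ v ∈ f w', G.Adj u v

/-- The complete graph on four vertices. -/
def K4 : SimpleGraph (Fin 4) := ⊤

/-- `D₃`: two vertices (`0` and `1`) joined by three internally vertex-disjoint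
paths of length three. -/
def D3 : SimpleGraph (Fin 8) := SimpleGraph.fromRel (fun x y =>
  (x = 0 ∧ y = 2) ∨ (x = 2 ∧ y = 3) ∨ (x = 3 ∧ y = 1) ∨
  (x = 0 ∧ y = 4) ∨ (x = 4 ∧ y = 5) ∨ (x = 5 ∧ y = 1) ∨
  (x = 0 ∧ y = 6) ∨ (x = 6 ∧ y = 7) ∨ (x = 7 ∧ y = 1))

/-- `S₃` (the 3-sun): a 6-cycle `0 1 2 3 4 5` together with the triangle `1 3 5`. -/
def S3 : SimpleGraph (Fin 6) := SimpleGraph.fromRel (fun x y =>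
  (x = 0 ∧ y = 1) ∨ (x = 1 ∧ y = 2) ∨ (x = 2 ∧ y = 3) ∨ (x = 3 ∧ y = 4) ∨
  (x = 4 ∧ y = 5) ∨ (x = 5 ∧ y = 0) ∨ (x = 1 ∧ y = 3) ∨ (x = 3 ∧ y = 5) ∨ (x = 5 ∧ y = 1))

/-- A graph is 2-connected if it has at least three vertices and deleting any one
vertex leaves it connected. -/
def TwoConnected {V : Type} (G : SimpleGraph V) : Prop :=
  3 ≤ Nat.card V ∧ ∀ v : V, (G.induce {x | x ≠ v}).Connected

/-- The cell completion of `G`: add an edge `vw` for every pair of (nonadjacent)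
vertices `v, w` such that deleting `v` and `w` leaves at least three connected
components. -/
def cellCompletion {V : Type} (G : SimpleGraph V) : SimpleGraph V :=
  SimpleGraph.fromRel (fun v w => G.Adj v w ∨
    3 ≤ Nat.card ((G.induce {x | x ≠ v ∧ x ≠ w}).ConnectedComponent))

/-- The induced subgraph of `G` on `S` has no cut vertex. -/
def NoCutVertex {V : Type} (G : SimpleGraph V) (S : Set V) : Prop :=
  ∀ v ∈ S, (S \ {v}).Nonempty → (G.induce (S \ {v})).Connected

/-- `S` carries a block of `G`: a maximal connected (induced) subgraph without a
cut vertex. -/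
def IsBlock {V : Type} (G : SimpleGraph V) (S : Set V) : Prop :=
  S.Nonempty ∧ (G.induce S).Connected ∧ NoCutVertex G S ∧
    ∀ S' : Set V, S ⊆ S' → (G.induce S').Connected → NoCutVertex G S' → S' = S

/-- Glue a cycle of length `n` onto the graph `G` by identifying the cycle edge
`{0, 1}` (with its end vertices) with the edge `{a, b}` of `G`. -/
def glueCycle {V : Type} (G : SimpleGraph V) (n : ℕ) (a b : V) :
    SimpleGraph (V ⊕ {x : ZMod n // x ≠ 0 ∧ x ≠ 1}) :=
  SimpleGraph.fromRel (fun p q =>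
    match p, q with
    | Sum.inl u, Sum.inl v => G.Adj u v
    | Sum.inl u, Sum.inr x => (u = a ∧ (cycGraph n).Adj 0 x.1) ∨ (u = b ∧ (cycGraph n).Adj 1 x.1)
    | Sum.inr x, Sum.inr y => (cycGraph n).Adj x.1 y.1
    | Sum.inr _, Sum.inl _ => False)

/-- The class of trees of cycles: every cycle is a tree of cycles, and gluing a
cycle onto a tree of cycles along an edge yields a tree of cycles (up to
isomorphism). -/
inductive IsTreeOfCycles : {V : Type} → SimpleGraph V → Prop
  | cycle {V : Type} (G : SimpleGraph V) (n : ℕ) (hn : 3 ≤ n)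
      (e : Nonempty (G ≃g cycGraph n)) : IsTreeOfCycles G
  | glue {V W : Type} (G : SimpleGraph V) (hG : IsTreeOfCycles G)
      (n : ℕ) (hn : 3 ≤ n) (a b : V) (hab : G.Adj a b)
      (H : SimpleGraph W) (e : Nonempty (H ≃g glueCycle G n a b)) : IsTreeOfCycles H

/-- `S` is the vertex set of a chordless cycle of `G`, i.e. it induces a cycle. -/
def IsChordlessCycle {V : Type} (G : SimpleGraph V) (S : Set V) : Prop :=
  ∃ n : ℕ, 3 ≤ n ∧ Nonempty ((G.induce S) ≃g cycGraph n)

/-- The edge `uv` is an edge separator: it lies in at least two distinct chordless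
cycles of `G`. -/
def IsEdgeSeparator {V : Type} (G : SimpleGraph V) (u v : V) : Prop :=
  G.Adj u v ∧ ∃ S₁ S₂ : Set V, S₁ ≠ S₂ ∧ IsChordlessCycle G S₁ ∧ IsChordlessCycle G S₂ ∧
    u ∈ S₁ ∧ v ∈ S₁ ∧ u ∈ S₂ ∧ v ∈ S₂

/-- `S` is a simplicial triangle of `G`: a chordless cycle on three vertices
containing a simplicial vertex of `G`. -/
def IsSimplicialTriangle {V : Type} (G : SimpleGraph V) (S : Set V) : Prop :=
  IsChordlessCycle G S ∧ S.ncard = 3 ∧ ∃ v ∈ S, G.IsClique (G.neighborSet v)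

/-- A chain tree of cycles: a tree of cycles in which every edge lies in at most two
chordless cycles that are not simplicial triangles (equivalently, if an edge lies in
`m ≥ 3` chordless cycles then at least `m - 2` of them are simplicial triangles). -/
def IsChainTreeOfCycles {V : Type} (G : SimpleGraph V) : Prop :=
  IsTreeOfCycles G ∧ ∀ u v : V, G.Adj u v →
    {S : Set V | IsChordlessCycle G S ∧ u ∈ S ∧ v ∈ S ∧ ¬ IsSimplicialTriangle G S}.ncard ≤ 2

/-- A tree of two-boundaried cycles: a tree of cycles in which every chordless
cycle contains at most two edge separators. -/
def IsTreeOfTwoBoundariedCycles {V : Type} (G : SimpleGraph V) : Prop :=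
  IsTreeOfCycles G ∧ ∀ S : Set V, IsChordlessCycle G S →
    {e : Sym2 V | ∃ u v : V, e = s(u, v) ∧ u ∈ S ∧ v ∈ S ∧ IsEdgeSeparator G u v}.ncard ≤ 2

/-- A path of cycles: a tree of cycles in which every chordless cycle contains at
most two edge separators and every edge lies in at most two chordless cycles that
are not simplicial triangles. -/
def IsPathOfCycles {V : Type} (G : SimpleGraph V) : Prop :=
  IsTreeOfCycles G ∧
    (∀ S : Set V, IsChordlessCycle G S →
      {e : Sym2 V | ∃ u v : V, e = s(u, v) ∧ u ∈ S ∧ v ∈ S ∧ IsEdgeSeparator G u v}.ncard ≤ 2) ∧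
    ∀ u v : V, G.Adj u v →
      {S : Set V | IsChordlessCycle G S ∧ u ∈ S ∧ v ∈ S ∧ ¬ IsSimplicialTriangle G S}.ncard ≤ 2

/-- The graph is a single edge. -/
def IsSingleEdgeGraph {V : Type} (G : SimpleGraph V) : Prop :=
  Nat.card V = 2 ∧ ∀ a b : V, a ≠ b → G.Adj a b

/-- A mamba: a 2-connected graph of pathwidth two, a single edge, or an isolated
vertex. -/
def IsMamba {V : Type} (G : SimpleGraph V) : Prop :=
  (TwoConnected G ∧ pw G = 2) ∨ IsSingleEdgeGraph G ∨ Nat.card V = 1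

/-- `v` is a head vertex of the mamba `G`: some path decomposition of `G` of width
at most two has `v` in its first bag. -/
def IsHeadVertex {V : Type} (G : SimpleGraph V) (v : V) : Prop :=
  ∃ pd : PathDecomp G, (∀ i, (pd.bag i).ncard ≤ 3) ∧ v ∈ pd.bag ⟨0, pd.hm⟩

/-- Glue the graph `M` onto the graph `G` by identifying the vertex `h` of `M` with
the vertex `x` of `G`. -/
def glueAtVertex {V W : Type} (G : SimpleGraph V) (x : V) (M : SimpleGraph W) (h : W) :
    SimpleGraph (V ⊕ {w : W // w ≠ h}) :=
  SimpleGraph.fromRel (fun p q =>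
    match p, q with
    | Sum.inl u, Sum.inl u' => G.Adj u u'
    | Sum.inl u, Sum.inr w => u = x ∧ M.Adj h w.1
    | Sum.inr w, Sum.inr w' => M.Adj w.1 w'.1
    | Sum.inr _, Sum.inl _ => False)

/-- The class of mamba trees: every mamba is a mamba tree, and gluing a mamba onto
a mamba tree by identifying a vertex of the mamba tree with a head vertex of the
mamba yields a mamba tree (up to isomorphism). -/
inductive IsMambaTree : {V : Type} → SimpleGraph V → Prop
  | mamba {V : Type} (G : SimpleGraph V) (hG : IsMamba G) : IsMambaTree G
  | glue {V W U : Type} (G : SimpleGraph V) (hG : IsMambaTree G)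
      (M : SimpleGraph W) (hM : IsMamba M) (x : V) (h : W) (hh : IsHeadVertex M h)
      (K : SimpleGraph U) (e : Nonempty (K ≃g glueAtVertex G x M h)) : IsMambaTree K

/-- Subdivide the edge `{a, b}` of `G` by a new vertex. -/
def subdivideEdge {V : Type} (G : SimpleGraph V) (a b : V) : SimpleGraph (V ⊕ Unit) :=
  SimpleGraph.fromRel (fun p q =>
    match p, q with
    | Sum.inl u, Sum.inl v => G.Adj u v ∧ ¬(u = a ∧ v = b) ∧ ¬(u = b ∧ v = a)
    | Sum.inl u, Sum.inr _ => u = a ∨ u = b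
    | Sum.inr _, _ => False)

/-- `H` is a subdivision of `G`: `H` is obtained from (an isomorphic copy of) `G`
by repeatedly subdividing edges. -/
inductive IsSubdivisionOf : {W V : Type} → SimpleGraph W → SimpleGraph V → Prop
  | base {V W : Type} {G : SimpleGraph V} {H : SimpleGraph W}
      (e : Nonempty (H ≃g G)) : IsSubdivisionOf H G
  | step {V W U : Type} {G : SimpleGraph V} {H : SimpleGraph W} (a b : W) (hab : H.Adj a b)
      (h : IsSubdivisionOf H G) {K : SimpleGraph U}
      (e : Nonempty (K ≃g subdivideEdge H a b)) : IsSubdivisionOf K G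

/-- Contract the edge `{a, b}` of `G` (the contracted vertex is `a`, `b` is removed). -/
def contractEdge {V : Type} (G : SimpleGraph V) (a b : V) : SimpleGraph {x : V // x ≠ b} :=
  SimpleGraph.fromRel (fun x y =>
    G.Adj x.1 y.1 ∨ (x.1 = a ∧ G.Adj b y.1) ∨ (y.1 = a ∧ G.Adj b x.1))

/-- The set `s` is nonempty and connected in `G`, phrased through sets closed under adjacency. -/
def ConnOn {V : Type} (G : SimpleGraph V) (s : Set V) : Prop :=
  s.Nonempty ∧ ∀ U : Set V, (∃ x ∈ s, x ∈ U) →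
    (∀ x ∈ s, x ∈ U → ∀ y ∈ s, G.Adj x y → y ∈ U) → s ⊆ U

theorem connOn_iff {V : Type} {G : SimpleGraph V} {s : Set V} :
    ConnOn G s ↔ (G.induce s).Connected := by
  constructor
  · rintro ⟨⟨x, hx⟩, h⟩
    have key : ∀ x : s, ∀ y : s, (G.induce s).Reachable x y := by
      intro x y
      have := h {z | ∃ hz : z ∈ s, (G.induce s).Reachable x ⟨z, hz⟩} ⟨x, x.2, x.2, Reachable.rfl⟩
        (by
          rintro a ha ⟨_, hra⟩ b hb hab
          exact ⟨hb, hra.trans (Adj.reachable (by simpa using hab))⟩)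
      exact (this y.2).2
    exact (connected_iff _).2 ⟨key, ⟨⟨x, hx⟩⟩⟩
  · intro h
    obtain ⟨⟨x, hx⟩⟩ := h.nonempty
    refine ⟨⟨x, hx⟩, ?_⟩
    rintro U ⟨y, hy, hyU⟩ hcl z hz
    obtain ⟨w⟩ := h.preconnected ⟨y, hy⟩ ⟨z, hz⟩
    have : ∀ {a b : s} (w : (G.induce s).Walk a b), (a : V) ∈ U → (b : V) ∈ U := by
      intro a b w
      induction w with
      | nil => exact id
      | @cons p q r hpq _ ih => exact fun ha => ih (hcl p p.2 ha q q.2 hpq)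
    exact this w hyU

namespace ConnOn

variable {V : Type} {G : SimpleGraph V}

theorem singleton (x : V) : ConnOn G {x} :=
  ⟨⟨x, rfl⟩, by rintro U ⟨y, rfl, hy⟩ _ z rfl; exact hy⟩

theorem union {s t : Set V} (hs : ConnOn G s) (ht : ConnOn G t)
    (h : ∃ x ∈ s, ∃ y ∈ t, x = y ∨ G.Adj x y) : ConnOn G (s ∪ t) := by
  obtain ⟨x, hx, y, hy, hxy⟩ := h
  refine ⟨⟨x, Or.inl hx⟩, ?_⟩
  rintro U ⟨z, hz, hzU⟩ hcl
  have hs' : (∃ a ∈ s, a ∈ U) → s ⊆ U := fun hh => hs.2 U hh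
    fun a ha haU b hb hab => hcl a (Or.inl ha) haU b (Or.inl hb) hab
  have ht' : (∃ a ∈ t, a ∈ U) → t ⊆ U := fun hh => ht.2 U hh
    fun a ha haU b hb hab => hcl a (Or.inr ha) haU b (Or.inr hb) hab
  have hst : x ∈ U ↔ y ∈ U := by
    rcases hxy with rfl | hxy
    · rfl
    · exact ⟨fun h => hcl x (Or.inl hx) h y (Or.inr hy) hxy,
        fun h => hcl y (Or.inr hy) h x (Or.inl hx) hxy.symm⟩
  rcases hz with hz | hz
  · have h1 := hs' ⟨z, hz, hzU⟩
    exact Set.union_subset h1 (ht' ⟨y, hy, hst.1 (h1 hx)⟩)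
  · have h1 := ht' ⟨z, hz, hzU⟩
    exact Set.union_subset (hs' ⟨x, hx, hst.2 (h1 hy)⟩) h1

theorem mono {H : SimpleGraph V} {s : Set V} (hs : ConnOn G s)
    (h : ∀ x ∈ s, ∀ y ∈ s, G.Adj x y → H.Adj x y) : ConnOn H s :=
  ⟨hs.1, fun U hU hcl => hs.2 U hU fun x hx hxU y hy hxy => hcl x hx hxU y hy (h x hx y hy hxy)⟩

/-- A connected set meeting `U` and its complement has an edge leaving `U`. -/
theorem exists_cross {s U : Set V} (hs : ConnOn G s) (h1 : ∃ x ∈ s, x ∈ U)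
    (h2 : ∃ x ∈ s, x ∉ U) : ∃ x ∈ s, x ∈ U ∧ ∃ y ∈ s, y ∉ U ∧ G.Adj x y := by
  by_contra hcon
  push Not at hcon
  obtain ⟨x, hx, hxU⟩ := h2
  refine hxU (hs.2 U h1 (fun a ha haU b hb hab => ?_) hx)
  by_contra hbU
  exact hcon a ha haU b hb hbU hab

end ConnOn

/-- The vertices reachable from `u` by walks whose vertices after `u` avoid `P`. -/
def comp {V : Type} (G : SimpleGraph V) (P : Set V) (u : V) : Set V :=
  {w | Relation.ReflTransGen (fun x y => G.Adj x y ∧ y ∉ P) u w}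

section comp

variable {V : Type} {G : SimpleGraph V} {P : Set V} {u : V}

theorem mem_comp_self : u ∈ comp G P u := Relation.ReflTransGen.refl

theorem comp_closed {x y : V} (hx : x ∈ comp G P u) (hxy : G.Adj x y) (hy : y ∉ P) :
    y ∈ comp G P u := Relation.ReflTransGen.tail hx ⟨hxy, hy⟩

theorem comp_subset {U : Set V} (hu : u ∈ U) (hU : ∀ x ∈ U, ∀ y ∉ P, G.Adj x y → y ∈ U) :
    comp G P u ⊆ U := by
  intro w hw
  induction hw with
  | refl => exact hu
  | tail _ h ih => exact hU _ ih _ h.2 h.1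

theorem comp_disjoint (hu : u ∉ P) {x : V} (hx : x ∈ comp G P u) : x ∉ P :=
  comp_subset (U := Pᶜ) hu (fun _ _ _ h _ => h) hx

theorem comp_connOn : ConnOn G (comp G P u) := by
  have key : ∀ U : Set V, (∀ x ∈ comp G P u, x ∈ U → ∀ y ∈ comp G P u, G.Adj x y → y ∈ U) →
      u ∈ U → comp G P u ⊆ U := by
    intro U hcl hu w hw
    have : comp G P u ⊆ {w | w ∈ U ∧ w ∈ comp G P u} :=
      comp_subset ⟨hu, mem_comp_self⟩ fun x hx y hy hxy =>
        ⟨hcl x hx.2 hx.1 y (comp_closed hx.2 hxy hy) hxy, comp_closed hx.2 hxy hy⟩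
    exact (this hw).1
  refine ⟨⟨u, mem_comp_self⟩, ?_⟩
  rintro U ⟨x, hx, hxU⟩ hcl
  by_cases hu : u ∈ U
  · exact key U hcl hu
  · have := key Uᶜ (fun a ha haU b hb hab hbU => haU (hcl b hb hbU a ha hab.symm)) hu hx
    exact absurd hxU this

theorem subset_comp {D : Set V} (hD : ConnOn G D) (hu : u ∈ D) (hP : ∀ x ∈ D, x ∉ P) :
    D ⊆ comp G P u :=
  hD.2 _ ⟨u, hu, mem_comp_self⟩ fun _ _ hx y hy hxy => comp_closed hx hxy (hP y hy)

theorem comp_symm (hu : u ∉ P) {x : V} (hx : x ∈ comp G P u) : u ∈ comp G P x :=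
  subset_comp comp_connOn hx (fun _ h => comp_disjoint hu h) mem_comp_self

theorem comp_trans {x y : V} (hx : x ∈ comp G P u) (hy : y ∈ comp G P x) : y ∈ comp G P u :=
  Relation.ReflTransGen.trans hx hy

end comp

section Tree

variable {ι : Type} {T : SimpleGraph ι}

theorem exists_path_of_mem_comp {P : Set ι} {u w : ι} (hu : u ∉ P) (hw : w ∈ comp T P u) :
    ∃ p : T.Walk u w, p.IsPath ∧ ∀ z ∈ p.support, z ∉ P := by
  classical
  have : ∃ p : T.Walk u w, ∀ z ∈ p.support, z ∉ P := by
    induction hw with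
    | refl => exact ⟨Walk.nil, by simpa using hu⟩
    | tail _ h ih =>
      obtain ⟨p, hp⟩ := ih
      refine ⟨p.concat h.1, fun z hz => ?_⟩
      rw [Walk.support_concat] at hz
      simp only [List.mem_append, List.mem_singleton] at hz
      rcases hz with hz | rfl
      · exact hp z hz
      · exact h.2
  obtain ⟨p, hp⟩ := this
  exact ⟨p.bypass, p.bypass_isPath, fun z hz => hp z (p.support_bypass_subset_support hz)⟩

/-- In a forest, distinct neighbours of `x` lie in distinct components of `T - x`. -/
theorem eq_of_mem_comp (hT : T.IsAcyclic) {x y y' : ι} (hy : T.Adj x y) (hy' : T.Adj x y')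
    (h : y' ∈ comp T {x} y) : y = y' := by
  obtain ⟨p, hp, hpx⟩ := exists_path_of_mem_comp (by simpa using hy.ne') h
  have h1 : (Walk.cons hy p).IsPath := hp.cons fun hx => hpx x hx rfl
  have h2 : (Walk.cons hy' Walk.nil).IsPath := by simp [hy'.ne]
  have := (hT.subsingleton_path _ _).elim ⟨_, h1⟩ ⟨_, h2⟩
  have h3 : (Walk.cons hy p).support = (Walk.cons hy' Walk.nil).support := by
    rw [congrArg (fun q : T.Path x y' => q.1.support) this]
  have h4 : y ∈ (Walk.cons hy' Walk.nil).support := by rw [← h3]; simp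
  simp only [Walk.support_cons, Walk.support_nil, List.mem_cons, List.not_mem_nil, or_false] at h4
  rcases h4 with h4 | h4
  · exact absurd h4 hy.ne'
  · exact h4

/-- In a forest, the two sides of an edge are disjoint. -/
theorem not_mem_comp_both (hT : T.IsAcyclic) {x y z : ι} (hxy : T.Adj x y)
    (h1 : z ∈ comp T {x} y) (h2 : z ∈ comp T {y} x) : False := by
  obtain ⟨p, hp, hpx⟩ := exists_path_of_mem_comp (by simpa using hxy.ne') h1
  obtain ⟨q, hq, hqy⟩ := exists_path_of_mem_comp (by simpa using hxy.ne) h2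
  have h1 : (Walk.cons hxy p).IsPath := hp.cons fun hx => hpx x hx rfl
  have := (hT.subsingleton_path _ _).elim ⟨_, h1⟩ ⟨_, hq⟩
  have h3 : (Walk.cons hxy p).support = q.support := by
    rw [congrArg (fun q : T.Path x z => q.1.support) this]
  exact hqy y (by rw [← h3]; simp) rfl

/-- In a set connected in a graph, every point other than `x` lies beyond a neighbour of `x`. -/
theorem exists_adj_mem_comp {R : Set ι} (hR : ConnOn T R) {x z : ι} (hx : x ∈ R) (hz : z ∈ R)
    (hxz : z ≠ x) : ∃ y ∈ R, T.Adj x y ∧ z ∈ comp T {x} y := by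
  have := hR.2 {w | w = x ∨ ∃ y ∈ R, T.Adj x y ∧ w ∈ comp T {x} y} ⟨x, hx, Or.inl rfl⟩ (by
    rintro a ha (rfl | ⟨y, hy, hxy, hay⟩) b hb hab
    · exact Or.inr ⟨b, hb, hab, mem_comp_self⟩
    · by_cases hbx : b = x
      · exact Or.inl hbx
      · exact Or.inr ⟨y, hy, hxy, comp_closed hay hab hbx⟩) hz
  exact this.resolve_left hxz

theorem exists_direction (hT : T.IsTree) {S : Set ι} (hS : ConnOn T S) {x : ι} (hx : x ∉ S) :
    ∃ y, T.Adj x y ∧ S ⊆ comp T {x} y := by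
  obtain ⟨z, hz⟩ := hS.1
  have huniv : ConnOn T Set.univ := by
    rw [connOn_iff]
    exact (Iso.connected_iff (induceUnivIso T)).2 hT.connected
  obtain ⟨y, -, hxy, hzy⟩ := exists_adj_mem_comp huniv (Set.mem_univ x) (Set.mem_univ z)
    (fun h => hx (h ▸ hz))
  refine ⟨y, hxy, fun w hw => comp_trans hzy ?_⟩
  exact subset_comp hS hz (fun a ha hax => hx (by rw [← (hax : a = x)]; exact ha)) hw

theorem mem_of_mem_comp (hT : T.IsAcyclic) {R : Set ι} (hR : ConnOn T R) {x y z : ι}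
    (hxy : T.Adj x y) (hx : x ∈ R) (hz : z ∈ R) (hzy : z ∈ comp T {x} y) : y ∈ R := by
  have hyx : y ∉ ({x} : Set ι) := by simpa using hxy.ne'
  have hzx : z ≠ x := comp_disjoint hyx hzy
  obtain ⟨y', hy', hxy', hzy'⟩ := exists_adj_mem_comp hR hx hz hzx
  have hyx' : y' ∉ ({x} : Set ι) := by simpa using hxy'.ne'
  rw [eq_of_mem_comp hT hxy hxy' (comp_trans hzy (comp_symm hyx' hzy'))]
  exact hy'

/-- A map sending every node of a finite tree to a neighbour flips some edge. -/
theorem exists_flip [Finite ι] (hT : T.IsTree) (f : ι → ι) (hf : ∀ x, T.Adj x (f x)) :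
    ∃ x, f (f x) = x := by
  classical
  have := Fintype.ofFinite ι
  have hcard := hT.card_edgeFinset
  obtain ⟨x, -, y, -, hne, hxy⟩ := Finset.exists_ne_map_eq_of_card_lt_of_maps_to
    (s := (Finset.univ : Finset ι)) (t := T.edgeFinset) (f := fun x => s(x, f x))
    (by rw [Finset.card_univ]; omega) (by intro x _; simpa using hf x)
  simp only [Sym2.eq_iff] at hxy
  rcases hxy with ⟨h, -⟩ | ⟨h1, h2⟩
  · exact absurd h hne
  · exact ⟨x, by rw [h2, ← h1]⟩

/-- Helly property for subtrees. -/
theorem tree_helly [Finite ι] (hT : T.IsTree) {κ : Type} (S : κ → Set ι)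
    (hS : ∀ k, ConnOn T (S k)) (hint : ∀ k l, (S k ∩ S l).Nonempty) : ∃ x, ∀ k, x ∈ S k := by
  by_contra hcon
  push Not at hcon
  choose k hk using hcon
  choose f hf hfS using fun x => exists_direction hT (hS (k x)) (hk x)
  obtain ⟨x, hx⟩ := exists_flip hT f hf
  obtain ⟨z, hz1, hz2⟩ := hint (k x) (k (f x))
  have h2 := hfS (f x) hz2
  rw [hx] at h2
  exact not_mem_comp_both hT.isAcyclic (hf x) (hfS x hz1) h2

/-- If at every node of `Z` two of three pairwise compatible subtrees avoiding the node lie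
beyond the same neighbour and this neighbour is in `Z`, then `Z` is empty. -/
theorem tree_no_drift [Finite ι] (hT : T.IsTree) (Z : Set ι) (Q : ι → Fin 3 → Set ι)
    (hconn : ∀ x ∈ Z, ∀ i, ConnOn T (Q x i) ∧ x ∉ Q x i)
    (hint : ∀ x ∈ Z, ∀ y ∈ Z, ∀ i, (Q x i ∩ Q y i).Nonempty)
    (hstep : ∀ x ∈ Z, ∀ y : Fin 3 → ι, (∀ i, T.Adj x (y i) ∧ Q x i ⊆ comp T {x} (y i)) →
      ∃ i j, i ≠ j ∧ y i = y j ∧ y i ∈ Z) : Z = ∅ := by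
  classical
  by_contra hne
  obtain ⟨z₀, hz₀⟩ := Set.nonempty_iff_ne_empty.2 hne
  have hstep' : ∀ x, ∃ y, T.Adj x y ∧ (x ∈ Z → y ∈ Z ∧ ∃ i j, i ≠ j ∧
      Q x i ⊆ comp T {x} y ∧ Q x j ⊆ comp T {x} y) := by
    intro x
    by_cases hx : x ∈ Z
    · choose y hy using fun i => exists_direction hT (hconn x hx i).1 (hconn x hx i).2
      obtain ⟨i, j, hij, hyij, hyZ⟩ := hstep x hx y hy
      exact ⟨y i, (hy i).1, fun _ => ⟨hyZ, i, j, hij, (hy i).2, hyij ▸ (hy j).2⟩⟩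
    · obtain ⟨y, hy, -⟩ := exists_direction hT (ConnOn.singleton (G := T) z₀) (x := x)
        (fun h => hx ((h : x = z₀) ▸ hz₀))
      exact ⟨y, hy, fun h => absurd h hx⟩
  choose f hf hfZ using hstep'
  have hiter : ∃ x, x ∈ Z ∧ f (f x) = x := by
    choose! d hd using fun x (hx : x ∉ Z) => exists_direction hT (ConnOn.singleton (G := T) z₀)
      (x := x) (fun h => hx ((h : x = z₀) ▸ hz₀))
    obtain ⟨x, hx⟩ := exists_flip hT (fun x => if x ∈ Z then f x else d x) (by
      intro x
      by_cases hx : x ∈ Z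
      · simpa [hx] using hf x
      · simpa [hx] using (hd x hx).1)
    by_cases hxZ : x ∈ Z
    · have := (hfZ x hxZ).1
      exact ⟨x, hxZ, by simpa [hxZ, this] using hx⟩
    · exfalso
      simp only [hxZ, if_false] at hx
      by_cases hdZ : d x ∈ Z
      · simp only [hdZ, if_true] at hx
        exact hxZ (hx ▸ (hfZ _ hdZ).1)
      · simp only [hdZ, if_false] at hx
        have h1 := (hd x hxZ).2 rfl
        have h2 := (hd (d x) hdZ).2 rfl
        rw [hx] at h2
        exact not_mem_comp_both hT.isAcyclic (hd x hxZ).1 h1 h2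
  obtain ⟨x, hxZ, hx⟩ := hiter
  obtain ⟨hfx, i, j, hij, hi, hj⟩ := hfZ x hxZ
  obtain ⟨-, i', j', hij', hi', hj'⟩ := hfZ (f x) hfx
  rw [hx] at hi' hj'
  have key : ∀ i, Q x i ⊆ comp T {x} (f x) → Q (f x) i ⊆ comp T {f x} x → False := by
    intro i h1 h2
    obtain ⟨z, hz1, hz2⟩ := hint x hxZ (f x) hfx i
    exact not_mem_comp_both hT.isAcyclic (hf x) (h1 hz1) (h2 hz2)
  have : i = i' ∨ i = j' ∨ j = i' ∨ j = j' := by omega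
  rcases this with rfl | rfl | rfl | rfl
  · exact key _ hi hi'
  · exact key _ hi hj'
  · exact key _ hj hi'
  · exact key _ hj hj'

end Tree

theorem TwoConnected.connOn {V : Type} {G : SimpleGraph V} (hG : TwoConnected G) (v : V) :
    ConnOn G {x | x ≠ v} := connOn_iff.2 (hG.2 v)

/-- In a 2-connected graph every component of `G - {p, q}` is attached to `p`. -/
theorem TwoConnected.exists_adj_comp {V : Type} {G : SimpleGraph V} (hG : TwoConnected G)
    {p q z : V} {P : Set V} (hpq : p ≠ q) (hP : P ⊆ {p, q}) (hp : p ∈ P) (hz : z ∉ P)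
    (hzq : z ≠ q) : ∃ u ∈ comp G P z, G.Adj u p := by
  obtain ⟨x, _, hxK, y, hy, hyK, hxy⟩ := (hG.connOn q).exists_cross (U := comp G P z)
    ⟨z, hzq, mem_comp_self⟩ ⟨p, hpq, fun h => comp_disjoint hz h hp⟩
  have hyP : y ∈ P := by
    by_contra hyP
    exact hyK (comp_closed hxK hxy hyP)
  rcases hP hyP with rfl | rfl
  · exact ⟨x, hxK, hxy⟩
  · exact absurd rfl hy

namespace TreeDecomp

variable {V : Type} {G : SimpleGraph V} (td : TreeDecomp G)

/-- The nodes whose bags meet `D`. -/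
def nodes (D : Set V) : Set td.ι := {x | ∃ v ∈ D, v ∈ td.bag x}

variable {td}

theorem nodes_connOn {D : Set V} (hD : ConnOn G D) : ConnOn td.tree (td.nodes D) := by
  obtain ⟨v, hv⟩ := hD.1
  obtain ⟨x, hx⟩ := td.bag_cover v
  refine ⟨⟨x, v, hv, hx⟩, ?_⟩
  rintro U ⟨y, ⟨w, hw, hwy⟩, hyU⟩ hcl
  have key : ∀ u ∈ D, (∃ z, u ∈ td.bag z ∧ z ∈ U) → {z | u ∈ td.bag z} ⊆ U := by
    rintro u hu ⟨z, hz, hzU⟩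
    exact (connOn_iff.2 (td.bag_conn u)).2 U ⟨z, hz, hzU⟩
      fun a ha haU b hb hab => hcl a ⟨u, hu, ha⟩ haU b ⟨u, hu, hb⟩ hab
  have hall : D ⊆ {u | {z | u ∈ td.bag z} ⊆ U} :=
    hD.2 _ ⟨w, hw, key w hw ⟨y, hwy, hyU⟩⟩ fun u hu huU u' hu' huu' => by
      obtain ⟨z, hz, hz'⟩ := td.bag_edge huu'
      exact key u' hu' ⟨z, hz', huU hz⟩
  rintro z ⟨u, hu, huz⟩
  exact hall hu huz

theorem nodes_inter {D E : Set V} (h : ∃ u ∈ D, ∃ v ∈ E, u = v ∨ G.Adj u v) :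
    (td.nodes D ∩ td.nodes E).Nonempty := by
  obtain ⟨u, hu, v, hv, rfl | huv⟩ := h
  · obtain ⟨x, hx⟩ := td.bag_cover u
    exact ⟨x, ⟨u, hu, hx⟩, ⟨u, hv, hx⟩⟩
  · obtain ⟨x, hx, hx'⟩ := td.bag_edge huv
    exact ⟨x, ⟨u, hu, hx⟩, ⟨v, hv, hx'⟩⟩

/-- Pairwise touching, pairwise disjoint connected sets all meet a common bag. -/
theorem exists_injective_bag {n : ℕ} (f : Fin n → Set V) (hf : ∀ i, ConnOn G (f i))
    (hdisj : ∀ i j, i ≠ j → Disjoint (f i) (f j))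
    (hadj : ∀ i j, i ≠ j → ∃ u ∈ f i, ∃ v ∈ f j, G.Adj u v) :
    ∃ x, ∃ l : Fin n → V, Function.Injective l ∧ ∀ i, l i ∈ f i ∧ l i ∈ td.bag x := by
  have := td.finι
  obtain ⟨x, hx⟩ := tree_helly td.isTree (fun i => td.nodes (f i)) (fun i => nodes_connOn (hf i))
    (fun i j => by
      rcases eq_or_ne i j with rfl | hij
      · obtain ⟨u, hu⟩ := (hf i).1
        exact nodes_inter ⟨u, hu, u, hu, Or.inl rfl⟩
      · obtain ⟨u, hu, v, hv, huv⟩ := hadj i j hij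
        exact nodes_inter ⟨u, hu, v, hv, Or.inr huv⟩)
  choose l hl hlx using hx
  refine ⟨x, l, fun i j hij => ?_, fun i => ⟨hl i, hlx i⟩⟩
  by_contra hne
  exact Set.disjoint_left.1 (hdisj i j hne) (hl i) (hij ▸ hl j)

theorem le_ncard_of_injective [Finite V] {n : ℕ} {s : Set V} (l : Fin n → V)
    (hl : Function.Injective l) (hs : ∀ i, l i ∈ s) : n ≤ s.ncard := by
  have h1 : (Set.range l).ncard = n := by
    rw [← Set.image_univ, Set.ncard_image_of_injective _ hl, Set.ncard_univ, Nat.card_fin]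
  rw [← h1]
  exact Set.ncard_le_ncard (Set.range_subset_iff.2 hs)

theorem exists_three_le_ncard [Finite V] (hG : TwoConnected G) (td : TreeDecomp G) :
    ∃ x, 3 ≤ (td.bag x).ncard := by
  have := Fintype.ofFinite V
  obtain ⟨v, p, q, hvp, hvq, hpq⟩ := (Fintype.two_lt_card_iff (α := V)).1
    (by rw [← Nat.card_eq_fintype_card]; exact hG.1)
  obtain ⟨x, hx, hxv⟩ := hG.exists_adj_comp (p := v) (q := p) (P := {v}) hvp (by simp) rfl
    (z := q) (by simpa using hvq.symm) hpq.symm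
  have hxv' : x ≠ v := hxv.ne
  obtain ⟨z, hzv, hzx⟩ : ∃ z, z ≠ v ∧ z ≠ x := by
    rcases eq_or_ne x p with rfl | h
    · exact ⟨q, hvq.symm, hpq.symm⟩
    · exact ⟨p, hvp.symm, h.symm⟩
  have hz : z ∉ ({v, x} : Set V) := by simp [hzv, hzx]
  obtain ⟨u, hu, huv⟩ := hG.exists_adj_comp (P := {v, x}) hxv'.symm subset_rfl (by simp) hz hzx
  obtain ⟨w, hw, hwx⟩ := hG.exists_adj_comp (P := {v, x}) hxv' (by rw [Set.pair_comm]) (by simp)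
    hz hzv
  have hK := fun y => comp_disjoint (G := G) (x := y) hz
  obtain ⟨n, l, hl, hln⟩ := exists_injective_bag (td := td) (n := 3)
    ![{v}, {x}, comp G {v, x} z]
    (by intro i; fin_cases i
        exacts [ConnOn.singleton v, ConnOn.singleton x, comp_connOn])
    (by
      have h1 : Disjoint {v} (comp G {v, x} z) := by
        rw [Set.disjoint_singleton_left]; exact fun h => hK v h (by simp)
      have h2 : Disjoint {x} (comp G {v, x} z) := by
        rw [Set.disjoint_singleton_left]; exact fun h => hK x h (by simp)
      intro i j hij
      fin_cases i <;> fin_cases j <;>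
        first | exact absurd rfl hij | exact h1 | exact h2 | exact h1.symm | exact h2.symm |
          simp [hxv', hxv'.symm])
    (by
      intro i j hij
      fin_cases i <;> fin_cases j
      exacts [absurd rfl hij, ⟨v, rfl, x, rfl, hxv.symm⟩, ⟨v, rfl, u, hu, huv.symm⟩,
        ⟨x, rfl, v, rfl, hxv⟩, absurd rfl hij, ⟨x, rfl, w, hw, hwx.symm⟩, ⟨u, hu, v, rfl, huv⟩,
        ⟨w, hw, x, rfl, hwx⟩, absurd rfl hij])
  exact ⟨n, le_ncard_of_injective l hl fun i => (hln i).2⟩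

end TreeDecomp

theorem TreeDecomp.not_isMinorOf_K4 {V : Type} [Finite V] {G : SimpleGraph V} (td : TreeDecomp G)
    (hw : ∀ x, (td.bag x).ncard ≤ 3) : ¬ IsMinorOf K4 G := by
  rintro ⟨f, -, hconn, hdisj, hadj⟩
  obtain ⟨x, l, hl, hlx⟩ := exists_injective_bag (td := td) f (fun i => connOn_iff.2 (hconn i))
    (fun i j hij => hdisj hij) (fun i j hij => hadj (by simpa [K4] using hij))
  have := le_ncard_of_injective l hl fun i => (hlx i).2
  have := hw x
  omega

/-- Enlarge `D` inside `L` until it touches the vertex `l` of `L`. -/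
theorem ConnOn.extend_to {V : Type} {G : SimpleGraph V} {D L : Set V} (hD : ConnOn G D)
    (hL : ConnOn G L) {l : V} (hl : l ∈ L) (h : ∃ u ∈ D, ∃ w ∈ L, G.Adj u w) :
    ∃ E, D ⊆ E ∧ E ⊆ D ∪ (L \ {l}) ∧ ConnOn G E ∧ ∃ e ∈ E, G.Adj e l := by
  obtain ⟨u, hu, w, hw, huw⟩ := h
  rcases eq_or_ne w l with rfl | hwl
  · exact ⟨D, subset_rfl, Set.subset_union_left, hD, u, hu, huw⟩
  have hwP : w ∉ Lᶜ ∪ {l} := by simp [hw, hwl]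
  obtain ⟨x, _, hxC, y, hyL, hyC, hxy⟩ := hL.exists_cross (U := comp G (Lᶜ ∪ {l}) w)
    ⟨w, hw, mem_comp_self⟩ ⟨l, hl, fun h => comp_disjoint hwP h (Or.inr rfl)⟩
  have hyl : y = l := by
    by_contra hyl
    exact hyC (comp_closed hxC hxy (by simp [hyL, hyl]))
  refine ⟨D ∪ comp G (Lᶜ ∪ {l}) w, Set.subset_union_left, ?_,
    hD.union comp_connOn ⟨u, hu, w, mem_comp_self, Or.inr huw⟩, x, Or.inr hxC, hyl ▸ hxy⟩
  refine Set.union_subset_union_right _ fun z hz => ?_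
  have := comp_disjoint hwP hz
  simp only [Set.mem_union, Set.mem_compl_iff, not_or, not_not] at this
  exact this

theorem exists_ne_iff_iff (p : Fin 3 → Prop) : ∃ i j, i ≠ j ∧ (p i ↔ p j) := by
  by_contra hcon
  push Not at hcon
  have h1 := hcon 0 1 (by decide)
  have h2 := hcon 0 2 (by decide)
  have h3 := hcon 1 2 (by decide)
  tauto

theorem fin_three_cases {i j : Fin 3} (hij : i ≠ j) : ∃ k, k ≠ i ∧ k ≠ j ∧
    ∀ m, m = i ∨ m = j ∨ m = k := by
  revert i j; decide

theorem DirSpaghettiTD.not_isMinorOf_S3 {V : Type} [Finite V] {G : SimpleGraph V}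
    (td : DirSpaghettiTD G) (hw : ∀ x, (td.bag x).ncard ≤ 3) : ¬ IsMinorOf S3 G := by
  rintro ⟨f, -, hconn, hdisj, hadj⟩
  have := td.finι
  have hconn' := fun i => connOn_iff.2 (hconn i)
  have hdisj' : ∀ i j v, v ∈ f i → v ∈ f j → i = j := by
    intro i j v hi hj
    by_contra hij
    exact Set.disjoint_left.1 (hdisj hij) hi hj
  let c : Fin 3 → Fin 6 := ![1, 3, 5]
  let d : Fin 3 → Fin 6 := ![4, 0, 2]
  have hc : Function.Injective c := by decide
  have hdc : ∀ i j, d i ≠ c j := by decide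
  have hcc : ∀ i j, i ≠ j → S3.Adj (c i) (c j) := by unfold S3; decide
  have hdca : ∀ i j, i ≠ j → S3.Adj (d i) (c j) := by unfold S3; decide
  obtain ⟨x₀, l, hl, hlx⟩ := TreeDecomp.exists_injective_bag (td := td.toTreeDecomp)
    (fun i => f (c i)) (fun i => hconn' (c i)) (fun i j hij => hdisj (hc.ne hij))
    (fun i j hij => hadj (hcc i j hij))
  have hK : ∀ i, ∃ K, ConnOn G K ∧ (∀ j, l j ∉ K) ∧ ∀ j, j ≠ i → ∃ u ∈ K, G.Adj u (l j) := by
    intro i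
    obtain ⟨j, hji⟩ : ∃ j, j ≠ i := exists_ne i
    obtain ⟨k, hkj, hki, hall⟩ := fin_three_cases hji
    obtain ⟨E, hDE, hE, hEc, e, heE, he⟩ := (hconn' (d i)).extend_to (hconn' (c j)) (hlx j).1
      (hadj (hdca i j hji.symm))
    obtain ⟨u, hu, w, hw', huw⟩ := hadj (hdca i k hki.symm)
    obtain ⟨E', hEE', hE', hEc', e', heE', he'⟩ := hEc.extend_to (hconn' (c k)) (hlx k).1
      ⟨u, hDE hu, w, hw', huw⟩
    refine ⟨E', hEc', fun m hm => ?_, fun m hmi => ?_⟩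
    · have hcase : ∀ n, l m ∈ f (c n) → l m ≠ l n → False := fun n h1 h2 =>
        h2 (congrArg l (hc (hdisj' _ _ _ (hlx m).1 h1)))
      rcases hE' hm with h | h
      · rcases hE h with h | h
        · exact hdc _ _ (hdisj' _ _ _ h (hlx m).1)
        · exact hcase j h.1 h.2
      · exact hcase k h.1 h.2
    · rcases hall m with rfl | rfl | rfl
      · exact ⟨e, hEE' heE, he⟩
      · exact absurd rfl hmi
      · exact ⟨e', heE', he'⟩
  choose K hKc hKl hKa using hK
  have hbag : ∀ x, (∀ i, l i ∈ td.bag x) → td.bag x = Set.range l := by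
    intro x hx
    refine (Set.eq_of_subset_of_ncard_le (Set.range_subset_iff.2 hx) ?_).symm
    refine (hw x).trans (TreeDecomp.le_ncard_of_injective l hl fun i => ⟨i, rfl⟩)
  have hR := fun j => connOn_iff.2 (td.bag_conn (l j))
  have hZ := tree_no_drift td.isTree {x | ∀ i, l i ∈ td.bag x}
    (fun _ i => td.toTreeDecomp.nodes (K i)) (fun x hx i => ⟨TreeDecomp.nodes_connOn (hKc i), by
      rintro ⟨v, hv, hvx⟩
      rw [hbag x hx] at hvx
      obtain ⟨j, rfl⟩ := hvx
      exact hKl i j hv⟩)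
    (fun x _ y _ i => by
      obtain ⟨v, hv⟩ := (hKc i).1
      exact TreeDecomp.nodes_inter ⟨v, hv, v, hv, Or.inl rfl⟩)
    (fun x hx y hy => by
      have hmem : ∀ i j, j ≠ i → l j ∈ td.bag (y i) := by
        intro i j hji
        obtain ⟨u, hu, hul⟩ := hKa i j hji
        obtain ⟨z, hz, w, hw', hwz⟩ := TreeDecomp.nodes_inter (td := td.toTreeDecomp) (D := K i)
          (E := {l j}) ⟨u, hu, l j, rfl, Or.inr hul⟩
        obtain rfl : w = l j := hw'
        exact mem_of_mem_comp td.isTree.isAcyclic (hR j) (hy i).1 (hx j) hwz ((hy i).2 hz)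
      by_contra hcon
      push Not at hcon
      have hinj : ∀ i j, i ≠ j → y i ≠ y j := by
        intro i j hij h
        refine hcon i j hij h fun k => ?_
        rcases eq_or_ne k i with rfl | hki
        · exact h ▸ hmem j k hij
        · exact hmem i k hki
      obtain ⟨i, j, hij, ho⟩ := exists_ne_iff_iff fun i => td.orient x (y i)
      obtain ⟨k, hki, hkj, -⟩ := fin_three_cases hij
      have := td.bag_dirpath (l k)
      have hi := (td.orient_iff x (y i)).1 (hy i).1
      have hj := (td.orient_iff x (y j)).1 (hy j).1
      by_cases h : td.orient x (y i)
      · exact hinj i j hij ((Set.ncard_le_one_iff (Set.toFinite _)).1 (this.2.1 x (hx k))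
          ⟨hmem i k hki, h⟩ ⟨hmem j k hkj, ho.1 h⟩)
      · exact hinj i j hij ((Set.ncard_le_one_iff (Set.toFinite _)).1 (this.2.2 x (hx k))
          ⟨hmem i k hki, hi.resolve_left h⟩ ⟨hmem j k hkj, hj.resolve_left fun h' => h (ho.2 h')⟩))
  exact (Set.eq_empty_iff_forall_notMem.1 hZ) x₀ fun i => (hlx i).2

theorem ConnOn.exists_diff_singleton {V : Type} [Finite V] {G : SimpleGraph V} {F : Set V}
    (hF : ConnOn G F) (hcard : 2 ≤ F.ncard) : ∃ v ∈ F, ConnOn G (F \ {v}) := by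
  obtain ⟨x, hx⟩ := hF.1
  have hx1 : ({x} : Set V).ncard = 1 := Set.ncard_singleton x
  obtain ⟨W, ⟨hWF, hWc, hWne⟩, hmax⟩ := (Set.toFinite {W : Set V | W ⊆ F ∧ ConnOn G W ∧
    W ≠ F}).exists_maximalFor Set.ncard _ ⟨{x}, by simpa using hx, ConnOn.singleton x, by
      rintro rfl; omega⟩
  obtain ⟨z, hz, hzW⟩ := Set.exists_of_ssubset (hWF.ssubset_of_ne hWne)
  obtain ⟨w, hw⟩ := hWc.1
  obtain ⟨a, ha, haW, b, hb, hbW, hab⟩ := hF.exists_cross (U := W) ⟨w, hWF hw, hw⟩ ⟨z, hz, hzW⟩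
  have hins : W ∪ {b} = F := by
    by_contra hne
    have := hmax ⟨Set.union_subset hWF (by simpa using hb),
      hWc.union (ConnOn.singleton b) ⟨a, haW, b, rfl, Or.inr hab⟩, hne⟩
      (Set.ncard_le_ncard Set.subset_union_left)
    have h2 : (insert b W).ncard = W.ncard + 1 := Set.ncard_insert_of_notMem hbW
    rw [Set.union_singleton] at this
    omega
  refine ⟨b, hb, ?_⟩
  rw [← hins, Set.union_sdiff_right, Set.sdiff_singleton_eq_self hbW]
  exact hWc

/-- A connected set touching three pairwise disjoint connected sets can be traded for a single
vertex by enlarging the latter. -/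
theorem exists_tripod {V : Type} [Finite V] {G : SimpleGraph V} (n : ℕ) :
    ∀ (F : Set V) (A : Fin 3 → Set V), F.ncard ≤ n → ConnOn G F → (∀ i, ConnOn G (A i)) →
    (∀ i, Disjoint F (A i)) → (∀ i j, i ≠ j → Disjoint (A i) (A j)) →
    (∀ i, ∃ u ∈ F, ∃ v ∈ A i, G.Adj u v) →
    ∃ a ∈ F, ∃ A' : Fin 3 → Set V, (∀ i, A i ⊆ A' i ∧ A' i ⊆ A i ∪ F ∧ ConnOn G (A' i) ∧
      a ∉ A' i ∧ ∃ v ∈ A' i, G.Adj a v) ∧ ∀ i j, i ≠ j → Disjoint (A' i) (A' j) := by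
  classical
  induction n with
  | zero =>
    intro F A hn hF
    have := (Set.ncard_pos (Set.toFinite F)).2 hF.1
    omega
  | succ n ih =>
    intro F A hn hF hA hFA hAA hadj
    have haF : ∀ i, ∀ a ∈ F, a ∉ A i := fun i a ha => Set.disjoint_left.1 (hFA i) ha
    rcases Nat.lt_or_ge F.ncard 2 with hlt | hge
    · obtain ⟨a, ha⟩ := hF.1
      refine ⟨a, ha, A, fun i => ⟨subset_rfl, Set.subset_union_left, hA i, haF i a ha, ?_⟩, hAA⟩
      obtain ⟨u, hu, v, hv, huv⟩ := hadj i
      obtain rfl : u = a := (Set.ncard_le_one_iff (Set.toFinite F)).1 (by omega) hu ha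
      exact ⟨v, hv, huv⟩
    obtain ⟨v, hv, hFv⟩ := hF.exists_diff_singleton hge
    have hcard : (F \ {v}).ncard ≤ n := by
      have := Set.ncard_sdiff_singleton_add_one hv (Set.toFinite F)
      omega
    have hdep : ∀ i, (¬ ∃ u ∈ F \ {v}, ∃ w ∈ A i, G.Adj u w) → ∃ w ∈ A i, G.Adj v w := by
      intro i hi
      obtain ⟨u, hu, w, hw, huw⟩ := hadj i
      by_cases huv : u = v
      · exact ⟨w, hw, huv ▸ huw⟩
      · exact absurd ⟨u, ⟨hu, huv⟩, w, hw, huw⟩ hi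
    obtain ⟨y, hy⟩ := hFv.1
    obtain ⟨p, hp, hpv, q, hq, hqv, hpq⟩ := hF.exists_cross (U := {v}) ⟨v, hv, rfl⟩ ⟨y, hy⟩
    obtain rfl : p = v := hpv
    by_cases hone : ∃ i₀, ∀ i, i ≠ i₀ → ∃ u ∈ F \ {p}, ∃ w ∈ A i, G.Adj u w
    · obtain ⟨i₀, hi₀⟩ := hone
      by_cases h0 : ∃ u ∈ F \ {p}, ∃ w ∈ A i₀, G.Adj u w
      · obtain ⟨a, ha, A', h1, h2⟩ := ih (F \ {p}) A hcard hFv hA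
          (fun i => (hFA i).mono_left Set.sdiff_subset) hAA (fun i => by
            by_cases hi : i = i₀
            · exact hi ▸ h0
            · exact hi₀ i hi)
        exact ⟨a, ha.1, A', fun i => ⟨(h1 i).1, (h1 i).2.1.trans
          (Set.union_subset_union_right _ Set.sdiff_subset), (h1 i).2.2⟩, h2⟩
      · obtain ⟨w₀, hw₀, hvw₀⟩ := hdep i₀ h0
        have hsub : ∀ i, A i ⊆ Function.update A i₀ (A i₀ ∪ {p}) i := by
          intro i
          by_cases hi : i = i₀
          · subst hi; simp
          · simp [hi]
        have hsub' : ∀ i, Function.update A i₀ (A i₀ ∪ {p}) i ⊆ A i ∪ {p} := by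
          intro i
          by_cases hi : i = i₀
          · subst hi; simp
          · simp [hi]
        obtain ⟨a, ha, A', h1, h2⟩ := ih (F \ {p}) (Function.update A i₀ (A i₀ ∪ {p})) hcard hFv
          (fun i => by
            by_cases hi : i = i₀
            · subst hi
              simpa using (hA i).union (ConnOn.singleton p) ⟨w₀, hw₀, p, rfl, Or.inr hvw₀.symm⟩
            · simpa [hi] using hA i)
          (fun i => by
            refine Set.disjoint_left.2 fun x hx hxi => ?_
            rcases hsub' i hxi with h | h
            · exact haF i x hx.1 h
            · exact hx.2 h)
          (fun i j hij => by
            refine Set.disjoint_left.2 fun x hxi hxj => ?_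
            by_cases hi : i = i₀
            · subst hi
              rw [Function.update_of_ne hij.symm] at hxj
              rcases hsub' i hxi with h | h
              · exact Set.disjoint_left.1 (hAA i j hij) h hxj
              · exact haF j x (by rwa [(h : x = p)]) hxj
            · rw [Function.update_of_ne hi] at hxi
              rcases hsub' j hxj with h | h
              · exact Set.disjoint_left.1 (hAA i j hij) hxi h
              · exact haF i x (by rwa [(h : x = p)]) hxi)
          (fun i => by
            by_cases hi : i = i₀
            · subst hi
              exact ⟨q, ⟨hq, hqv⟩, p, by simp, hpq.symm⟩
            · obtain ⟨u, hu, w, hw, huw⟩ := hi₀ i hi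
              exact ⟨u, hu, w, hsub i hw, huw⟩)
        refine ⟨a, ha.1, A', fun i => ⟨(hsub i).trans (h1 i).1, ?_, (h1 i).2.2⟩, h2⟩
        refine (h1 i).2.1.trans (Set.union_subset ((hsub' i).trans ?_) ?_)
        · exact Set.union_subset_union_right _ (by simpa using hv)
        · exact Set.sdiff_subset.trans Set.subset_union_right
    · push Not at hone
      obtain ⟨i, -, hi⟩ := hone 0
      obtain ⟨j, hji, hj⟩ := hone i
      obtain ⟨k, hkj, hki, hall⟩ := fin_three_cases hji
      have hi' := hdep i (by push Not; exact hi)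
      have hj' := hdep j (by push Not; exact hj)
      by_cases hk : ∃ w ∈ A k, G.Adj p w
      · refine ⟨p, hv, A, fun m => ⟨subset_rfl, Set.subset_union_left, hA m, haF m p hv, ?_⟩, hAA⟩
        rcases hall m with rfl | rfl | rfl
        exacts [hj', hi', hk]
      · obtain ⟨u, hu, w, hw, huw⟩ := hadj k
        have hup : u ≠ p := by
          rintro rfl; exact hk ⟨w, hw, huw⟩
        refine ⟨p, hv, Function.update A k (A k ∪ F \ {p}), fun m => ?_, ?_⟩
        · by_cases hm : m = k
          · subst hm
            simp only [Function.update_self]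
            refine ⟨Set.subset_union_left, Set.union_subset_union_right _ Set.sdiff_subset,
              (hA m).union hFv ⟨w, hw, u, ⟨hu, hup⟩, Or.inr huw.symm⟩, ?_, q, Or.inr ⟨hq, hqv⟩, hpq⟩
            rintro (h | h)
            · exact haF m p hv h
            · exact h.2 rfl
          · rw [Function.update_of_ne hm]
            refine ⟨subset_rfl, Set.subset_union_left, hA m, haF m p hv, ?_⟩
            rcases hall m with rfl | rfl | rfl
            exacts [hj', hi', absurd rfl hm]
        · have hd : ∀ m, m ≠ k → Disjoint (A m) (A k ∪ F \ {p}) := fun m hm =>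
            Set.disjoint_union_right.2 ⟨hAA m k hm, (hFA m).symm.mono_right Set.sdiff_subset⟩
          intro m m' hmm
          by_cases hm : m = k
          · subst hm
            rw [Function.update_self, Function.update_of_ne hmm.symm]
            exact (hd m' hmm.symm).symm
          · rw [Function.update_of_ne hm]
            by_cases hm' : m' = k
            · subst hm'
              rw [Function.update_self]
              exact hd m hm
            · rw [Function.update_of_ne hm']
              exact hAA _ _ hmm

/-- A connected set meeting both sides of an edge `xy` of a tree contains `x`. -/
theorem mem_of_meets_both {ι : Type} {T : SimpleGraph ι} (hT : T.IsTree) {R : Set ι}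
    (hR : ConnOn T R) {x y z w : ι} (hxy : T.Adj x y) (hz : z ∈ R) (hzy : z ∈ comp T {x} y)
    (hw : w ∈ R) (hwx : w ∈ comp T {y} x) : x ∈ R := by
  by_contra hx
  obtain ⟨y', hxy', hRy'⟩ := exists_direction hT hR hx
  have hyx' : y' ∉ ({x} : Set ι) := by simpa using hxy'.ne'
  obtain rfl := eq_of_mem_comp hT.isAcyclic hxy hxy'
    (comp_trans hzy (comp_symm hyx' (hRy' hz)))
  exact not_mem_comp_both hT.isAcyclic hxy (hRy' hw) hwx

/-- Two disjoint subtrees are separated by an edge leaving the first one. -/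
theorem exists_separating_edge {ι : Type} [Finite ι] {T : SimpleGraph ι} (hT : T.IsTree)
    {A B : Set ι} (hA : ConnOn T A) (hB : ConnOn T B) (hAB : ∀ x ∈ A, x ∉ B) :
    ∃ x ∈ A, ∃ y, T.Adj x y ∧ B ⊆ comp T {x} y ∧ A ⊆ comp T {y} x := by
  classical
  have h : ∀ x, ∃ y, T.Adj x y ∧ (x ∈ A → B ⊆ comp T {x} y) ∧ (x ∉ A → A ⊆ comp T {x} y) := by
    intro x
    by_cases hx : x ∈ A
    · obtain ⟨y, hy, hBy⟩ := exists_direction hT hB (hAB x hx)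
      exact ⟨y, hy, fun _ => hBy, fun h => absurd hx h⟩
    · obtain ⟨y, hy, hAy⟩ := exists_direction hT hA hx
      exact ⟨y, hy, fun h => absurd h hx, fun _ => hAy⟩
  choose f hf hfB hfA using h
  obtain ⟨x, hx⟩ := exists_flip hT f hf
  obtain ⟨a, ha⟩ := hA.1
  obtain ⟨b, hb⟩ := hB.1
  have hkey := fun z => not_mem_comp_both (z := z) hT.isAcyclic (hf x)
  by_cases hxA : x ∈ A <;> by_cases hyA : f x ∈ A
  · have := hfB _ hyA
    rw [hx] at this
    exact (hkey b (hfB x hxA hb) (this hb)).elim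
  · have := hfA _ hyA
    rw [hx] at this
    exact ⟨x, hxA, f x, hf x, hfB x hxA, this⟩
  · have := hfB _ hyA
    rw [hx] at this
    exact ⟨f x, hyA, x, (hf x).symm, this, hfA x hxA⟩
  · have := hfA _ hyA
    rw [hx] at this
    exact (hkey a (hfA x hxA ha) (this ha)).elim

theorem DirSpaghettiTD.not_isMinorOf_D3 {V : Type} [Finite V] {G : SimpleGraph V}
    (td : DirSpaghettiTD G) (hw : ∀ x, (td.bag x).ncard ≤ 3) : ¬ IsMinorOf D3 G := by
  classical
  rintro ⟨f, -, hconn, hdisj, hadj⟩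
  have := td.finι
  have hconn' := fun i => connOn_iff.2 (hconn i)
  let c : Fin 3 → Fin 8 := ![2, 4, 6]
  let d : Fin 3 → Fin 8 := ![3, 5, 7]
  have hc : Function.Injective c := by decide
  have hd : Function.Injective d := by decide
  have hcd : ∀ i j, c i ≠ d j := by decide
  have h0c : ∀ i, 0 ≠ c i := by decide
  have h0d : ∀ i, 0 ≠ d i := by decide
  have h1c : ∀ i, 1 ≠ c i := by decide
  have h1d : ∀ i, 1 ≠ d i := by decide
  have a0 : ∀ i, D3.Adj 0 (c i) := by unfold D3; decide
  have a1 : ∀ i, D3.Adj 1 (d i) := by unfold D3; decide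
  have acd : ∀ i, D3.Adj (c i) (d i) := by unfold D3; decide
  obtain ⟨a, haF, A, hA, hAA⟩ := exists_tripod _ (f 0) (fun i => f (c i)) le_rfl (hconn' 0)
    (fun i => hconn' _) (fun i => hdisj (h0c i)) (fun i j hij => hdisj (hc.ne hij))
    (fun i => hadj (a0 i))
  obtain ⟨b, hbF, B, hB, hBB⟩ := exists_tripod _ (f 1) (fun i => f (d i)) le_rfl (hconn' 1)
    (fun i => hconn' _) (fun i => hdisj (h1d i)) (fun i j hij => hdisj (hd.ne hij))
    (fun i => hadj (a1 i))
  have hne : ∀ {i j : Fin 8} {x y : V}, i ≠ j → x ∈ f i → y ∈ f j → x ≠ y := by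
    rintro i j x _ hij hx hy rfl
    exact Set.disjoint_left.1 (hdisj hij) hx hy
  have hab : a ≠ b := hne (by decide) haF hbF
  have hAB : ∀ i j, Disjoint (A i) (B j) := by
    refine fun i j => Set.disjoint_left.2 fun x hx hx' => ?_
    rcases (hA i).2.1 hx with h | h <;> rcases (hB j).2.1 hx' with h' | h'
    exacts [hne (hcd i j) h h' rfl, hne (h1c i).symm h h' rfl, hne (h0d j) h h' rfl,
      hne (by decide) h h' rfl]
  have hbA : ∀ i, b ∉ A i := fun i h => by
    rcases (hA i).2.1 h with h | h
    exacts [hne (h1c i) hbF h rfl, hne (by decide) hbF h rfl]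
  have haB : ∀ i, a ∉ B i := fun i h => by
    rcases (hB i).2.1 h with h | h
    exacts [hne (h0d i) haF h rfl, hne (by decide) haF h rfl]
  have hABadj : ∀ i, ∃ u ∈ A i, ∃ v ∈ B i, G.Adj u v := by
    intro i
    obtain ⟨u, hu, v, hv, huv⟩ := hadj (acd i)
    exact ⟨u, (hA i).1 hu, v, (hB i).1 hv, huv⟩
  have hDc : ∀ i, ConnOn G (A i ∪ B i) := by
    intro i
    obtain ⟨u, hu, v, hv, huv⟩ := hABadj i
    exact (hA i).2.2.1.union (hB i).2.2.1 ⟨u, hu, v, hv, Or.inr huv⟩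
  have hDD : ∀ i j, i ≠ j → Disjoint (A i ∪ B i) (A j ∪ B j) := fun i j hij =>
    Set.disjoint_union_left.2 ⟨Set.disjoint_union_right.2 ⟨hAA i j hij, hAB i j⟩,
      Set.disjoint_union_right.2 ⟨(hAB j i).symm, hBB i j hij⟩⟩
  have haD : ∀ i, a ∉ A i ∪ B i := fun i h => h.elim (hA i).2.2.2.1 (haB i)
  have hbD : ∀ i, b ∉ A i ∪ B i := fun i h => h.elim (hbA i) (hB i).2.2.2.1
  have hfour : ∀ x p q r s, p ∈ td.bag x → q ∈ td.bag x → r ∈ td.bag x → s ∈ td.bag x →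
      p ≠ q → p ≠ r → p ≠ s → q ≠ r → q ≠ s → r ≠ s → False := by
    intro x p q r s hp hq hr hs h1 h2 h3 h4 h5 h6
    have h7 : ({p, q, r, s} : Set V).ncard = 4 := by
      rw [Set.ncard_eq_toFinset_card']
      simp [h1, h2, h3, h4, h5, h6]
    have h8 : ({p, q, r, s} : Set V) ⊆ td.bag x := by
      rintro y (rfl | rfl | rfl | rfl) <;> assumption
    have := Set.ncard_le_ncard h8
    have := hw x
    omega
  have hTa := connOn_iff.2 (td.bag_conn a)
  have hTb := connOn_iff.2 (td.bag_conn b)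
  have hab_bag : ∃ x, a ∈ td.bag x ∧ b ∈ td.bag x := by
    by_contra hcon
    push Not at hcon
    obtain ⟨x, hx, y, hxy, hby, hax⟩ := exists_separating_edge td.isTree hTa hTb hcon
    have hD : ∀ i, ∃ u ∈ A i ∪ B i, u ∈ td.bag x := by
      intro i
      obtain ⟨v, hv, hav⟩ := (hA i).2.2.2.2
      obtain ⟨w, hw, hbw⟩ := (hB i).2.2.2.2
      obtain ⟨z, hz, z', rfl, hzz⟩ := TreeDecomp.nodes_inter (td := td.toTreeDecomp)
        (D := A i ∪ B i) (E := {b}) ⟨w, Or.inr hw, b, rfl, Or.inr hbw.symm⟩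
      obtain ⟨y', hy', y'', rfl, hyy⟩ := TreeDecomp.nodes_inter (td := td.toTreeDecomp)
        (D := A i ∪ B i) (E := {a}) ⟨v, Or.inl hv, a, rfl, Or.inr hav.symm⟩
      exact mem_of_meets_both td.isTree (TreeDecomp.nodes_connOn (hDc i)) hxy hz (hby hzz) hy'
        (hax hyy)
    choose u hu hux using hD
    have huu : ∀ i j, i ≠ j → u i ≠ u j := fun i j hij h =>
      Set.disjoint_left.1 (hDD i j hij) (hu i) (h ▸ hu j)
    have hau : ∀ i, a ≠ u i := fun i h => haD i (h ▸ hu i)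
    exact hfour x a (u 0) (u 1) (u 2) hx (hux 0) (hux 1) (hux 2) (hau 0) (hau 1) (hau 2)
      (huu 0 1 (by decide)) (huu 0 2 (by decide)) (huu 1 2 (by decide))
  let P : td.ι → Fin 3 → Set V := fun x i =>
    if ∃ w ∈ td.bag x, w ∈ B i then A i else if ∃ w ∈ td.bag x, w ∈ A i then B i else A i ∪ B i
  have hPcases : ∀ x i, (P x i = A i ∧ ∃ w ∈ td.bag x, w ∈ B i) ∨
      (P x i = B i ∧ ∃ w ∈ td.bag x, w ∈ A i) ∨ (P x i = A i ∪ B i ∧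
        ∀ w ∈ td.bag x, w ∉ A i ∪ B i) := by
    intro x i
    by_cases h1 : ∃ w ∈ td.bag x, w ∈ B i
    · exact Or.inl ⟨if_pos h1, h1⟩
    · by_cases h2 : ∃ w ∈ td.bag x, w ∈ A i
      · exact Or.inr (Or.inl ⟨(if_neg h1).trans (if_pos h2), h2⟩)
      · refine Or.inr (Or.inr ⟨(if_neg h1).trans (if_neg h2), ?_⟩)
        rintro w hw (h | h)
        exacts [h2 ⟨w, hw, h⟩, h1 ⟨w, hw, h⟩]
  have hPsub : ∀ x i, A i ⊆ P x i ∨ B i ⊆ P x i := by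
    intro x i
    rcases hPcases x i with ⟨h, -⟩ | ⟨h, -⟩ | ⟨h, -⟩ <;> rw [h]
    exacts [Or.inl subset_rfl, Or.inr subset_rfl, Or.inl Set.subset_union_left]
  have hZ := tree_no_drift td.isTree {x | a ∈ td.bag x ∧ b ∈ td.bag x}
    (fun x i => td.toTreeDecomp.nodes (P x i)) (fun x hx i => ⟨TreeDecomp.nodes_connOn (by
      rcases hPcases x i with ⟨h, -⟩ | ⟨h, -⟩ | ⟨h, -⟩ <;> rw [h]
      exacts [(hA i).2.2.1, (hB i).2.2.1, hDc i]), by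
      rintro ⟨v, hv, hvx⟩
      rcases hPcases x i with ⟨h, w, hwx, hw⟩ | ⟨h, w, hwx, hw⟩ | ⟨h, hw⟩ <;> rw [h] at hv
      · refine hfour x a b v w hx.1 hx.2 hvx hwx hab ?_ ?_ ?_ ?_ ?_ <;> rintro rfl
        exacts [haD i (Or.inl hv), haD i (Or.inr hw), hbD i (Or.inl hv), hbD i (Or.inr hw),
          Set.disjoint_left.1 (hAB i i) hv hw]
      · refine hfour x a b v w hx.1 hx.2 hvx hwx hab ?_ ?_ ?_ ?_ ?_ <;> rintro rfl
        exacts [haD i (Or.inr hv), haD i (Or.inl hw), hbD i (Or.inr hv), hbD i (Or.inl hw),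
          Set.disjoint_left.1 (hAB i i) hw hv]
      · exact hw v hvx hv⟩)
    (fun x _ y _ i => by
      obtain ⟨u, hu, v, hv, huv⟩ := hABadj i
      rcases hPsub x i with h1 | h1 <;> rcases hPsub y i with h2 | h2
      exacts [TreeDecomp.nodes_inter ⟨u, h1 hu, u, h2 hu, Or.inl rfl⟩,
        TreeDecomp.nodes_inter ⟨u, h1 hu, v, h2 hv, Or.inr huv⟩,
        TreeDecomp.nodes_inter ⟨v, h1 hv, u, h2 hu, Or.inr huv.symm⟩,
        TreeDecomp.nodes_inter ⟨v, h1 hv, v, h2 hv, Or.inl rfl⟩])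
    (fun x hx y hy => by
      have hmem : ∀ i p, p ∈ td.bag x → (∃ u ∈ P x i, G.Adj u p) → p ∈ td.bag (y i) := by
        rintro i p hp ⟨u, hu, hup⟩
        obtain ⟨z, hz, w, hw', hwz⟩ := TreeDecomp.nodes_inter (td := td.toTreeDecomp)
          (D := P x i) (E := {p}) ⟨u, hu, p, rfl, Or.inr hup⟩
        obtain rfl : w = p := hw'
        exact mem_of_mem_comp td.isTree.isAcyclic (connOn_iff.2 (td.bag_conn w)) (hy i).1 hp hwz
          ((hy i).2 hz)
      have hma : ∀ i, A i ⊆ P x i → a ∈ td.bag (y i) := fun i h => by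
        obtain ⟨v, hv, hav⟩ := (hA i).2.2.2.2
        exact hmem i a hx.1 ⟨v, h hv, hav.symm⟩
      have hmb : ∀ i, B i ⊆ P x i → b ∈ td.bag (y i) := fun i h => by
        obtain ⟨v, hv, hbv⟩ := (hB i).2.2.2.2
        exact hmem i b hx.2 ⟨v, h hv, hbv.symm⟩
      have hone : ∀ i j, i ≠ j → ∀ w ∈ td.bag x, w ∈ A i ∪ B i → P x j = A j ∪ B j := by
        intro i j hij w hwx hwi
        have : ∀ w' ∈ td.bag x, w' ∉ A j ∪ B j := by
          intro w' hwx' hwj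
          refine hfour x a b w w' hx.1 hx.2 hwx hwx' hab ?_ ?_ ?_ ?_ ?_ <;> rintro rfl
          exacts [haD i hwi, haD j hwj, hbD i hwi, hbD j hwj,
            Set.disjoint_left.1 (hDD i j hij) hwi hwj]
        rcases hPcases x j with ⟨_, w', hw', h⟩ | ⟨_, w', hw', h⟩ | ⟨h, -⟩
        exacts [absurd (Or.inr h) (this w' hw'), absurd (Or.inl h) (this w' hw'), h]
      have hfull : ∀ i, P x i = A i ∪ B i → a ∈ td.bag (y i) ∧ b ∈ td.bag (y i) := fun i h =>
        ⟨hma i (h ▸ Set.subset_union_left), hmb i (h ▸ Set.subset_union_right)⟩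
      have hall : ∃ p, p ∈ td.bag x ∧ ∀ i, p ∈ td.bag (y i) := by
        by_cases hh : ∃ i, P x i ≠ A i ∪ B i
        · obtain ⟨i, hi⟩ := hh
          rcases hPcases x i with ⟨h, w, hwx, hw⟩ | ⟨h, w, hwx, hw⟩ | ⟨h, -⟩
          · refine ⟨a, hx.1, fun j => ?_⟩
            rcases eq_or_ne i j with rfl | hij
            · exact hma i h.superset
            · exact (hfull j (hone i j hij w hwx (Or.inr hw))).1
          · refine ⟨b, hx.2, fun j => ?_⟩
            rcases eq_or_ne i j with rfl | hij
            · exact hmb i h.superset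
            · exact (hfull j (hone i j hij w hwx (Or.inl hw))).2
          · exact absurd h hi
        · push Not at hh
          exact ⟨a, hx.1, fun i => (hfull i (hh i)).1⟩
      by_contra hcon
      push Not at hcon
      have hinj : ∀ i j, i ≠ j → y i ≠ y j := by
        intro i j hij h
        refine hcon i j hij h ?_
        by_cases hi : P x i = A i ∪ B i
        · exact hfull i hi
        · rw [h]
          rcases hPcases x i with ⟨-, w, hwx, hw⟩ | ⟨-, w, hwx, hw⟩ | ⟨h', -⟩
          exacts [hfull j (hone i j hij w hwx (Or.inr hw)),
            hfull j (hone i j hij w hwx (Or.inl hw)), absurd h' hi]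
      obtain ⟨p, hp, hpy⟩ := hall
      have h2 := (td.bag_dirpath p).1.2 x hp
      have h3 := TreeDecomp.le_ncard_of_injective y (s := {z | z ∈ {x | p ∈ td.bag x} ∧
        td.tree.Adj x z}) (fun i j h => by_contra fun hij => hinj i j hij h)
        (fun i => ⟨hpy i, (hy i).1⟩)
      omega)
  obtain ⟨x, hx⟩ := hab_bag
  exact (Set.eq_empty_iff_forall_notMem.1 hZ) x hx

theorem pathGraph_isTree (n : ℕ) : (pathGraph (n + 1)).IsTree := by
  rw [isTree_iff_connected_and_card]
  refine ⟨pathGraph_connected n, ?_⟩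
  have h : (pathGraph (n + 1)).edgeSet = Set.range fun i : Fin n => s(i.castSucc, i.succ) := by
    ext e
    induction e with
    | _ x y =>
      simp only [mem_edgeSet, pathGraph_adj, Set.mem_range, Sym2.eq_iff, Fin.ext_iff,
        Fin.val_castSucc, Fin.val_succ]
      constructor
      · rintro (h | h)
        · exact ⟨⟨x, by omega⟩, Or.inl ⟨rfl, h⟩⟩
        · exact ⟨⟨y, by omega⟩, Or.inr ⟨rfl, h⟩⟩
      · rintro ⟨i, h | h⟩ <;> omega
  have hinj : Function.Injective fun i : Fin n => s(i.castSucc, i.succ) := by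
    intro i j hij
    simp only [Sym2.eq_iff, Fin.ext_iff, Fin.val_castSucc, Fin.val_succ] at hij
    exact Fin.ext (by omega)
  rw [h, ← Set.image_univ, Nat.card_image_of_injective hinj]
  simp

theorem pathGraph_dist_zero {n : ℕ} (x : Fin (n + 1)) : (pathGraph (n + 1)).dist x 0 = x := by
  refine le_antisymm ?_ ?_
  · obtain ⟨i, hi⟩ := x
    induction i with
    | zero => simp
    | succ i ih =>
      have h : (pathGraph (n + 1)).Adj ⟨i + 1, hi⟩ ⟨i, by omega⟩ := by
        rw [pathGraph_adj]; exact Or.inr rfl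
      have h1 := (pathGraph_connected n).dist_triangle (u := ⟨i + 1, hi⟩) (v := ⟨i, by omega⟩)
        (w := 0)
      rw [dist_eq_one_iff_adj.2 h] at h1
      have h2 := ih (by omega)
      simp only at h2 ⊢
      omega
  · obtain ⟨p, hp⟩ := (pathGraph_connected n).exists_walk_length_eq_dist x 0
    rw [← hp]
    have : ∀ {u v : Fin (n + 1)} (p : (pathGraph (n + 1)).Walk u v), (u : ℕ) ≤ v + p.length := by
      intro u v p
      induction p with
      | nil => simp
      | cons h _ ih =>
        rw [pathGraph_adj] at h
        rw [Walk.length_cons]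
        omega
    simpa using this p

theorem pathGraph_connOn {n : ℕ} {s : Set (Fin n)} (hs : s.Nonempty)
    (hconv : ∀ i j k : Fin n, i ≤ j → j ≤ k → i ∈ s → k ∈ s → j ∈ s) :
    ConnOn (pathGraph n) s := by
  refine ⟨hs, ?_⟩
  rintro U ⟨x, hx, hxU⟩ hcl
  have up : ∀ (d : ℕ) (y : Fin n), y ∈ s → (y : ℕ) = x + d → y ∈ U := by
    intro d
    induction d with
    | zero => intro y _ h; rwa [show y = x from Fin.ext (by omega)]
    | succ d ih =>
      intro y hy h
      have hz : (⟨x + d, by omega⟩ : Fin n) ∈ s :=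
        hconv x _ y (Fin.mk_le_mk.2 (by omega)) (Fin.mk_le_mk.2 (by omega)) hx hy
      exact hcl _ hz (ih _ hz rfl) y hy (pathGraph_adj.2 (Or.inl (by simp only; omega)))
  have down : ∀ (d : ℕ) (y : Fin n), y ∈ s → (y : ℕ) + d = x → y ∈ U := by
    intro d
    induction d with
    | zero => intro y _ h; rwa [show y = x from Fin.ext (by omega)]
    | succ d ih =>
      intro y hy h
      have hz : (⟨y + 1, by omega⟩ : Fin n) ∈ s :=
        hconv y _ x (Fin.mk_le_mk.2 (by omega)) (Fin.mk_le_mk.2 (by omega)) hy hx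
      exact hcl _ hz (ih _ hz (by simp only; omega)) y hy
        (pathGraph_adj.2 (Or.inr (by simp only)))
  intro y hy
  rcases le_total (x : ℕ) y with h | h
  · exact up (y - x) y hy (by omega)
  · exact down (x - y) y hy (by omega)

/-- A path decomposition, rooted at its first node, is a special tree decomposition. -/
theorem PathDecomp.exists_specialTD {V : Type} {G : SimpleGraph V} (pd : PathDecomp G) {k : ℕ}
    (hk : ∀ i, (pd.bag i).ncard ≤ k) : ∃ td : SpecialTD G, ∀ x, (td.bag x).ncard ≤ k := by
  obtain ⟨m, hm, bag, bag_cover, bag_edge, bag_convex⟩ := pd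
  obtain ⟨n, rfl⟩ : ∃ n, m = n + 1 := ⟨m - 1, by omega⟩
  have hconn : ∀ v, ConnOn (pathGraph (n + 1)) {x | v ∈ bag x} := fun v =>
    pathGraph_connOn (bag_cover v) fun i j k hij hjk => bag_convex v i j k hij hjk
  have hle : ∀ {s : Set (Fin (n + 1))} (a : ℕ), (∀ y ∈ s, (y : ℕ) = a) → s.ncard ≤ 1 := by
    intro s a h
    refine (Set.ncard_le_one_iff (Set.toFinite _)).2 fun {y z} hy hz => Fin.ext ?_
    rw [h y hy, h z hz]
  refine ⟨{ ι := Fin (n + 1), finι := inferInstance, tree := pathGraph (n + 1),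
            isTree := pathGraph_isTree n, bag := bag, bag_cover := bag_cover,
            bag_edge := bag_edge, bag_conn := fun v => connOn_iff.1 (hconn v), root := 0,
            bag_vertical := fun v => ⟨⟨connOn_iff.1 (hconn v), fun x _ => ?_⟩,
              fun x _ => hle (x - 1) fun y hy => ?_, fun x _ => hle (x + 1) fun y hy => ?_⟩ }, hk⟩
  · have h1 : {y | y ∈ {x | v ∈ bag x} ∧ (pathGraph (n + 1)).Adj x y} ⊆
        {y | (y : ℕ) = x + 1} ∪ {y | (y : ℕ) = x - 1} := by
      rintro y ⟨-, hy⟩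
      rw [pathGraph_adj] at hy
      simp only [Set.mem_union, Set.mem_ofPred_eq]
      omega
    have h2 := Set.ncard_union_le {y : Fin (n + 1) | (y : ℕ) = x + 1} {y | (y : ℕ) = x - 1}
    have h3 := hle (s := {y : Fin (n + 1) | (y : ℕ) = x + 1}) _ fun y hy => hy
    have h4 := hle (s := {y : Fin (n + 1) | (y : ℕ) = x - 1}) _ fun y hy => hy
    have h5 := Set.ncard_le_ncard h1
    omega
  · obtain ⟨-, h1, h2⟩ := hy
    rw [pathGraph_dist_zero, pathGraph_dist_zero] at h2
    rw [pathGraph_adj] at h1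
    omega
  · obtain ⟨-, h1, h2⟩ := hy
    rw [pathGraph_dist_zero, pathGraph_dist_zero] at h2
    rw [pathGraph_adj] at h1
    omega

theorem SpecialTD.exists_dirSpaghettiTD {V : Type} {G : SimpleGraph V} (td : SpecialTD G) {k : ℕ}
    (hk : ∀ i, (td.bag i).ncard ≤ k) : ∃ td : DirSpaghettiTD G, ∀ x, (td.bag x).ncard ≤ k := by
  refine ⟨{ toTreeDecomp := td.toTreeDecomp,
            orient := fun x y => td.tree.Adj x y ∧
              td.tree.dist y td.root < td.tree.dist x td.root,
            orient_iff := fun x y => ⟨fun h => ?_, fun h => h.elim (·.1) (·.1.symm)⟩,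
            orient_asymm := fun x y h h' => h.2.not_gt h'.2,
            bag_dirpath := td.bag_vertical }, hk⟩
  have := td.isTree.dist_ne_of_adj td.root h
  rw [dist_comm, dist_comm (v := y)] at this
  rcases lt_or_gt_of_ne this with h' | h'
  · exact Or.inr ⟨h.symm, h'⟩
  · exact Or.inl ⟨h, h'⟩

theorem sInf_eq_two_iff {P : ℕ → Prop} (hP : ∀ k, P k → 2 ≤ k) : sInf {k | P k} = 2 ↔ P 2 := by
  constructor
  · intro h
    have := Nat.sInf_mem (Nat.nonempty_of_pos_sInf (s := {k | P k}) (by omega))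
    rwa [h] at this
  · intro h
    exact le_antisymm (Nat.sInf_le h) (hP _ (Nat.sInf_mem (s := {k | P k}) ⟨2, h⟩))

section widths

variable {V : Type} [Finite V] {G : SimpleGraph V}

theorem dptw_eq_two_iff (hG : TwoConnected G) :
    dptw G = 2 ↔ ∃ td : DirSpaghettiTD G, ∀ x, (td.bag x).ncard ≤ 3 := by
  refine sInf_eq_two_iff (P := fun k => ∃ td : DirSpaghettiTD G, ∀ x, (td.bag x).ncard ≤ k + 1) ?_
  rintro k ⟨td, h⟩
  obtain ⟨x, hx⟩ := TreeDecomp.exists_three_le_ncard hG td.toTreeDecomp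
  have := h x
  omega

theorem spctw_eq_two_iff (hG : TwoConnected G) :
    spctw G = 2 ↔ ∃ td : SpecialTD G, ∀ x, (td.bag x).ncard ≤ 3 := by
  refine sInf_eq_two_iff (P := fun k => ∃ td : SpecialTD G, ∀ x, (td.bag x).ncard ≤ k + 1) ?_
  rintro k ⟨td, h⟩
  obtain ⟨x, hx⟩ := TreeDecomp.exists_three_le_ncard hG td.toTreeDecomp
  have := h x
  omega

theorem pw_eq_two_iff (hG : TwoConnected G) :
    pw G = 2 ↔ ∃ pd : PathDecomp G, ∀ i, (pd.bag i).ncard ≤ 3 := by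
  refine sInf_eq_two_iff (P := fun k => ∃ pd : PathDecomp G, ∀ i, (pd.bag i).ncard ≤ k + 1) ?_
  rintro k ⟨pd, h⟩
  obtain ⟨td, htd⟩ := pd.exists_specialTD h
  obtain ⟨x, hx⟩ := TreeDecomp.exists_three_le_ncard hG td.toTreeDecomp
  have := htd x
  omega

end widths

theorem cycGraph_adj_natCast {n i j : ℕ} (hn : 3 ≤ n) (hij : i < j) (hj : j < n) :
    (cycGraph n).Adj (i : ZMod n) (j : ZMod n) ↔ j = i + 1 ∨ (i = 0 ∧ j + 1 = n) := by
  have hne : (i : ZMod n) ≠ (j : ZMod n) := by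
    rw [Ne, ZMod.natCast_eq_natCast_iff', Nat.mod_eq_of_lt hj, Nat.mod_eq_of_lt (hij.trans hj)]
    omega
  have h1 : (i : ZMod n) = (j : ZMod n) + 1 ↔ i = 0 ∧ j + 1 = n := by
    rw [← Nat.cast_succ, ZMod.natCast_eq_natCast_iff', Nat.mod_eq_of_lt (hij.trans hj)]
    rcases Nat.lt_or_ge (j + 1) n with h | h
    · rw [Nat.mod_eq_of_lt h]; omega
    · obtain rfl : n = j + 1 := by omega
      rw [Nat.succ_eq_add_one, Nat.mod_self]; omega
  have h2 : (j : ZMod n) = (i : ZMod n) + 1 ↔ j = i + 1 := by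
    rw [← Nat.cast_succ, ZMod.natCast_eq_natCast_iff', Nat.mod_eq_of_lt hj,
      Nat.mod_eq_of_lt (by omega)]
  rw [cycGraph, fromRel_adj, h1, h2]
  tauto

theorem zmod_exists_natCast {n : ℕ} (hn : 3 ≤ n) (z : ZMod n) : ∃ i < n, z = (i : ZMod n) := by
  have : NeZero n := ⟨by omega⟩
  exact ⟨z.val, z.val_lt, (ZMod.natCast_zmod_val z).symm⟩

theorem zmod_natCast_inj {n i j : ℕ} (hi : i < n) (hj : j < n) :
    (i : ZMod n) = (j : ZMod n) ↔ i = j := by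
  rw [ZMod.natCast_eq_natCast_iff', Nat.mod_eq_of_lt hi, Nat.mod_eq_of_lt hj]

/-- `s 0, …, s (n - 1)` enumerates the induced cycle `X` of `H` in cyclic order. -/
structure CycSeq {V : Type} (H : SimpleGraph V) (X : Set V) (n : ℕ) (s : ℕ → V) : Prop where
  three_le : 3 ≤ n
  inj : ∀ i j, i < n → j < n → s i = s j → i = j
  mem_iff : ∀ x, x ∈ X ↔ ∃ i < n, x = s i
  adj_iff : ∀ i j, i < j → j < n → (H.Adj (s i) (s j) ↔ j = i + 1 ∨ (i = 0 ∧ j + 1 = n))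

theorem isChordlessCycle_iff {V : Type} {H : SimpleGraph V} {X : Set V} :
    IsChordlessCycle H X ↔ ∃ n s, CycSeq H X n s := by
  constructor
  · rintro ⟨n, hn, ⟨e⟩⟩
    refine ⟨n, fun i => (e.symm (i : ZMod n)).1, hn, fun i j hi hj h => ?_, fun x => ⟨fun hx => ?_,
      ?_⟩, fun i j hij hj => ?_⟩
    · exact (zmod_natCast_inj hi hj).1 (e.symm.injective (Subtype.ext h))
    · obtain ⟨i, hi, h⟩ := zmod_exists_natCast hn (e ⟨x, hx⟩)
      exact ⟨i, hi, by rw [← h]; simp⟩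
    · rintro ⟨i, -, rfl⟩
      exact (e.symm (i : ZMod n)).2
    · rw [← cycGraph_adj_natCast hn hij hj, ← e.symm.map_adj_iff]
      simp
  · rintro ⟨n, s, hn, hinj, hmem, hadj⟩
    have : NeZero n := ⟨by omega⟩
    refine ⟨n, hn, ⟨Iso.symm ⟨Equiv.ofBijective
      (fun z : ZMod n => (⟨s z.val, (hmem _).2 ⟨_, z.val_lt, rfl⟩⟩ : X)) ⟨?_, ?_⟩, ?_⟩⟩⟩
    · intro z w h
      exact ZMod.val_injective _ (hinj _ _ z.val_lt w.val_lt (congrArg Subtype.val h))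
    · rintro ⟨x, hx⟩
      obtain ⟨i, hi, rfl⟩ := (hmem _).1 hx
      exact ⟨i, Subtype.ext (by simp [ZMod.val_cast_of_lt hi])⟩
    · intro z w
      obtain ⟨i, hi, rfl⟩ := zmod_exists_natCast hn z
      obtain ⟨j, hj, rfl⟩ := zmod_exists_natCast hn w
      change H.Adj (s (ZMod.val _)) (s (ZMod.val _)) ↔ _
      rw [ZMod.val_cast_of_lt hi, ZMod.val_cast_of_lt hj]
      rcases lt_trichotomy i j with h | rfl | h
      · rw [hadj i j h hj, cycGraph_adj_natCast hn h hj]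
      · simp
      · rw [H.adj_comm, hadj j i h hi, adj_comm, cycGraph_adj_natCast hn h hi]

/-- Vertex sets inducing trees of cycles in `H`, built by successively attaching ears
`s 0, s 1, …, s (m + 1)` at the ends of edges. -/
inductive TCSet {V : Type} (H : SimpleGraph V) : Set V → Prop
  | cycle {X : Set V} {n : ℕ} {s : ℕ → V} (h : CycSeq H X n s) : TCSet H X
  | ear {X Y : Set V} (hX : TCSet H X) {m : ℕ} {s : ℕ → V} (hm : 1 ≤ m)
      (h0 : s 0 ∈ X) (h1 : s (m + 1) ∈ X) (hadj : H.Adj (s 0) (s (m + 1)))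
      (hinj : ∀ i j, 1 ≤ i → i ≤ m → 1 ≤ j → j ≤ m → s i = s j → i = j)
      (hnew : ∀ i, 1 ≤ i → i ≤ m → s i ∉ X)
      (hmem : ∀ y, y ∈ Y ↔ y ∈ X ∨ ∃ i, 1 ≤ i ∧ i ≤ m ∧ y = s i)
      (hnbr : ∀ i, 1 ≤ i → i ≤ m → ∀ y ∈ Y, H.Adj (s i) y ↔ y = s (i - 1) ∨ y = s (i + 1)) :
      TCSet H Y

section glue

variable {V : Type} {G : SimpleGraph V} {n : ℕ} {a b : V}

@[simp] theorem glueCycle_inl_inl {u v : V} :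
    (glueCycle G n a b).Adj (Sum.inl u) (Sum.inl v) ↔ G.Adj u v := by
  simp only [glueCycle, fromRel_adj, ne_eq, Sum.inl.injEq, G.adj_comm v u, or_self]
  exact ⟨fun h => h.2, fun h => ⟨h.ne, h⟩⟩

@[simp] theorem glueCycle_inr_inl {u : V} {x : {x : ZMod n // x ≠ 0 ∧ x ≠ 1}} :
    (glueCycle G n a b).Adj (Sum.inr x) (Sum.inl u) ↔
      (u = a ∧ (cycGraph n).Adj 0 x.1) ∨ (u = b ∧ (cycGraph n).Adj 1 x.1) := by
  simp [glueCycle]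

@[simp] theorem glueCycle_inr_inr {x y : {x : ZMod n // x ≠ 0 ∧ x ≠ 1}} :
    (glueCycle G n a b).Adj (Sum.inr x) (Sum.inr y) ↔ (cycGraph n).Adj x.1 y.1 := by
  simp only [glueCycle, fromRel_adj, ne_eq, Sum.inr.injEq, (cycGraph n).adj_comm y.1 x.1, or_self]
  exact ⟨fun h => h.2, fun h => ⟨fun h' => h.ne (congrArg Subtype.val h'), h⟩⟩

theorem natCast_ne_zero_one {i : ℕ} (h2 : 2 ≤ i) (hi : i < n) :
    (i : ZMod n) ≠ 0 ∧ (i : ZMod n) ≠ 1 := by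
  have h0 := (zmod_natCast_inj hi (by omega : 0 < n)).not
  have h1 := (zmod_natCast_inj hi (by omega : 1 < n)).not
  rw [Nat.cast_zero] at h0
  rw [Nat.cast_one] at h1
  exact ⟨h0.2 (by omega), h1.2 (by omega)⟩

theorem exists_natCast_of_ne {z : ZMod n} (hn : 3 ≤ n) (hz : z ≠ 0 ∧ z ≠ 1) :
    ∃ i, 2 ≤ i ∧ i < n ∧ z = (i : ZMod n) := by
  obtain ⟨i, hi, rfl⟩ := zmod_exists_natCast hn z
  refine ⟨i, ?_, hi, rfl⟩
  have : i ≠ 0 := by rintro rfl; simp at hz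
  have : i ≠ 1 := by rintro rfl; simp at hz
  omega

theorem cycGraph_adj_zero {i : ℕ} (h2 : 2 ≤ i) (hi : i < n) :
    (cycGraph n).Adj 0 (i : ZMod n) ↔ i + 1 = n := by
  have := cycGraph_adj_natCast (by omega) (by omega : 0 < i) hi
  rw [Nat.cast_zero] at this
  rw [this]; omega

theorem cycGraph_adj_one {i : ℕ} (h2 : 2 ≤ i) (hi : i < n) :
    (cycGraph n).Adj 1 (i : ZMod n) ↔ i = 2 := by
  have := cycGraph_adj_natCast (by omega) (by omega : 1 < i) hi
  rw [Nat.cast_one] at this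
  rw [this]; omega

end glue

theorem IsTreeOfCycles.of_iso {V W : Type} {G : SimpleGraph V} {H : SimpleGraph W}
    (hG : IsTreeOfCycles G) (e : H ≃g G) : IsTreeOfCycles H := by
  cases hG with
  | cycle _ n hn e' => exact .cycle H n hn (e'.map e.trans)
  | glue G' hG' n hn a b hab _ e' => exact .glue G' hG' n hn a b hab H (e'.map e.trans)

theorem IsTreeOfCycles.tcSet {V : Type} {G : SimpleGraph V} (hG : IsTreeOfCycles G) :
    ∀ {W : Type} {H : SimpleGraph W} (φ : G ↪g H), TCSet H (Set.range φ) := by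
  classical
  induction hG with
  | cycle G n hn e =>
    obtain ⟨e⟩ := e
    intro W H φ
    refine .cycle (n := n) (s := fun i => φ (e.symm (i : ZMod n))) ⟨hn, fun i j hi hj h => ?_,
      fun x => ⟨?_, ?_⟩, fun i j hij hj => ?_⟩
    · exact (zmod_natCast_inj hi hj).1 (e.symm.injective (φ.injective h))
    · rintro ⟨y, rfl⟩
      obtain ⟨i, hi, h⟩ := zmod_exists_natCast hn (e y)
      exact ⟨i, hi, by rw [← h]; simp⟩
    · rintro ⟨i, -, rfl⟩
      exact ⟨_, rfl⟩
    · rw [← cycGraph_adj_natCast hn hij hj, φ.map_adj_iff, e.symm.map_adj_iff]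
  | @glue V V' G hG n hn a b hab H' e ih =>
    obtain ⟨e⟩ := e
    intro W H φ'
    obtain ⟨φ, hφ⟩ : ∃ φ : glueCycle G n a b ↪g H, Set.range φ = Set.range φ' :=
      ⟨e.symm.toEmbedding.trans φ', by
        rw [RelEmbedding.coe_trans, RelIso.coe_toRelEmbedding, Set.range_comp,
          e.symm.surjective.range_eq, Set.image_univ]⟩
    rw [← hφ]
    let ψ : G ↪g H := ⟨⟨fun v => φ (Sum.inl v), φ.injective.comp Sum.inl_injective⟩, by
      intro u v
      rw [← glueCycle_inl_inl (G := G) (n := n) (a := a) (b := b)]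
      exact φ.map_adj_iff⟩
    let g : ℕ → V ⊕ {x : ZMod n // x ≠ 0 ∧ x ≠ 1} := fun i =>
      if i = 0 then Sum.inl b else
        if h : ((i + 1 : ℕ) : ZMod n) ≠ 0 ∧ ((i + 1 : ℕ) : ZMod n) ≠ 1 then Sum.inr ⟨_, h⟩
        else Sum.inl a
    have g0 : g 0 = Sum.inl b := if_pos rfl
    have g1 : g (n - 2 + 1) = Sum.inl a := by
      simp only [g]
      rw [if_neg (by omega), dif_neg]
      rw [show n - 2 + 1 + 1 = n by omega]
      simp
    have gi : ∀ i, ∀ (_ : 1 ≤ i) (_ : i ≤ n - 2),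
        g i = Sum.inr ⟨((i + 1 : ℕ) : ZMod n), natCast_ne_zero_one (by omega) (by omega)⟩ := by
      intro i h1 h2
      simp only [g]
      rw [if_neg (by omega), dif_pos]
    have inr_eq : ∀ z, ∃ i, 1 ≤ i ∧ i ≤ n - 2 ∧ Sum.inr z = g i := by
      rintro ⟨z, hz⟩
      obtain ⟨i, h2, hi, rfl⟩ := exists_natCast_of_ne hn hz
      obtain ⟨i, rfl⟩ : ∃ j, i = j + 1 := ⟨i - 1, by omega⟩
      exact ⟨i, by omega, by omega, (gi i (by omega) (by omega)).symm⟩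
    have ginj : ∀ i j, 1 ≤ i → i ≤ n - 2 → 1 ≤ j → j ≤ n - 2 → g i = g j → i = j := by
      intro i j hi hi' hj hj' h
      rw [gi i hi hi', gi j hj hj', Sum.inr.injEq, Subtype.mk.injEq,
        zmod_natCast_inj (by omega) (by omega)] at h
      omega
    have gb : ∀ j, j ≤ n - 2 → g j = Sum.inl b → j = 0 := by
      intro j hj h
      by_contra hj0
      rw [gi j (by omega) hj] at h
      exact Sum.inr_ne_inl h
    have ga : ∀ j, 1 ≤ j → j ≤ n - 1 → g j = Sum.inl a → j = n - 1 := by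
      intro j hj hj' h
      by_contra hj0
      rw [gi j hj (by omega)] at h
      exact Sum.inr_ne_inl h
    refine .ear (ih ψ) (m := n - 2) (s := fun i => φ (g i)) (by omega) ⟨b, by rw [g0]; rfl⟩
      ⟨a, by rw [g1]; rfl⟩ ?_ (fun i j hi hi' hj hj' h => ginj i j hi hi' hj hj' (φ.injective h))
      (fun i hi hi' => ?_) (fun y => ?_) (fun i hi hi' => ?_)
    · rw [φ.map_adj_iff, g0, g1, glueCycle_inl_inl]
      exact hab.symm
    · rintro ⟨v, hv⟩
      have h2 : Sum.inl v = g i := φ.injective hv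
      rw [gi i hi hi'] at h2
      exact Sum.inl_ne_inr h2
    · constructor
      · rintro ⟨v | z, rfl⟩
        · exact Or.inl ⟨v, rfl⟩
        · obtain ⟨i, h1, h2, h⟩ := inr_eq z
          exact Or.inr ⟨i, h1, h2, by rw [h]⟩
      · rintro (⟨v, rfl⟩ | ⟨i, -, -, rfl⟩)
        exacts [⟨_, rfl⟩, ⟨_, rfl⟩]
    · rintro _ ⟨q, rfl⟩
      rw [φ.map_adj_iff, φ.injective.eq_iff, φ.injective.eq_iff]
      rcases q with v | z
      · rw [gi i hi hi', glueCycle_inr_inl, cycGraph_adj_zero (by omega) (by omega),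
          cycGraph_adj_one (by omega) (by omega)]
        constructor
        · rintro (⟨rfl, h⟩ | ⟨rfl, h⟩)
          · right; rw [← g1]; congr 1; omega
          · left; rw [← g0]; congr 1; omega
        · rintro (h | h)
          · by_cases hi1 : i = 1
            · subst hi1
              rw [g0, Sum.inl.injEq] at h
              exact Or.inr ⟨h, rfl⟩
            · rw [gi (i - 1) (by omega) (by omega)] at h
              exact absurd h Sum.inl_ne_inr
          · by_cases hi1 : i = n - 2
            · subst hi1
              rw [g1, Sum.inl.injEq] at h
              exact Or.inl ⟨h, by omega⟩
            · rw [gi (i + 1) (by omega) (by omega)] at h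
              exact absurd h Sum.inl_ne_inr
      · obtain ⟨j, hj1, hj2, h⟩ := inr_eq z
        rw [h]
        have h3 : (glueCycle G n a b).Adj (g i) (g j) ↔ j + 1 = i ∨ j = i + 1 := by
          rw [gi i hi hi', gi j hj1 hj2, glueCycle_inr_inr]
          rcases lt_trichotomy i j with h | rfl | h
          · rw [cycGraph_adj_natCast hn (by omega) (by omega)]; omega
          · simp
          · rw [adj_comm, cycGraph_adj_natCast hn (by omega) (by omega)]; omega
        rw [h3]
        constructor
        · rintro (rfl | rfl)
          exacts [Or.inl rfl, Or.inr rfl]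
        · rintro (h | h)
          · by_cases hi1 : i = 1
            · subst hi1
              have := gb j hj2 (h.trans g0)
              omega
            · have := ginj _ _ hj1 hj2 (by omega) (by omega) h
              omega
          · by_cases hi1 : i = n - 2
            · subst hi1
              have := ga j hj1 (by omega) (h.trans g1)
              omega
            · have := ginj _ _ hj1 hj2 (by omega) (by omega) h
              omega

theorem TCSet.isTreeOfCycles_induce {V : Type} {H : SimpleGraph V} {X : Set V} (hX : TCSet H X) :
    IsTreeOfCycles (H.induce X) := by
  induction hX with
  | cycle h =>
    obtain ⟨n, hn, e⟩ := isChordlessCycle_iff.2 ⟨_, _, h⟩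
    exact .cycle _ n hn e
  | @ear X Y hX m s hm h0 h1 hadj hinj hnew hmem hnbr ih =>
    have hXY : ∀ x ∈ X, x ∈ Y := fun x hx => (hmem x).2 (Or.inl hx)
    have hsY : ∀ i, 1 ≤ i → i ≤ m → s i ∈ Y := fun i hi hi' => (hmem _).2 (Or.inr ⟨i, hi, hi', rfl⟩)
    have hval : ∀ i, i < m + 2 → (i : ZMod (m + 2)).val = i := fun i hi => ZMod.val_cast_of_lt hi
    have hz : ∀ z : {x : ZMod (m + 2) // x ≠ 0 ∧ x ≠ 1}, 2 ≤ z.1.val ∧ z.1.val < m + 2 := by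
      rintro ⟨z, hz⟩
      obtain ⟨i, h2, hi, rfl⟩ := exists_natCast_of_ne (by omega) hz
      rw [hval i hi]
      exact ⟨h2, hi⟩
    let F : X ⊕ {x : ZMod (m + 2) // x ≠ 0 ∧ x ≠ 1} → Y := Sum.elim
      (fun x => ⟨x, hXY x x.2⟩)
      (fun z => ⟨s (z.1.val - 1), hsY _ (by have := hz z; omega) (by have := hz z; omega)⟩)
    have hF : Function.Bijective F := by
      constructor
      · rintro (x | z) (x' | z') h
        · exact congrArg Sum.inl (Subtype.ext (congrArg Subtype.val h :))
        · have h' : x.1 = s (z'.1.val - 1) := congrArg Subtype.val h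
          exact absurd (h' ▸ x.2) (hnew _ (by have := hz z'; omega) (by have := hz z'; omega))
        · have h' : s (z.1.val - 1) = x'.1 := congrArg Subtype.val h
          exact absurd (h' ▸ x'.2) (hnew _ (by have := hz z; omega) (by have := hz z; omega))
        · have h' := hinj _ _ (by have := hz z; omega) (by have := hz z; omega)
            (by have := hz z'; omega) (by have := hz z'; omega) (congrArg Subtype.val h :)
          have hh : z.1.val = z'.1.val := by
            have := hz z
            have := hz z'
            omega
          exact congrArg Sum.inr (Subtype.ext (ZMod.val_injective _ hh))
      · rintro ⟨y, hy⟩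
        rcases (hmem y).1 hy with h | ⟨i, hi, hi', rfl⟩
        · exact ⟨Sum.inl ⟨y, h⟩, rfl⟩
        · refine ⟨Sum.inr ⟨((i + 1 : ℕ) : ZMod (m + 2)),
            natCast_ne_zero_one (by omega) (by omega)⟩, Subtype.ext ?_⟩
          change s (((i + 1 : ℕ) : ZMod (m + 2)).val - 1) = s i
          rw [hval _ (by omega), Nat.add_sub_cancel]
    have key : ∀ (x : X) z, (glueCycle (H.induce X) (m + 2) ⟨s (m + 1), h1⟩ ⟨s 0, h0⟩).Adj
        (Sum.inr z) (Sum.inl x) ↔ H.Adj (s (z.1.val - 1)) x := by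
      intro x z
      have hz' := hz z
      rw [glueCycle_inr_inl, hnbr _ (by omega) (by omega) x (hXY x x.2)]
      obtain ⟨z, hz2⟩ := z
      obtain ⟨i, h2, hi, rfl⟩ := exists_natCast_of_ne (by omega) hz2
      rw [cycGraph_adj_zero h2 hi, cycGraph_adj_one h2 hi, hval i hi, Subtype.ext_iff,
        Subtype.ext_iff]
      simp only
      constructor
      · rintro (⟨h, h'⟩ | ⟨h, h'⟩)
        · right; rw [h]; congr 1; omega
        · left; rw [h]; congr 1; omega
      · rintro (h | h)
        · by_cases hi2 : i = 2
          · subst hi2; exact Or.inr ⟨h, rfl⟩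
          · exact absurd (h ▸ x.2) (hnew _ (by omega) (by omega))
        · by_cases hi2 : i = m + 1
          · subst hi2; exact Or.inl ⟨h, by omega⟩
          · exact absurd (h ▸ x.2) (hnew _ (by omega) (by omega))
    refine .glue (H.induce X) ih (m + 2) (by omega) ⟨s (m + 1), h1⟩ ⟨s 0, h0⟩ hadj.symm _
      ⟨Iso.symm ⟨Equiv.ofBijective F hF, fun {p q} => ?_⟩⟩
    change H.Adj (F p).1 (F q).1 ↔ _
    rcases p with x | z <;> rcases q with x' | z'
    · rw [glueCycle_inl_inl]; rfl
    · rw [adj_comm _ (Sum.inl x), key, adj_comm]; rfl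
    · rw [key]; rfl
    · rw [glueCycle_inr_inr]
      change H.Adj (s (z.1.val - 1)) (s (z'.1.val - 1)) ↔ _
      rw [hnbr _ (by have := hz z; omega) (by have := hz z; omega) _
        (hsY _ (by have := hz z'; omega) (by have := hz z'; omega))]
      obtain ⟨z, hz2⟩ := z
      obtain ⟨i, h2, hi, rfl⟩ := exists_natCast_of_ne (by omega) hz2
      obtain ⟨z', hz2'⟩ := z'
      obtain ⟨j, h2', hj, rfl⟩ := exists_natCast_of_ne (by omega) hz2'
      simp only [hval i hi, hval j hj]
      have hA : (cycGraph (m + 2)).Adj (i : ZMod (m + 2)) j ↔ j = i + 1 ∨ i = j + 1 := by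
        rcases lt_trichotomy i j with h | rfl | h
        · rw [cycGraph_adj_natCast (by omega) h hj]; omega
        · simp
        · rw [adj_comm, cycGraph_adj_natCast (by omega) h hi]; omega
      rw [hA]
      constructor
      · rintro (h | h)
        · by_cases hi2 : i = 2
          · subst hi2
            exact absurd (h ▸ h0) (hnew _ (by omega) (by omega))
          · have := hinj _ _ (by omega) (by omega) (by omega) (by omega) h
            omega
        · by_cases hi2 : i = m + 1
          · subst hi2
            exact absurd (h ▸ h1) (hnew _ (by omega) (by omega))
          · have := hinj _ _ (by omega) (by omega) (by omega) (by omega) h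
            omega
      · rintro (rfl | rfl)
        · right; congr 1; omega
        · left; congr 1

theorem isTreeOfCycles_iff {V : Type} {H : SimpleGraph V} :
    IsTreeOfCycles H ↔ TCSet H Set.univ :=
  ⟨fun h => by
    have hr : Set.range (Embedding.refl (G := H)) = Set.univ :=
      Set.range_eq_univ.2 fun x => ⟨x, rfl⟩
    exact hr ▸ h.tcSet Embedding.refl,
    fun h => h.isTreeOfCycles_induce.of_iso (induceUnivIso H).symm⟩

/-- `B` arranges the vertices of `X` in bags indexed by the real line, each vertex occupying an
interval; far to the left the bag is the pair `e₁`, far to the right it is the pair `e₂`, and each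
pair in `A` is the bag throughout some open interval. -/
structure IsBagLine {V : Type} (H : SimpleGraph V) (X : Set V) (e₁ e₂ : Sym2 V) (A : Set (Sym2 V))
    (B : ℝ → Set V) : Prop where
  subset : ∀ t, B t ⊆ X
  cover : ∀ x ∈ X, ∃ t, x ∈ B t
  edge : ∀ x ∈ X, ∀ y ∈ X, H.Adj x y → ∃ t, x ∈ B t ∧ y ∈ B t
  convex : ∀ v r s t, r ≤ s → s ≤ t → v ∈ B r → v ∈ B t → v ∈ B s
  card : ∀ t, (B t).ncard ≤ 3
  left : ∃ t₀, ∀ t < t₀, B t = {v | v ∈ e₁}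
  right : ∃ t₀, ∀ t > t₀, B t = {v | v ∈ e₂}
  wide : ∀ e ∈ A, ∃ t t', t < t' ∧ ∀ u, t < u → u < t' → B u = {v | v ∈ e}

/-- Some arrangement in the sense of `IsBagLine` exists. -/
def HasBagLine {V : Type} (H : SimpleGraph V) (X : Set V) (e₁ e₂ : Sym2 V)
    (A : Set (Sym2 V)) : Prop :=
  ∃ B, IsBagLine H X e₁ e₂ A B

namespace HasBagLine

variable {V : Type} {H : SimpleGraph V} {X : Set V} {e₁ e₂ : Sym2 V} {A : Set (Sym2 V)}

theorem mono (h : HasBagLine H X e₁ e₂ A) {A' : Set (Sym2 V)} (hA : A' ⊆ A) :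
    HasBagLine H X e₁ e₂ A' := by
  obtain ⟨B, hB⟩ := h
  exact ⟨B, { hB with wide := fun e he => hB.wide e (hA he) }⟩

theorem reverse (h : HasBagLine H X e₁ e₂ A) : HasBagLine H X e₂ e₁ A := by
  obtain ⟨B, hB⟩ := h
  refine ⟨fun t => B (-t), ⟨fun t => hB.subset _, fun x hx => ?_, fun x hx y hy hxy => ?_,
    fun v r s t hrs hst hr ht => hB.convex v (-t) (-s) (-r) (neg_le_neg hst) (neg_le_neg hrs) ht hr,
    fun t => hB.card _, ?_, ?_, fun e he => ?_⟩⟩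
  · obtain ⟨t, ht⟩ := hB.cover x hx
    exact ⟨-t, by simpa using ht⟩
  · obtain ⟨t, ht⟩ := hB.edge x hx y hy hxy
    exact ⟨-t, by simpa using ht⟩
  · obtain ⟨t, ht⟩ := hB.right
    exact ⟨-t, fun u hu => ht _ (by linarith)⟩
  · obtain ⟨t, ht⟩ := hB.left
    exact ⟨-t, fun u hu => ht _ (by linarith)⟩
  · obtain ⟨t, t', htt, ht⟩ := hB.wide e he
    exact ⟨-t', -t, by linarith, fun u h1 h2 => ht _ (by linarith) (by linarith)⟩

theorem pair {c d : V} (hA : A ⊆ {s(c, d)}) : HasBagLine H {c, d} s(c, d) s(c, d) A := by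
  have hset : {v | v ∈ s(c, d)} = ({c, d} : Set V) := by ext; simp
  refine ⟨fun _ => {c, d}, ⟨fun _ => subset_rfl, fun x hx => ⟨0, hx⟩,
    fun x hx y hy _ => ⟨0, hx, hy⟩,
    fun v r s t _ _ hr _ => hr, fun _ => (Set.ncard_insert_le _ _).trans (by simp),
    ⟨0, fun _ _ => hset.symm⟩, ⟨0, fun _ _ => hset.symm⟩, fun e he => ?_⟩⟩
  obtain rfl : e = s(c, d) := hA he
  exact ⟨0, 1, one_pos, fun _ _ _ => hset.symm⟩

theorem pair_ncard_le (a b : V) : {v | v ∈ s(a, b)}.ncard ≤ 2 := by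
  have hset : {v | v ∈ s(a, b)} = ({a, b} : Set V) := by ext; simp
  rw [hset]
  exact (Set.ncard_insert_le _ _).trans (by simp)

/-- Add a vertex attached to a pair of `A`. -/
theorem insert (h : HasBagLine H X e₁ e₂ A) {a b x : V} (hab : s(a, b) ∈ A) (hx : x ∉ X)
    (hN : ∀ y ∈ X, H.Adj x y → y = a ∨ y = b) : HasBagLine H (insert x X) e₁ e₂ A := by
  classical
  obtain ⟨B, hB⟩ := h
  obtain ⟨t, t', htt, ht⟩ := hB.wide _ hab
  obtain ⟨z, hz⟩ : ∃ z, z = (t + t') / 2 := ⟨_, rfl⟩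
  have hBz : B z = {v | v ∈ s(a, b)} := ht z (by linarith) (by linarith)
  have hxB : ∀ u, x ∉ B u := fun u hu => hx (hB.subset u hu)
  let B' : ℝ → Set V := fun u => if u = z then Insert.insert x (B u) else B u
  have hz' : B' z = Insert.insert x (B z) := if_pos rfl
  have hnz : ∀ u, u ≠ z → B' u = B u := fun u hu => if_neg hu
  have hle : ∀ u, B u ⊆ B' u := by
    intro u
    by_cases hu : u = z
    · rw [hu, hz']; exact Set.subset_insert _ _
    · rw [hnz u hu]
  have hmem : ∀ v ∈ X, ∀ u, v ∈ B' u ↔ v ∈ B u := by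
    intro v hv u
    by_cases hu : u = z
    · rw [hu, hz', Set.mem_insert_iff]
      exact or_iff_right fun h => hx (h ▸ hv)
    · rw [hnz u hu]
  have hxz : ∀ u, x ∈ B' u ↔ u = z := by
    intro u
    by_cases hu : u = z
    · rw [hu, hz']; simp
    · rw [hnz u hu]; simp [hu, hxB u]
  have hxy : ∀ y ∈ X, H.Adj x y → ∃ t, x ∈ B' t ∧ y ∈ B' t := fun y hy h =>
    ⟨z, (hxz z).2 rfl, hle z (by rw [hBz]; simpa using hN y hy h)⟩
  refine ⟨B', ⟨fun u v hv => ?_, ?_, ?_, fun v r s u hrs hsu hr hu => ?_, fun u => ?_, ?_, ?_,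
    fun e he => ?_⟩⟩
  · by_cases hu : u = z
    · rw [hu, hz'] at hv
      exact Set.insert_subset_insert (hB.subset _) hv
    · rw [hnz u hu] at hv
      exact Or.inr (hB.subset _ hv)
  · rintro v (rfl | hv)
    · exact ⟨z, (hxz z).2 rfl⟩
    · obtain ⟨u, hu⟩ := hB.cover v hv
      exact ⟨u, hle u hu⟩
  · rintro v (rfl | hv) w (rfl | hw) hvw
    · exact absurd rfl hvw.ne
    · exact hxy w hw hvw
    · obtain ⟨u, h1, h2⟩ := hxy v hv hvw.symm
      exact ⟨u, h2, h1⟩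
    · obtain ⟨u, h1, h2⟩ := hB.edge v hv w hw hvw
      exact ⟨u, hle u h1, hle u h2⟩
  · by_cases hv : v ∈ X
    · rw [hmem v hv] at hr hu ⊢
      exact hB.convex v r s u hrs hsu hr hu
    · by_cases hvx : v = x
      · subst hvx
        rw [hxz] at hr hu ⊢
        linarith
      · exfalso
        by_cases hr' : r = z
        · rw [hr', hz'] at hr
          rcases hr with h | h
          exacts [hvx h, hv (hB.subset _ h)]
        · rw [hnz r hr'] at hr
          exact hv (hB.subset _ hr)
  · by_cases hu : u = z
    · rw [hu, hz', hBz]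
      have := pair_ncard_le a b
      exact (Set.ncard_insert_le _ _).trans (by omega)
    · rw [hnz u hu]; exact hB.card u
  · obtain ⟨t₀, ht₀⟩ := hB.left
    refine ⟨min t₀ z, fun u hu => ?_⟩
    rw [hnz u (hu.trans_le (min_le_right _ _)).ne]
    exact ht₀ u (hu.trans_le (min_le_left _ _))
  · obtain ⟨t₀, ht₀⟩ := hB.right
    refine ⟨max t₀ z, fun u hu => ?_⟩
    rw [hnz u ((le_max_right _ _).trans_lt hu).ne']
    exact ht₀ u ((le_max_left _ _).trans_lt hu)
  · obtain ⟨p, q, hpq, hp⟩ := hB.wide e he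
    by_cases hpz : p < z
    · refine ⟨p, min q z, lt_min hpq hpz, fun u h1 h2 => ?_⟩
      rw [hnz u (h2.trans_le (min_le_right _ _)).ne]
      exact hp u h1 (h2.trans_le (min_le_left _ _))
    · refine ⟨p, q, hpq, fun u h1 h2 => ?_⟩
      rw [hnz u (by intro h; linarith)]
      exact hp u h1 h2

/-- Replace `p` by a new vertex `x` in the leftmost pair. -/
theorem step {p q x : V} (h : HasBagLine H X s(p, q) e₂ A) (hx : x ∉ X)
    (hN : ∀ y ∈ X, H.Adj x y → y = p ∨ y = q) :
    HasBagLine H (Insert.insert x X) s(x, q) e₂ (Insert.insert s(x, q) A) := by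
  classical
  obtain ⟨B, hB⟩ := h
  obtain ⟨t₀, ht₀⟩ := hB.left
  have hpq : ∀ t < t₀, ∀ v, v ∈ B t ↔ v = p ∨ v = q := by
    intro t ht v
    rw [ht₀ t ht]
    simp
  have hxB : ∀ u, x ∉ B u := fun u hu => hx (hB.subset u hu)
  have hpX : p ∈ X := hB.subset (t₀ - 1) ((hpq _ (by linarith) p).2 (Or.inl rfl))
  have hqX : q ∈ X := hB.subset (t₀ - 1) ((hpq _ (by linarith) q).2 (Or.inr rfl))
  obtain ⟨z, hz⟩ : ∃ z, z = t₀ - 2 := ⟨_, rfl⟩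
  let B' : ℝ → Set V := fun u => if u < z then {v | v ∈ s(x, q)} else
    if u = z then {x, p, q} else B u
  have hlt : ∀ u, u < z → B' u = {v | v ∈ s(x, q)} := fun u hu => if_pos hu
  have heq : B' z = {x, p, q} := (if_neg (lt_irrefl z)).trans (if_pos rfl)
  have hgt : ∀ u, z < u → B' u = B u := fun u hu => (if_neg hu.not_gt).trans (if_neg hu.ne')
  have hxz : ∀ u, x ∈ B' u ↔ u ≤ z := by
    intro u
    rcases lt_trichotomy u z with h | h | h
    · simp [hlt u h, h.le]
    · simp [h, heq]
    · simp [hgt u h, hxB u, h]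
  have hqz : ∀ u, q ∈ B' u ↔ q ∈ B u := by
    intro u
    rcases lt_trichotomy u z with h | h | h
    · simp [hlt u h, hpq u (by linarith)]
    · simp [h, heq, hpq z (by linarith)]
    · simp [hgt u h]
  have hvz : ∀ v, v ∈ X → v ≠ q → ∀ u, v ∈ B' u ↔ v ∈ B u ∧ z ≤ u := by
    intro v hv hvq u
    have hvx : v ≠ x := fun h => hx (h ▸ hv)
    rcases lt_trichotomy u z with h | h | h
    · simp [hlt u h, hvx, hvq, h]
    · simp [h, heq, hpq z (by linarith), hvx, hvq]
    · simp [hgt u h, h.le]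
  have hpos : ∀ v ∈ X, ∀ u, v ∈ B u → v ∈ B (max u (z + 1)) := by
    intro v hv u hvu
    rcases le_total u (z + 1) with h | h
    · rw [max_eq_right h]
      exact (hpq _ (by linarith) v).2 ((hpq u (by linarith) v).1 hvu)
    · rwa [max_eq_left h]
  have hmax : ∀ u : ℝ, z < max u (z + 1) := fun u => lt_max_of_lt_right (by linarith)
  have hxy : ∀ y ∈ X, H.Adj x y → ∃ t, x ∈ B' t ∧ y ∈ B' t := fun y hy h =>
    ⟨z, (hxz z).2 le_rfl, by rw [heq]; rcases hN y hy h with rfl | rfl <;> simp⟩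
  refine ⟨B', ⟨fun u v hv => ?_, ?_, ?_, fun v r s u hrs hsu hr hu => ?_, fun u => ?_,
    ⟨z, fun u hu => hlt u hu⟩, ?_, ?_⟩⟩
  · rcases lt_trichotomy u z with h | h | h
    · rw [hlt u h] at hv
      simp only [Sym2.mem_iff, Set.mem_ofPred_eq] at hv
      rcases hv with rfl | rfl
      exacts [Or.inl rfl, Or.inr hqX]
    · rw [h, heq] at hv
      rcases hv with rfl | rfl | rfl
      exacts [Or.inl rfl, Or.inr hpX, Or.inr hqX]
    · rw [hgt u h] at hv
      exact Or.inr (hB.subset u hv)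
  · rintro v (rfl | hv)
    · exact ⟨z, (hxz z).2 le_rfl⟩
    · obtain ⟨u, hu⟩ := hB.cover v hv
      exact ⟨_, by rw [hgt _ (hmax u)]; exact hpos v hv u hu⟩
  · rintro v (rfl | hv) w (rfl | hw) hvw
    · exact absurd rfl hvw.ne
    · exact hxy w hw hvw
    · obtain ⟨u, h1, h2⟩ := hxy v hv hvw.symm
      exact ⟨u, h2, h1⟩
    · obtain ⟨u, h1, h2⟩ := hB.edge v hv w hw hvw
      refine ⟨max u (z + 1), ?_⟩
      rw [hgt _ (hmax u)]
      exact ⟨hpos v hv u h1, hpos w hw u h2⟩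
  · by_cases hvx : v = x
    · subst hvx
      rw [hxz] at hu ⊢
      linarith
    by_cases hvq : v = q
    · subst hvq
      rw [hqz] at hr hu ⊢
      exact hB.convex _ r s u hrs hsu hr hu
    by_cases hv : v ∈ X
    · rw [hvz v hv hvq] at hr hu ⊢
      exact ⟨hB.convex v r s u hrs hsu hr.1 hu.1, by linarith [hr.2]⟩
    · exfalso
      rcases lt_trichotomy r z with h | h | h
      · simp [hlt r h, hvx, hvq] at hr
      · rw [h, heq] at hr
        rcases hr with rfl | rfl | rfl
        exacts [hvx rfl, hv hpX, hvq rfl]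
      · rw [hgt r h] at hr
        exact hv (hB.subset r hr)
  · rcases lt_trichotomy u z with h | h | h
    · rw [hlt u h]
      have := pair_ncard_le x q
      omega
    · rw [h, heq]
      have h1 := Set.ncard_insert_le x {p, q}
      have h2 := Set.ncard_insert_le p {q}
      rw [Set.ncard_singleton] at h2
      omega
    · rw [hgt u h]; exact hB.card u
  · obtain ⟨t₁, ht₁⟩ := hB.right
    refine ⟨max t₁ z, fun u hu => ?_⟩
    rw [hgt u ((le_max_right _ _).trans_lt hu)]
    exact ht₁ u ((le_max_left _ _).trans_lt hu)
  · rintro e (rfl | he)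
    · exact ⟨z - 1, z, by linarith, fun u _ h2 => hlt u h2⟩
    · obtain ⟨r, r', hrr, hr⟩ := hB.wide e he
      by_cases hrz : r' ≤ t₀
      · refine ⟨z, z + 1, by linarith, fun u h1 h2 => ?_⟩
        rw [hgt u h1, ht₀ u (by linarith), ← ht₀ ((r + r') / 2) (by linarith),
          hr _ (by linarith) (by linarith)]
      · refine ⟨max r z, r', max_lt hrr (by linarith), fun u h1 h2 => ?_⟩
        rw [hgt u ((le_max_right _ _).trans_lt h1)]
        exact hr u ((le_max_left _ _).trans_lt h1) h2

theorem exists_pathDecomp [Finite V] [Nonempty V] (h : HasBagLine H Set.univ e₁ e₂ A)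
    {G : SimpleGraph V} (hGH : G ≤ H) : ∃ pd : PathDecomp G, ∀ i, (pd.bag i).ncard ≤ 3 := by
  classical
  have := Fintype.ofFinite V
  obtain ⟨B, hB⟩ := h
  have hE : ∀ p : V × V, ∃ t, p.1 ∈ B t ∧ (H.Adj p.1 p.2 → p.2 ∈ B t) := by
    rintro ⟨x, y⟩
    by_cases hxy : H.Adj x y
    · obtain ⟨t, h1, h2⟩ := hB.edge x trivial y trivial hxy
      exact ⟨t, h1, fun _ => h2⟩
    · obtain ⟨t, ht⟩ := hB.cover x trivial
      exact ⟨t, ht, fun h => absurd h hxy⟩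
  choose τ hτ1 hτ2 using hE
  let W : Finset ℝ := Finset.univ.image τ
  have hW : ∀ p, ∃ i, W.orderEmbOfFin rfl i = τ p := by
    intro p
    have : τ p ∈ Set.range (W.orderEmbOfFin rfl) := by
      rw [Finset.range_orderEmbOfFin]
      exact Finset.mem_coe.2 (Finset.mem_image_of_mem _ (Finset.mem_univ p))
    exact this
  refine ⟨⟨W.card, ?_, fun i => B (W.orderEmbOfFin rfl i), fun v => ?_, fun u v huv => ?_,
    fun v i j k hij hjk => hB.convex v _ _ _ ((W.orderEmbOfFin rfl).monotone hij)
      ((W.orderEmbOfFin rfl).monotone hjk)⟩, fun i => hB.card _⟩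
  · obtain ⟨v⟩ := ‹Nonempty V›
    exact Finset.card_pos.2 ⟨_, Finset.mem_image_of_mem τ (Finset.mem_univ (v, v))⟩
  · obtain ⟨i, hi⟩ := hW (v, v)
    exact ⟨i, by rw [hi]; exact hτ1 (v, v)⟩
  · obtain ⟨i, hi⟩ := hW (u, v)
    exact ⟨i, by rw [hi]; exact ⟨hτ1 (u, v), hτ2 (u, v) (hGH huv)⟩⟩

end HasBagLine

namespace CycSeq

variable {V : Type} {H : SimpleGraph V} {X : Set V} {n : ℕ} {s : ℕ → V}

theorem adj_iff' (h : CycSeq H X n s) {i j : ℕ} (hi : i < n) (hj : j < n) :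
    H.Adj (s i) (s j) ↔
      j = i + 1 ∨ i = j + 1 ∨ (i = 0 ∧ j + 1 = n) ∨ (j = 0 ∧ i + 1 = n) := by
  have := h.three_le
  rcases lt_trichotomy i j with hij | rfl | hij
  · rw [h.adj_iff i j hij hj]; omega
  · simp only [SimpleGraph.irrefl, false_iff]; omega
  · rw [H.adj_comm, h.adj_iff j i hij hi]; omega

theorem rotate (h : CycSeq H X n s) {k : ℕ} (hk : k < n) :
    ∃ t : ℕ → V, CycSeq H X n t ∧ t 0 = s k ∧ t (n - 1) = s (if k = 0 then n - 1 else k - 1) ∧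
      t 1 = s (if k + 1 = n then 0 else k + 1) := by
  have h3 := h.three_le
  refine ⟨fun i => s (if i + k < n then i + k else i + k - n), ⟨h3, fun i j hi hj hij => ?_,
    fun x => ?_, fun i j hij hj => ?_⟩, ?_, ?_, ?_⟩
  · have := h.inj _ _ (by split_ifs <;> omega) (by split_ifs <;> omega) hij
    split_ifs at this <;> omega
  · rw [h.mem_iff]
    constructor
    · rintro ⟨i, hi, rfl⟩
      refine ⟨if k ≤ i then i - k else i + n - k, by split_ifs <;> omega, ?_⟩
      congr 1
      split_ifs <;> omega
    · rintro ⟨i, hi, rfl⟩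
      exact ⟨_, by split_ifs <;> omega, rfl⟩
  · rw [h.adj_iff' (by split_ifs <;> omega) (by split_ifs <;> omega)]
    split_ifs <;> omega
  · simp [hk]
  · beta_reduce
    congr 1
    split_ifs <;> omega
  · beta_reduce
    congr 1
    split_ifs <;> omega

theorem adj_succ (h : CycSeq H X n s) {i : ℕ} (hi : i + 1 < n) : H.Adj (s i) (s (i + 1)) :=
  (h.adj_iff i (i + 1) (by omega) hi).2 (Or.inl rfl)

theorem adj_zero_last (h : CycSeq H X n s) : H.Adj (s 0) (s (n - 1)) := by
  have := h.three_le
  exact (h.adj_iff 0 (n - 1) (by omega) (by omega)).2 (Or.inr ⟨rfl, by omega⟩)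

theorem mem (h : CycSeq H X n s) {i : ℕ} (hi : i < n) : s i ∈ X := (h.mem_iff _).2 ⟨i, hi, rfl⟩

theorem isChordlessCycle (h : CycSeq H X n s) : IsChordlessCycle H X :=
  isChordlessCycle_iff.2 ⟨n, s, h⟩

/-- Any vertex of an induced cycle can be taken as its starting point. -/
theorem _root_.IsChordlessCycle.exists_cycSeq (h : IsChordlessCycle H X) {x : V} (hx : x ∈ X) :
    ∃ n s, CycSeq H X n s ∧ s 0 = x := by
  obtain ⟨n, s, h⟩ := isChordlessCycle_iff.1 h
  obtain ⟨k, hk, rfl⟩ := (h.mem_iff x).1 hx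
  obtain ⟨t, ht, h0, -⟩ := h.rotate hk
  exact ⟨n, t, ht, h0⟩

/-- Any edge of an induced cycle can be taken as its closing edge. -/
theorem _root_.IsChordlessCycle.exists_cycSeq_of_adj (h : IsChordlessCycle H X) {x y : V}
    (hx : x ∈ X) (hy : y ∈ X) (hxy : H.Adj x y) :
    ∃ n s, CycSeq H X n s ∧ s(s 0, s (n - 1)) = s(x, y) := by
  obtain ⟨n, s, h⟩ := isChordlessCycle_iff.1 h
  have h3 := h.three_le
  obtain ⟨i, hi, rfl⟩ := (h.mem_iff x).1 hx
  obtain ⟨j, hj, rfl⟩ := (h.mem_iff y).1 hy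
  rcases (h.adj_iff' hi hj).1 hxy with rfl | rfl | ⟨rfl, h'⟩ | ⟨rfl, h'⟩
  · obtain ⟨t, ht, h0, h1, -⟩ := h.rotate hj
    exact ⟨n, t, ht, by rw [h0, h1, if_neg (by omega), Nat.add_sub_cancel, Sym2.eq_swap]⟩
  · obtain ⟨t, ht, h0, h1, -⟩ := h.rotate hi
    exact ⟨n, t, ht, by rw [h0, h1, if_neg (by omega), Nat.add_sub_cancel]⟩
  · exact ⟨n, s, h, by rw [← h', Nat.add_sub_cancel]⟩
  · exact ⟨n, s, h, by rw [← h', Nat.add_sub_cancel, Sym2.eq_swap]⟩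

end CycSeq

/-- The path `s 0, …, s (m + 1)` extends the set `X` to `Y` as an ear over an edge. -/
structure IsEar {V : Type} (H : SimpleGraph V) (X Y : Set V) (m : ℕ) (s : ℕ → V) : Prop where
  one_le : 1 ≤ m
  left_mem : s 0 ∈ X
  right_mem : s (m + 1) ∈ X
  adj : H.Adj (s 0) (s (m + 1))
  inj : ∀ i j, 1 ≤ i → i ≤ m → 1 ≤ j → j ≤ m → s i = s j → i = j
  new : ∀ i, 1 ≤ i → i ≤ m → s i ∉ X
  mem_iff : ∀ y, y ∈ Y ↔ y ∈ X ∨ ∃ i, 1 ≤ i ∧ i ≤ m ∧ y = s i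
  nbr : ∀ i, 1 ≤ i → i ≤ m → ∀ y ∈ Y, H.Adj (s i) y ↔ y = s (i - 1) ∨ y = s (i + 1)

namespace IsEar

variable {V : Type} {H : SimpleGraph V} {X Y : Set V} {m : ℕ} {s : ℕ → V}

theorem subset (h : IsEar H X Y m s) : X ⊆ Y := fun y hy => (h.mem_iff y).2 (Or.inl hy)

theorem mem (h : IsEar H X Y m s) {i : ℕ} (hi : i ≤ m + 1) : s i ∈ Y := by
  rw [h.mem_iff]
  rcases Nat.eq_zero_or_pos i with rfl | h0
  · exact Or.inl h.left_mem
  rcases hi.lt_or_eq with h1 | rfl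
  · exact Or.inr ⟨i, h0, by omega, rfl⟩
  · exact Or.inl h.right_mem

theorem inj' (h : IsEar H X Y m s) {i j : ℕ} (hi : i ≤ m + 1) (hj : j ≤ m + 1)
    (hij : s i = s j) : i = j := by
  by_contra hne
  wlog hlt : i < j generalizing i j
  · exact this hj hi hij.symm (Ne.symm hne) (by omega)
  rcases Nat.eq_zero_or_pos i with rfl | h0
  · rcases hj.lt_or_eq with h1 | rfl
    · exact h.new j (by omega) (by omega) (hij ▸ h.left_mem)
    · exact h.adj.ne hij
  · rcases hj.lt_or_eq with h1 | rfl
    · exact hne (h.inj i j h0 (by omega) (by omega) (by omega) hij)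
    · exact h.new i (by omega) (by omega) (hij ▸ h.right_mem)

theorem cycSeq (h : IsEar H X Y m s) : CycSeq H {y | ∃ i < m + 2, y = s i} (m + 2) s := by
  have hm := h.one_le
  refine ⟨by omega, fun i j hi hj => h.inj' (by omega) (by omega), fun x => Iff.rfl,
    fun i j hij hj => ?_⟩
  have key : ∀ i j, 1 ≤ i → i ≤ m → j ≤ m + 1 → (H.Adj (s i) (s j) ↔ j = i - 1 ∨ j = i + 1) := by
    intro i j h1 h2 h3
    rw [h.nbr i h1 h2 _ (h.mem h3)]
    constructor
    · rintro (h' | h')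
      exacts [Or.inl (h.inj' h3 (by omega) h'), Or.inr (h.inj' h3 (by omega) h')]
    · rintro (rfl | rfl)
      exacts [Or.inl rfl, Or.inr rfl]
  rcases Nat.eq_zero_or_pos i with rfl | h0
  · rcases (show j ≤ m + 1 by omega).lt_or_eq with h1 | rfl
    · rw [H.adj_comm, key j 0 (by omega) (by omega) (by omega)]; omega
    · exact iff_of_true h.adj (by omega)
  · rw [key i j h0 (by omega) (by omega)]; omega

theorem isChordlessCycle (h : IsEar H X Y m s) : IsChordlessCycle H {y | ∃ i < m + 2, y = s i} :=
  h.cycSeq.isChordlessCycle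

theorem cycle_subset (h : IsEar H X Y m s) : {y | ∃ i < m + 2, y = s i} ⊆ Y := by
  rintro _ ⟨i, hi, rfl⟩
  exact h.mem (by omega)

theorem not_cycle_subset (h : IsEar H X Y m s) : ¬ {y | ∃ i < m + 2, y = s i} ⊆ X :=
  fun h' => h.new 1 le_rfl h.one_le (h' ⟨1, by omega, rfl⟩)

/-- Every edge of the extended set lies in the old set or is an edge of the ear. -/
theorem edge_cases (h : IsEar H X Y m s) {a b : V} (ha : a ∈ Y) (hb : b ∈ Y) (hab : H.Adj a b) :
    (a ∈ X ∧ b ∈ X) ∨ ∃ i ≤ m, s(a, b) = s(s i, s (i + 1)) := by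
  have key : ∀ {a b}, a ∈ Y → b ∈ Y → H.Adj a b → a ∉ X → ∃ i ≤ m, s(a, b) = s(s i, s (i + 1)) := by
    intro a b ha hb hab haX
    obtain ⟨i, h1, h2, rfl⟩ := ((h.mem_iff a).1 ha).resolve_left haX
    rcases (h.nbr i h1 h2 b hb).1 hab with rfl | rfl
    · exact ⟨i - 1, by omega, by rw [Nat.sub_add_cancel h1, Sym2.eq_swap]⟩
    · exact ⟨i, h2, rfl⟩
  by_cases haX : a ∈ X
  · by_cases hbX : b ∈ X
    · exact Or.inl ⟨haX, hbX⟩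
    · obtain ⟨i, hi, h'⟩ := key hb ha hab.symm hbX
      exact Or.inr ⟨i, hi, by rw [Sym2.eq_swap, h']⟩
  · exact Or.inr (key ha hb hab haX)

theorem _root_.CycSeq.isEar {C : Set V} {n : ℕ} (h : CycSeq H C n s) :
    IsEar H {s 0, s (n - 1)} C (n - 2) s := by
  have h3 := h.three_le
  have e1 : n - 2 + 1 = n - 1 := by omega
  refine ⟨by omega, Or.inl rfl, Or.inr (by rw [e1]; rfl), ?_,
    fun i j _ hi _ hj => h.inj i j (by omega) (by omega), fun i h1 h2 hi => ?_, fun y => ?_,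
    fun i h1 h2 y hy => ?_⟩
  · rw [e1]; exact h.adj_zero_last
  · rcases hi with h' | h'
    · have := h.inj i 0 (by omega) (by omega) h'; omega
    · have := h.inj i (n - 1) (by omega) (by omega) h'; omega
  · rw [h.mem_iff]
    constructor
    · rintro ⟨i, hi, rfl⟩
      by_cases h0 : i = 0
      · exact Or.inl (Or.inl (by rw [h0]))
      by_cases h1 : i = n - 1
      · exact Or.inl (Or.inr (by rw [h1]; rfl))
      exact Or.inr ⟨i, by omega, by omega, rfl⟩
    · rintro ((rfl | rfl) | ⟨i, h1, h2, rfl⟩)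
      exacts [⟨0, by omega, rfl⟩, ⟨n - 1, by omega, rfl⟩, ⟨i, by omega, rfl⟩]
  · obtain ⟨j, hj, rfl⟩ := (h.mem_iff y).1 hy
    rw [h.adj_iff' (by omega) hj]
    constructor
    · rintro (rfl | rfl | h' | h')
      · exact Or.inr rfl
      · exact Or.inl (by rw [Nat.add_sub_cancel])
      · omega
      · omega
    · rintro (h' | h')
      · have := h.inj _ _ hj (by omega) h'; omega
      · have := h.inj _ _ hj (by omega) h'; omega

end IsEar

namespace TCSet

variable {V : Type} {H : SimpleGraph V} {X : Set V}

theorem of_isEar {Y : Set V} {m : ℕ} {s : ℕ → V} (hX : TCSet H X) (h : IsEar H X Y m s) :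
    TCSet H Y :=
  hX.ear h.one_le h.left_mem h.right_mem h.adj h.inj h.new h.mem_iff h.nbr

/-- Induction over the construction of a tree of cycles, with the ear data bundled. -/
@[elab_as_elim]
theorem induction_ear {P : ∀ X : Set V, TCSet H X → Prop}
    (cycle : ∀ (X : Set V) (n : ℕ) (s : ℕ → V) (h : CycSeq H X n s), P X (.cycle h))
    (ear : ∀ (X Y : Set V) (m : ℕ) (s : ℕ → V) (hX : TCSet H X) (h : IsEar H X Y m s), P X hX →
      P Y (hX.of_isEar h)) {X : Set V} (hX : TCSet H X) : P X hX := by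
  induction hX with
  | cycle h => exact cycle _ _ _ h
  | ear hX hm h0 h1 hadj hinj hnew hmem hnbr ih =>
    exact ear _ _ _ _ hX ⟨hm, h0, h1, hadj, hinj, hnew, hmem, hnbr⟩ ih

theorem exists_chordless (hX : TCSet H X) : ∀ a ∈ X, ∀ b ∈ X, H.Adj a b →
    ∃ S, IsChordlessCycle H S ∧ S ⊆ X ∧ a ∈ S ∧ b ∈ S := by
  refine hX.induction_ear (fun X n s h a ha b hb _ => ⟨X, h.isChordlessCycle, subset_rfl, ha, hb⟩)
    (fun X Y m s _ h ih a ha b hb hab => ?_)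
  rcases h.edge_cases ha hb hab with ⟨ha, hb⟩ | ⟨i, hi, h'⟩
  · obtain ⟨S, hS, hSX, haS, hbS⟩ := ih a ha b hb hab
    exact ⟨S, hS, hSX.trans h.subset, haS, hbS⟩
  · refine ⟨_, h.isChordlessCycle, h.cycle_subset, ?_⟩
    have h1 : s i ∈ {y | ∃ i < m + 2, y = s i} := ⟨i, by omega, rfl⟩
    have h2 : s (i + 1) ∈ {y | ∃ i < m + 2, y = s i} := ⟨i + 1, by omega, rfl⟩
    rcases Sym2.eq_iff.1 h' with ⟨rfl, rfl⟩ | ⟨rfl, rfl⟩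
    exacts [⟨h1, h2⟩, ⟨h2, h1⟩]

theorem exists_adj_ne (hX : TCSet H X) : ∀ a ∈ X, ∀ b, ∃ z ∈ X, z ≠ b ∧ H.Adj a z := by
  refine hX.induction_ear ?_ ?_
  · intro X n s h a ha b
    obtain ⟨n, s, h, rfl⟩ := h.isChordlessCycle.exists_cycSeq ha
    have h3 := h.three_le
    by_cases hb : s 1 = b
    · refine ⟨s (n - 1), h.mem (by omega), fun h' => ?_, h.adj_zero_last⟩
      have := h.inj _ _ (by omega) (by omega) (hb.trans h'.symm)
      omega
    · exact ⟨s 1, h.mem (by omega), hb, h.adj_succ (by omega)⟩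
  · intro X Y m s _ h ih a ha b
    rcases (h.mem_iff a).1 ha with ha | ⟨i, h1, h2, rfl⟩
    · obtain ⟨z, hz, h'⟩ := ih a ha b
      exact ⟨z, h.subset hz, h'⟩
    · by_cases hb : s (i - 1) = b
      · refine ⟨s (i + 1), h.mem (by omega), fun h' => ?_,
          (h.nbr i h1 h2 _ (h.mem (by omega))).2 (Or.inr rfl)⟩
        have := h.inj' (by omega) (by omega) (hb.trans h'.symm)
        omega
      · exact ⟨s (i - 1), h.mem (by omega), hb,
          (h.nbr i h1 h2 _ (h.mem (by omega))).2 (Or.inl rfl)⟩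

theorem cliqueFree (hX : TCSet H X) : ∀ a ∈ X, ∀ b ∈ X, ∀ c ∈ X, ∀ d ∈ X, H.Adj a b → H.Adj a c →
    H.Adj a d → H.Adj b c → H.Adj b d → H.Adj c d → False := by
  refine hX.induction_ear ?_ ?_
  · intro X n s h a ha b hb c hc d hd hab hac had hbc hbd hcd
    obtain ⟨n, s, h, rfl⟩ := h.isChordlessCycle.exists_cycSeq ha
    obtain ⟨i, hi, rfl⟩ := (h.mem_iff _).1 hb
    obtain ⟨j, hj, rfl⟩ := (h.mem_iff _).1 hc
    obtain ⟨k, hk, rfl⟩ := (h.mem_iff _).1 hd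
    have h3 := h.three_le
    have h1 := hbc.ne
    have h2 := hbd.ne
    have h4 := hcd.ne
    have e1 : i ≠ j := fun h => h1 (by rw [h])
    have e2 : i ≠ k := fun h => h2 (by rw [h])
    have e3 : j ≠ k := fun h => h4 (by rw [h])
    rw [h.adj_iff' (by omega) (by omega)] at hab hac had
    omega
  · intro X Y m s _ h ih a ha b hb c hc d hd hab hac had hbc hbd hcd
    have key : ∀ a b c d, b ∈ Y → c ∈ Y → d ∈ Y → H.Adj a b → H.Adj a c → H.Adj a d → b ≠ c →
        b ≠ d → c ≠ d → a ∈ Y → a ∈ X := by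
      intro a b c d hb hc hd hab hac had h1 h2 h3 ha
      refine ((h.mem_iff a).1 ha).resolve_right ?_
      rintro ⟨i, hi, hi', rfl⟩
      rw [h.nbr i hi hi' _ (by assumption)] at hab hac had
      grind
    exact ih a (key a b c d hb hc hd hab hac had hbc.ne hbd.ne hcd.ne ha)
      b (key b a c d ha hc hd hab.symm hbc hbd hac.ne had.ne hcd.ne hb)
      c (key c a b d ha hb hd hac.symm hbc.symm hcd hab.ne had.ne hbd.ne hc)
      d (key d a b c ha hb hc had.symm hbd.symm hcd.symm hab.ne hac.ne hbc.ne hd)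
      hab hac had hbc hbd hcd

end TCSet

section sweep

variable {V : Type} {H : SimpleGraph V} {X Y : Set V} {e₂ : Sym2 V} {A : Set (Sym2 V)} {m : ℕ}
  {s : ℕ → V}

theorem HasBagLine.congr_set {e₁ : Sym2 V} (h : HasBagLine H X e₁ e₂ A)
    (hXY : ∀ y, y ∈ Y ↔ y ∈ X) : HasBagLine H Y e₁ e₂ A := by
  rwa [Set.ext hXY]

/-- Sweep the left tail over an ear, ending at any prescribed edge of the ear. -/
theorem HasBagLine.ear (h : HasBagLine H X s(s 0, s (m + 1)) e₂ A) (hear : IsEar H X Y m s)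
    (hA : s(s 0, s (m + 1)) ∈ A) {i : ℕ} (hi : i ≤ m) :
    HasBagLine H Y s(s i, s (i + 1)) e₂ (Insert.insert s(s i, s (i + 1)) A) := by
  have hnbr : ∀ j, 1 ≤ j → j ≤ m → ∀ y ∈ Y, H.Adj (s j) y → y = s (j - 1) ∨ y = s (j + 1) :=
    fun j h1 h2 y hy => (hear.nbr j h1 h2 y hy).1
  let Z : ℕ → ℕ → Set V := fun j k =>
    {y | y ∈ X ∨ ∃ l, 1 ≤ l ∧ l ≤ m ∧ (l ≤ j ∨ m + 1 - k ≤ l) ∧ y = s l}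
  have hZY : ∀ j k y, y ∈ Z j k → y ∈ Y := by
    rintro j k y (hy | ⟨l, h1, h2, -, rfl⟩)
    exacts [hear.subset hy, hear.mem (by omega)]
  have mem_Z : ∀ j k l, l ≤ m + 1 → s l ∈ Z j k → l ≤ j ∨ m + 1 - k ≤ l := by
    rintro j k l hl (hy | ⟨l', h1, h2, h3, h4⟩)
    · by_contra hcon
      exact hear.new l (by omega) (by omega) hy
    · rwa [hear.inj' hl (by omega) h4]
  have base : HasBagLine H (Z 0 0) s(s 0, s (m + 1)) e₂ (Insert.insert s(s 0, s (m + 1)) A) := by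
    rw [Set.insert_eq_of_mem hA]
    refine h.congr_set fun y => ⟨?_, Or.inl⟩
    rintro (hy | ⟨l, h1, h2, h3, rfl⟩)
    · exact hy
    · omega
  have first : ∀ j ≤ m, HasBagLine H (Z j 0) s(s j, s (m + 1)) e₂
      (Insert.insert s(s j, s (m + 1)) A) := by
    intro j
    induction j with
    | zero => exact fun _ => base
    | succ j ih =>
      intro hj
      refine (((ih (by omega)).mono (Set.subset_insert _ _)).step (x := s (j + 1)) ?_ ?_).congr_set
        fun y => ?_
      · intro hx
        have := mem_Z _ _ _ (by omega) hx
        omega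
      · intro y hy hadj
        rcases hnbr (j + 1) (by omega) hj y (hZY _ _ _ hy) hadj with rfl | rfl
        · exact Or.inl rfl
        · have := mem_Z _ _ _ (by omega) hy
          exact Or.inr (by congr 1; omega)
      · constructor
        · rintro (hy | ⟨l, h1, h2, h3, rfl⟩)
          · exact Or.inr (Or.inl hy)
          · by_cases hl : l = j + 1
            · exact Or.inl (by rw [hl])
            · exact Or.inr (Or.inr ⟨l, h1, h2, by omega, rfl⟩)
        · rintro (rfl | hy | ⟨l, h1, h2, h3, rfl⟩)
          exacts [Or.inr ⟨j + 1, by omega, hj, by omega, rfl⟩, Or.inl hy,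
            Or.inr ⟨l, h1, h2, by omega, rfl⟩]
  have second : ∀ k, i + k ≤ m → HasBagLine H (Z i k) s(s i, s (m + 1 - k)) e₂
      (Insert.insert s(s i, s (m + 1 - k)) A) := by
    intro k
    induction k with
    | zero => exact fun _ => first i hi
    | succ k ih =>
      intro hk
      have ih := (ih (by omega)).mono (Set.subset_insert _ _)
      rw [Sym2.eq_swap] at ih ⊢
      refine (ih.step (x := s (m + 1 - (k + 1))) ?_ ?_).congr_set fun y => ?_
      · intro hx
        have := mem_Z _ _ _ (by omega) hx
        omega
      · intro y hy hadj
        rcases hnbr _ (by omega) (by omega) y (hZY _ _ _ hy) hadj with rfl | rfl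
        · have := mem_Z _ _ _ (by omega) hy
          exact Or.inr (by congr 1; omega)
        · exact Or.inl (by congr 1; omega)
      · constructor
        · rintro (hy | ⟨l, h1, h2, h3, rfl⟩)
          · exact Or.inr (Or.inl hy)
          · by_cases hl : l = m + 1 - (k + 1)
            · exact Or.inl (by rw [hl])
            · exact Or.inr (Or.inr ⟨l, h1, h2, by omega, rfl⟩)
        · rintro (rfl | hy | ⟨l, h1, h2, h3, rfl⟩)
          exacts [Or.inr ⟨m + 1 - (k + 1), by omega, by omega, by omega, rfl⟩, Or.inl hy,
            Or.inr ⟨l, h1, h2, by omega, rfl⟩]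
  have := second (m - i) (by omega)
  rw [show m + 1 - (m - i) = i + 1 by omega] at this
  refine this.congr_set fun y => ?_
  rw [hear.mem_iff]
  constructor
  · rintro (hy | ⟨l, h1, h2, rfl⟩)
    exacts [Or.inl hy, Or.inr ⟨l, h1, h2, by omega, rfl⟩]
  · rintro (hy | ⟨l, h1, h2, -, rfl⟩)
    exacts [Or.inl hy, Or.inr ⟨l, h1, h2, rfl⟩]

end sweep

section chordless

variable {V : Type} {H : SimpleGraph V}

theorem IsEdgeSeparator.symm {a b : V} (h : IsEdgeSeparator H a b) : IsEdgeSeparator H b a := by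
  obtain ⟨hab, S, T, hST, hS, hT, h1, h2, h3, h4⟩ := h
  exact ⟨hab.symm, S, T, hST, hS, hT, h2, h1, h4, h3⟩

/-- The edges inside `X` through which some induced cycle leaves `X`. -/
def activeEdges (H : SimpleGraph V) (X : Set V) : Set (Sym2 V) :=
  {e | ∃ a b, e = s(a, b) ∧ a ∈ X ∧ b ∈ X ∧ H.Adj a b ∧
    ∃ S, IsChordlessCycle H S ∧ a ∈ S ∧ b ∈ S ∧ ¬ S ⊆ X}

/-- The body cycles leaving `X` through the edge `ab`. -/
def bodyCycles (H : SimpleGraph V) (X : Set V) (a b : V) : Set (Set V) :=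
  {S | IsChordlessCycle H S ∧ a ∈ S ∧ b ∈ S ∧ ¬ IsSimplicialTriangle H S ∧ ¬ S ⊆ X}

theorem bodyCycles_comm (X : Set V) (a b : V) : bodyCycles H X a b = bodyCycles H X b a := by
  ext S
  simp only [bodyCycles, Set.mem_ofPred_eq]
  tauto

theorem bodyCycles_anti {X Y : Set V} (h : X ⊆ Y) (a b : V) :
    bodyCycles H Y a b ⊆ bodyCycles H X a b :=
  fun _ ⟨h1, h2, h3, h4, h5⟩ => ⟨h1, h2, h3, h4, fun h' => h5 (h'.trans h)⟩

/-- The set `X` is arranged in a bag line that can still be extended, at its two tails by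
body cycles and anywhere by simplicial triangles. -/
def HasTails (H : SimpleGraph V) (X : Set V) : Prop :=
  ∃ e₁ e₂, HasBagLine H X e₁ e₂ (activeEdges H X) ∧ ∀ a ∈ X, ∀ b ∈ X, H.Adj a b →
    ((bodyCycles H X a b).ncard ≤ 1 ∨ s(a, b) = e₁ ∧ s(a, b) = e₂) ∧
    (bodyCycles H X a b = ∅ ∨ s(a, b) = e₁ ∨ s(a, b) = e₂)

variable {X Y : Set V} {m : ℕ} {s : ℕ → V}

theorem activeEdges_subset (hear : IsEar H X Y m s) {e : Sym2 V} (he : e ∈ activeEdges H Y) :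
    e ∈ activeEdges H X ∨ ∃ i ≤ m, e = s(s i, s (i + 1)) ∧
      ∃ S, IsChordlessCycle H S ∧ s i ∈ S ∧ s (i + 1) ∈ S ∧ ¬ S ⊆ Y := by
  obtain ⟨a, b, rfl, ha, hb, hab, S, hS, haS, hbS, hSY⟩ := he
  rcases hear.edge_cases ha hb hab with ⟨ha, hb⟩ | ⟨i, hi, h⟩
  · exact Or.inl ⟨a, b, rfl, ha, hb, hab, S, hS, haS, hbS, fun h => hSY (h.trans hear.subset)⟩
  · refine Or.inr ⟨i, hi, h, S, hS, ?_⟩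
    rcases Sym2.eq_iff.1 h with ⟨rfl, rfl⟩ | ⟨rfl, rfl⟩
    exacts [⟨haS, hbS, hSY⟩, ⟨hbS, haS, hSY⟩]

theorem bodyCycles_congr {a b c d : V} (h : s(a, b) = s(c, d)) :
    bodyCycles H X a b = bodyCycles H X c d := by
  rcases Sym2.eq_iff.1 h with ⟨rfl, rfl⟩ | ⟨rfl, rfl⟩
  exacts [rfl, bodyCycles_comm _ _ _]

theorem IsEar.edge_ne (hear : IsEar H X Y m s) {i : ℕ} (hi : i ≤ m) :
    s(s 0, s (m + 1)) ≠ s(s i, s (i + 1)) := by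
  have hm := hear.one_le
  intro h
  rcases Sym2.eq_iff.1 h with ⟨h1, h2⟩ | ⟨h1, h2⟩
  · have := hear.inj' (by omega) (by omega) h1
    have := hear.inj' (by omega) (by omega) h2
    omega
  · have := hear.inj' (by omega) (by omega) h1
    omega

theorem IsEar.edge_inj (hear : IsEar H X Y m s) {i j : ℕ} (hi : i ≤ m) (hj : j ≤ m)
    (h : s(s i, s (i + 1)) = s(s j, s (j + 1))) : i = j := by
  rcases Sym2.eq_iff.1 h with ⟨h1, h2⟩ | ⟨h1, h2⟩
  · exact hear.inj' (by omega) (by omega) h1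
  · have := hear.inj' (by omega) (by omega) h1
    have := hear.inj' (by omega) (by omega) h2
    omega

/-- Attach a body cycle. -/
theorem HasTails.ear_body [Finite V] (h : HasTails H X) (hear : IsEar H X Y m s)
    (hC : ¬ IsSimplicialTriangle H {y | ∃ i < m + 2, y = s i})
    (h2 : ∀ S : Set V, IsChordlessCycle H S →
      {e : Sym2 V | ∃ u v : V, e = s(u, v) ∧ u ∈ S ∧ v ∈ S ∧ IsEdgeSeparator H u v}.ncard ≤ 2)
    (h3 : ∀ u v : V, H.Adj u v →
      {S : Set V | IsChordlessCycle H S ∧ u ∈ S ∧ v ∈ S ∧ ¬ IsSimplicialTriangle H S}.ncard ≤ 2)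
    (hsep : IsEdgeSeparator H (s 0) (s (m + 1)) ∨
      ∀ i ≤ m, ¬ IsEdgeSeparator H (s i) (s (i + 1))) : HasTails H Y := by
  obtain ⟨C, hCdef⟩ : ∃ C, C = {y | ∃ i < m + 2, y = s i} := ⟨_, rfl⟩
  have hCc : IsChordlessCycle H C := hCdef ▸ hear.isChordlessCycle
  have hCY : C ⊆ Y := hCdef ▸ hear.cycle_subset
  have hCX : ¬ C ⊆ X := hCdef ▸ hear.not_cycle_subset
  rw [← hCdef] at hC
  have hmemC : ∀ i ≤ m + 1, s i ∈ C := fun i hi => hCdef ▸ ⟨i, by omega, rfl⟩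
  have hCb : C ∈ bodyCycles H X (s 0) (s (m + 1)) :=
    ⟨hCc, hmemC _ (by omega), hmemC _ le_rfl, hC, hCX⟩
  obtain ⟨e₁, e₂, hB, ht⟩ := h
  have ht0 := ht _ hear.left_mem _ hear.right_mem hear.adj
  wlog he : s(s 0, s (m + 1)) = e₁ generalizing e₁ e₂
  · refine this e₂ e₁ hB.reverse (fun a ha b hb hab => ?_) ?_ ?_
    · have := ht a ha b hb hab
      tauto
    · tauto
    · exact (ht0.2.resolve_left (Set.nonempty_iff_ne_empty.1 ⟨C, hCb⟩)).resolve_left he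
  subst he
  have hact : s(s 0, s (m + 1)) ∈ activeEdges H X :=
    ⟨_, _, rfl, hear.left_mem, hear.right_mem, hear.adj, C, hCc, hmemC _ (by omega),
      hmemC _ le_rfl, hCX⟩
  have hadj : ∀ i ≤ m, H.Adj (s i) (s (i + 1)) := fun i hi => hear.cycSeq.adj_succ (by omega)
  obtain ⟨i, hi, hiu⟩ : ∃ i ≤ m, ∀ j ≤ m, j ≠ i →
      ¬ ∃ S, IsChordlessCycle H S ∧ s j ∈ S ∧ s (j + 1) ∈ S ∧ ¬ S ⊆ Y := by
    by_contra! hcon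
    have hsepj : ∀ j ≤ m, (∃ S, IsChordlessCycle H S ∧ s j ∈ S ∧ s (j + 1) ∈ S ∧ ¬ S ⊆ Y) →
        IsEdgeSeparator H (s j) (s (j + 1)) := by
      rintro j hj ⟨S, hS, h1, h2, h3⟩
      exact ⟨hadj j hj, C, S, fun h => h3 (h ▸ hCY), hCc, hS, hmemC _ (by omega),
        hmemC _ (by omega), h1, h2⟩
    obtain ⟨j, hj, -, hjS⟩ := hcon 0 (by omega)
    obtain ⟨k, hk, hkj, hkS⟩ := hcon j hj
    have h0 := hsep.resolve_right fun h => h j hj (hsepj j hj hjS)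
    have hsub : ({s(s 0, s (m + 1)), s(s j, s (j + 1)), s(s k, s (k + 1))} : Set (Sym2 V)) ⊆
        {e | ∃ u v, e = s(u, v) ∧ u ∈ C ∧ v ∈ C ∧ IsEdgeSeparator H u v} := by
      rintro _ (rfl | rfl | rfl)
      exacts [⟨_, _, rfl, hmemC _ (by omega), hmemC _ (by omega), h0⟩,
        ⟨_, _, rfl, hmemC _ (by omega), hmemC _ (by omega), hsepj j hj hjS⟩,
        ⟨_, _, rfl, hmemC _ (by omega), hmemC _ (by omega), hsepj k hk hkS⟩]
    have := (Set.ncard_le_ncard hsub).trans (h2 C hCc)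
    rw [Set.ncard_eq_three.2 ⟨_, _, _, hear.edge_ne hj, hear.edge_ne hk,
      fun h => hkj (hear.edge_inj hj hk h).symm, rfl⟩] at this
    omega
  refine ⟨s(s i, s (i + 1)), e₂, (hB.ear hear hact hi).mono fun e he => ?_,
    fun a ha b hb hab => ?_⟩
  · rcases activeEdges_subset hear he with h | ⟨j, hj, rfl, hS⟩
    · exact Or.inr h
    · refine Or.inl ?_
      by_contra hne
      exact hiu j hj (fun h => hne (by rw [h])) hS
  rcases hear.edge_cases ha hb hab with ⟨ha, hb⟩ | ⟨j, hj, hj'⟩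
  · by_cases hcd : s(a, b) = s(s 0, s (m + 1))
    · rw [bodyCycles_congr hcd, hcd]
      have hss : bodyCycles H Y (s 0) (s (m + 1)) ⊆ bodyCycles H X (s 0) (s (m + 1)) \ {C} :=
        fun S hS => ⟨bodyCycles_anti hear.subset _ _ hS, fun h => hS.2.2.2.2 (h ▸ hCY)⟩
      have h4 := Set.ncard_le_ncard hss
      have h5 := Set.ncard_sdiff_singleton_add_one hCb
      have h6 : (bodyCycles H X (s 0) (s (m + 1))).ncard ≤ 2 := by
        refine le_trans (Set.ncard_le_ncard ?_) (h3 _ _ hear.adj)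
        exact fun S hS => ⟨hS.1, hS.2.1, hS.2.2.1, hS.2.2.2.1⟩
      refine ⟨Or.inl (by omega), ?_⟩
      by_cases h7 : s(s 0, s (m + 1)) = e₂
      · exact Or.inr (Or.inr h7)
      · have := ht0.1.resolve_right fun h => h7 h.2
        exact Or.inl ((Set.ncard_eq_zero).1 (by omega))
    · have h4 := Set.ncard_le_ncard (bodyCycles_anti (H := H) hear.subset a b)
      obtain ⟨h5, h6⟩ := ht a ha b hb hab
      refine ⟨Or.inl (h4.trans (h5.resolve_right fun h => hcd h.1)), ?_⟩
      rcases h6 with h6 | h6 | h6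
      · exact Or.inl (Set.subset_empty_iff.1 (h6 ▸ bodyCycles_anti hear.subset a b))
      · exact absurd h6 hcd
      · exact Or.inr (Or.inr h6)
  · rw [bodyCycles_congr hj', hj']
    by_cases hji : j = i
    · subst hji
      refine ⟨Or.inl ?_, Or.inr (Or.inl rfl)⟩
      have hCm : C ∈ {S | IsChordlessCycle H S ∧ s j ∈ S ∧ s (j + 1) ∈ S ∧
          ¬ IsSimplicialTriangle H S} := ⟨hCc, hmemC _ (by omega), hmemC _ (by omega), hC⟩
      have hss : bodyCycles H Y (s j) (s (j + 1)) ⊆ {S | IsChordlessCycle H S ∧ s j ∈ S ∧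
          s (j + 1) ∈ S ∧ ¬ IsSimplicialTriangle H S} \ {C} :=
        fun S hS => ⟨⟨hS.1, hS.2.1, hS.2.2.1, hS.2.2.2.1⟩, fun h => hS.2.2.2.2 (h ▸ hCY)⟩
      have h4 := Set.ncard_le_ncard hss
      have h5 := Set.ncard_sdiff_singleton_add_one hCm
      have h6 := h3 _ _ (hadj j hj)
      omega
    · have : bodyCycles H Y (s j) (s (j + 1)) = ∅ := by
        rw [Set.eq_empty_iff_forall_notMem]
        rintro S ⟨h1, h2, h3, -, h5⟩
        exact hiu j hj hji ⟨S, h1, h2, h3, h5⟩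
      rw [this]
      exact ⟨Or.inl (by simp), Or.inl rfl⟩

/-- Attach a simplicial triangle. -/
theorem HasTails.ear_simplicial [Finite V] (h : HasTails H X) (hear : IsEar H X Y 1 s)
    (hH : TCSet H Set.univ) (hs : H.IsClique (H.neighborSet (s 1))) : HasTails H Y := by
  obtain ⟨e₁, e₂, hB, ht⟩ := h
  have ha0 : H.Adj (s 1) (s 0) := (hear.cycSeq.adj_succ (i := 0) (by omega)).symm
  have ha2 : H.Adj (s 1) (s 2) := hear.cycSeq.adj_succ (i := 1) (by omega)
  have hY : Y = insert (s 1) X := by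
    ext y
    rw [hear.mem_iff, Set.mem_insert_iff]
    constructor
    · rintro (hy | ⟨i, h1, h2, rfl⟩)
      · exact Or.inr hy
      · exact Or.inl (by rw [le_antisymm h2 h1])
    · rintro (rfl | hy)
      exacts [Or.inr ⟨1, le_rfl, le_rfl, rfl⟩, Or.inl hy]
  have hin : ∀ i ≤ 1, ∀ S, IsChordlessCycle H S → s i ∈ S → s (i + 1) ∈ S → S ⊆ Y := by
    intro i hi S hS h1 h2
    have hx : s 1 ∈ S := by
      interval_cases i
      exacts [h2, h1]
    obtain ⟨n, t, hC, ht0⟩ := hS.exists_cycSeq hx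
    have h3 := hC.three_le
    have n1 : H.Adj (s 1) (t 1) := ht0 ▸ hC.adj_succ (by omega)
    have n2 : H.Adj (s 1) (t (n - 1)) := ht0 ▸ hC.adj_zero_last
    have hne : t 1 ≠ t (n - 1) := fun h => by
      have := hC.inj _ _ (by omega) (by omega) h; omega
    have n3 : n = 3 := by
      have := (hC.adj_iff' (i := 1) (j := n - 1) (by omega) (by omega)).1 (hs n1 n2 hne)
      omega
    subst n3
    have key : ∀ x, H.Adj (s 1) x → x = s 0 ∨ x = s 2 := by
      intro x hx
      by_contra! hcon
      exact hH.cliqueFree (s 1) trivial x trivial (s 0) trivial (s 2) trivial hx ha0 ha2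
        (hs hx ha0 hcon.1) (hs hx ha2 hcon.2) hear.adj
    intro y hy
    obtain ⟨j, hj, rfl⟩ := (hC.mem_iff y).1 hy
    have hnbr : ∀ x, H.Adj (s 1) x → x ∈ Y := by
      intro x hx
      rcases key x hx with rfl | rfl
      exacts [hear.mem (by omega), hear.mem (by omega)]
    interval_cases j
    · rw [ht0]; exact hear.mem (by omega)
    · exact hnbr _ n1
    · exact hnbr _ n2
  have hact : s(s 0, s 2) ∈ activeEdges H X :=
    ⟨_, _, rfl, hear.left_mem, hear.right_mem, hear.adj, _, hear.isChordlessCycle,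
      ⟨0, by omega, rfl⟩, ⟨2, by omega, rfl⟩, hear.not_cycle_subset⟩
  refine ⟨e₁, e₂, ?_, fun a ha b hb hab => ?_⟩
  · rw [hY] at hear hin ⊢
    refine (hB.insert hact (hear.new 1 le_rfl le_rfl) fun y hy hadj => ?_).mono fun e he => ?_
    · exact (hear.nbr 1 le_rfl le_rfl y (Set.mem_insert_of_mem _ hy)).1 hadj
    · rcases activeEdges_subset hear he with h | ⟨j, hj, -, S, hS, h1, h2, h3⟩
      · exact h
      · exact absurd (hin j hj S hS h1 h2) h3
  · rcases hear.edge_cases ha hb hab with ⟨ha, hb⟩ | ⟨j, hj, hj'⟩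
    · obtain ⟨h5, h6⟩ := ht a ha b hb hab
      have h4 := bodyCycles_anti (H := H) hear.subset a b
      exact ⟨h5.imp_left (Set.ncard_le_ncard h4).trans,
        h6.imp_left fun h => Set.subset_empty_iff.1 (h4.trans h.subset)⟩
    · have : bodyCycles H Y a b = ∅ := by
        rw [bodyCycles_congr hj', Set.eq_empty_iff_forall_notMem]
        rintro S ⟨h1, h2, h3, -, h5⟩
        exact h5 (hin j hj S h1 h2 h3)
      rw [this]
      exact ⟨Or.inl (by simp), Or.inl rfl⟩

theorem HasTails.pair {c d : V} (hcd : H.Adj c d) : HasTails H {c, d} := by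
  have key : ∀ a ∈ ({c, d} : Set V), ∀ b ∈ ({c, d} : Set V), H.Adj a b → s(a, b) = s(c, d) := by
    rintro a (rfl | rfl) b (rfl | rfl) hab
    exacts [absurd rfl hab.ne, rfl, Sym2.eq_swap, absurd rfl hab.ne]
  refine ⟨s(c, d), s(c, d), HasBagLine.pair ?_, fun a ha b hb hab => ?_⟩
  · rintro _ ⟨a, b, rfl, ha, hb, hab, -⟩
    exact key a ha b hb hab
  · have := key a ha b hb hab
    tauto

theorem IsPathOfCycles.hasTails [Finite V] (h : IsPathOfCycles H) : HasTails H Set.univ := by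
  obtain ⟨hT, h2, h3⟩ := h
  rw [isTreeOfCycles_iff] at hT
  suffices ∀ X, TCSet H X → HasTails H X from this _ hT
  intro X hX
  induction hX using TCSet.induction_ear with
  | cycle C n s hC =>
    have hCc := hC.isChordlessCycle
    have h3n := hC.three_le
    by_cases hs : IsSimplicialTriangle H C
    · obtain ⟨-, hcard, v, hv, hcl⟩ := hs
      obtain ⟨n, t, hC, rfl⟩ := hCc.exists_cycSeq hv
      have h3n := hC.three_le
      obtain ⟨u, hu, hlast, -, hone⟩ := hC.rotate (k := n - 1) (by omega)
      rw [if_pos (by omega)] at hone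
      have hn : n = 3 := by
        rw [← hcard]
        have : C = (Set.range fun i : Fin n => t i) := by
          ext x
          rw [hC.mem_iff]
          exact ⟨fun ⟨i, hi, h⟩ => ⟨⟨i, hi⟩, h.symm⟩, fun ⟨i, h⟩ => ⟨i, i.2, h.symm⟩⟩
        rw [this, ← Set.image_univ, Set.ncard_image_of_injective _ fun i j hij =>
          Fin.ext (hC.inj _ _ i.2 j.2 hij), Set.ncard_univ, Nat.card_fin]
      subst hn
      rw [← hone] at hcl
      exact (HasTails.pair hu.adj_zero_last).ear_simplicial hu.isEar hT hcl
    · obtain ⟨n, t, hC, hsep⟩ : ∃ n t, CycSeq H C n t ∧ (IsEdgeSeparator H (t 0) (t (n - 1)) ∨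
          ∀ x ∈ C, ∀ y ∈ C, ¬ IsEdgeSeparator H x y) := by
        by_cases hx : ∃ x ∈ C, ∃ y ∈ C, IsEdgeSeparator H x y
        · obtain ⟨x, hx, y, hy, hxy⟩ := hx
          obtain ⟨n, t, ht, he⟩ := hCc.exists_cycSeq_of_adj hx hy hxy.1
          refine ⟨n, t, ht, Or.inl ?_⟩
          rcases Sym2.eq_iff.1 he with ⟨h1, h2⟩ | ⟨h1, h2⟩
          · rwa [h1, h2]
          · rw [h1, h2]; exact hxy.symm
        · push Not at hx
          exact ⟨n, s, hC, Or.inr hx⟩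
      have h3n := hC.three_le
      have e1 : n - 2 + 1 = n - 1 := by omega
      refine (HasTails.pair hC.adj_zero_last).ear_body hC.isEar ?_ h2 h3 ?_
      · rwa [show {y | ∃ i < n - 2 + 2, y = t i} = C by
          ext x; rw [hC.mem_iff, show n - 2 + 2 = n by omega]; rfl]
      · rw [e1]
        exact hsep.imp_right fun h i hi => h _ (hC.mem (by omega)) _ (hC.mem (by omega))
  | ear X Y m s hX hear ih =>
    by_cases hs : IsSimplicialTriangle H {y | ∃ i < m + 2, y = s i}
    · obtain ⟨-, hcard, v, ⟨i, hi, rfl⟩, hcl⟩ := hs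
      have hm : m = 1 := by
        have : {y | ∃ i < m + 2, y = s i} = (Set.range fun i : Fin (m + 2) => s i) := by
          ext x
          exact ⟨fun ⟨i, hi, h⟩ => ⟨⟨i, hi⟩, h.symm⟩, fun ⟨i, h⟩ => ⟨i, i.2, h.symm⟩⟩
        rw [this, ← Set.image_univ, Set.ncard_image_of_injective _ fun i j hij =>
          Fin.ext (hear.inj' (by omega) (by omega) hij), Set.ncard_univ, Nat.card_fin] at hcard
        omega
      subst hm
      have hi1 : i = 1 := by
        have key : ∀ a b, H.IsClique (H.neighborSet a) → a ∈ X → H.Adj a (s 1) →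
            (∀ y ∈ Y, H.Adj (s 1) y → y = a ∨ y = b) → False := by
          intro a b hcl ha ha1 hN
          obtain ⟨z, hz, hzb, haz⟩ := hX.exists_adj_ne a ha b
          have h1z : s 1 ≠ z := fun h => hear.new 1 le_rfl le_rfl (h ▸ hz)
          rcases hN z (hear.subset hz) (hcl ha1 haz h1z) with rfl | rfl
          exacts [haz.ne rfl, hzb rfl]
        have hN : ∀ y ∈ Y, H.Adj (s 1) y → y = s 0 ∨ y = s 2 := fun y hy =>
          (hear.nbr 1 le_rfl le_rfl y hy).1
        interval_cases i
        · exact (key (s 0) (s 2) hcl hear.left_mem (hear.cycSeq.adj_succ (by omega)) hN).elim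
        · rfl
        · exact (key (s 2) (s 0) hcl hear.right_mem (hear.cycSeq.adj_succ (by omega)).symm
            fun y hy h => (hN y hy h).symm).elim
      subst hi1
      exact ih.ear_simplicial hear hT hcl
    · refine ih.ear_body hear hs h2 h3 (Or.inl ⟨hear.adj, ?_⟩)
      obtain ⟨S, hS, hSX, h0, h1⟩ := hX.exists_chordless _ hear.left_mem _ hear.right_mem hear.adj
      exact ⟨S, _, fun h => hear.not_cycle_subset (h.symm.subset.trans hSX), hS, hear.isChordlessCycle,
        h0, h1,
        ⟨0, by omega, rfl⟩, ⟨m + 1, by omega, rfl⟩⟩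

/-- A two-connected graph whose cell completion is a path of cycles has pathwidth two. -/
theorem pw_eq_two_of_isPathOfCycles [Finite V] {G : SimpleGraph V} (hG : TwoConnected G)
    (h : IsPathOfCycles (cellCompletion G)) : pw G = 2 := by
  obtain ⟨e₁, e₂, hB, -⟩ := h.hasTails
  have : Nonempty V := (Nat.card_pos_iff.1 (lt_of_lt_of_le three_pos hG.1)).1
  refine (pw_eq_two_iff hG).2 (hB.exists_pathDecomp fun a b hab => ?_)
  exact (fromRel_adj _ _ _).2 ⟨hab.ne, Or.inl (Or.inl hab)⟩

end chordless

section arcs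

variable {V : Type} {H : SimpleGraph V}

theorem connOn_chain {W : ℕ → Set V} {i j : ℕ} (hij : i ≤ j)
    (hW : ∀ l, i ≤ l → l ≤ j → ConnOn H (W l))
    (hadj : ∀ l, i ≤ l → l < j → ∃ x ∈ W l, ∃ y ∈ W (l + 1), H.Adj x y) :
    ConnOn H {y | ∃ l, i ≤ l ∧ l ≤ j ∧ y ∈ W l} := by
  induction j, hij using Nat.le_induction with
  | base =>
    convert hW i le_rfl le_rfl using 1
    ext y
    exact ⟨fun ⟨l, h1, h2, h⟩ => le_antisymm h2 h1 ▸ h, fun h => ⟨i, le_rfl, le_rfl, h⟩⟩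
  | succ j hij ih =>
    have h1 := ih (fun l h1 h2 => hW l h1 (by omega)) fun l h1 h2 => hadj l h1 (by omega)
    obtain ⟨x, hx, y, hy, hxy⟩ := hadj j hij (by omega)
    convert h1.union (hW (j + 1) (by omega) le_rfl) ⟨x, ⟨j, hij, le_rfl, hx⟩, y, hy, Or.inr hxy⟩
      using 1
    ext z
    constructor
    · rintro ⟨l, h1, h2, h⟩
      rcases Nat.le_succ_iff.1 h2 with h3 | rfl
      exacts [Or.inl ⟨l, h1, h3, h⟩, Or.inr h]
    · rintro (⟨l, h1, h2, h⟩ | h)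
      exacts [⟨l, h1, by omega, h⟩, ⟨j + 1, by omega, le_rfl, h⟩]

theorem connOn_arc {s : ℕ → V} {i j : ℕ} (hij : i ≤ j)
    (hadj : ∀ l, i ≤ l → l < j → H.Adj (s l) (s (l + 1))) :
    ConnOn H {y | ∃ l, i ≤ l ∧ l ≤ j ∧ y = s l} :=
  connOn_chain (W := fun l => {s l}) hij (fun _ _ _ => ConnOn.singleton _)
    fun l h1 h2 => ⟨_, rfl, _, rfl, hadj l h1 h2⟩

theorem CycSeq.connOn {X : Set V} {n : ℕ} {s : ℕ → V} (h : CycSeq H X n s) : ConnOn H X := by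
  have h3 := h.three_le
  convert connOn_arc (H := H) (s := s) (Nat.zero_le (n - 1))
    fun l _ h2 => h.adj_succ (by omega) using 1
  ext x
  rw [h.mem_iff]
  exact ⟨fun ⟨i, h1, h2⟩ => ⟨i, by omega, by omega, h2⟩, fun ⟨i, _, h1, h2⟩ => ⟨i, by omega, h2⟩⟩

/-- Every vertex of an induced cycle has exactly two neighbours on it. -/
theorem IsChordlessCycle.exists_nbrs {S : Set V} (hS : IsChordlessCycle H S) {x : V} (hx : x ∈ S) :
    ∃ y ∈ S, ∃ z ∈ S, y ≠ z ∧ H.Adj x y ∧ H.Adj x z ∧ ∀ w ∈ S, H.Adj x w → w = y ∨ w = z := by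
  obtain ⟨n, s, h, rfl⟩ := hS.exists_cycSeq hx
  have h3 := h.three_le
  refine ⟨s 1, h.mem (by omega), s (n - 1), h.mem (by omega), fun h' => ?_, h.adj_succ (by omega),
    h.adj_zero_last, fun w hw hadj => ?_⟩
  · have := h.inj _ _ (by omega) (by omega) h'; omega
  · obtain ⟨i, hi, rfl⟩ := (h.mem_iff w).1 hw
    rcases (h.adj_iff' (by omega) hi).1 hadj with rfl | h' | ⟨-, h'⟩ | h'
    · exact Or.inl rfl
    · omega
    · exact Or.inr (by congr 1; omega)
    · omega

theorem IsChordlessCycle.eq_of_subset {S T : Set V} (hS : IsChordlessCycle H S)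
    (hT : IsChordlessCycle H T) (hST : S ⊆ T) : S = T := by
  obtain ⟨n, s, h⟩ := isChordlessCycle_iff.1 hT
  obtain ⟨m, t, ht⟩ := isChordlessCycle_iff.1 hS
  have h3 := ht.three_le
  refine hST.antisymm (h.connOn.2 S ⟨t 0, hST (ht.mem (by omega)), ht.mem (by omega)⟩
    fun x hxT hx y hy hxy => ?_)
  obtain ⟨a, ha, b, hb, hab, hxa, hxb, -⟩ := hS.exists_nbrs hx
  obtain ⟨c, -, d, -, -, -, -, hcd⟩ := hT.exists_nbrs hxT
  have h1 := hcd a (hST ha) hxa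
  have h2 := hcd b (hST hb) hxb
  have h3 := hcd y hy hxy
  grind

/-- Removing two adjacent vertices from an induced cycle leaves a path. -/
theorem IsChordlessCycle.connOn_diff {S : Set V} (hS : IsChordlessCycle H S) {a b : V}
    (ha : a ∈ S) (hb : b ∈ S) (hab : H.Adj a b) : ConnOn H {x | x ∈ S ∧ x ≠ a ∧ x ≠ b} := by
  obtain ⟨n, s, h, he⟩ := hS.exists_cycSeq_of_adj ha hb hab
  have h3 := h.three_le
  convert connOn_arc (H := H) (s := s) (i := 1) (j := n - 2) (by omega)
    (fun l _ h2 => h.adj_succ (by omega)) using 1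
  have hab' : ∀ x, (x ≠ a ∧ x ≠ b) ↔ (x ≠ s 0 ∧ x ≠ s (n - 1)) := by
    intro x
    rcases Sym2.eq_iff.1 he with ⟨h1, h2⟩ | ⟨h1, h2⟩
    · rw [h1, h2]
    · rw [h1, h2, and_comm]
  ext x
  rw [Set.mem_ofPred_eq, hab', h.mem_iff]
  constructor
  · rintro ⟨⟨i, hi, rfl⟩, h0, h1⟩
    have : i ≠ 0 := fun h => h0 (by rw [h])
    have : i ≠ n - 1 := fun h => h1 (by rw [h])
    exact ⟨i, by omega, by omega, rfl⟩
  · rintro ⟨i, h1, h2, rfl⟩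
    refine ⟨⟨i, by omega, rfl⟩, fun h' => ?_, fun h' => ?_⟩
    · have := h.inj _ _ (by omega) (by omega) h'; omega
    · have := h.inj _ _ (by omega) (by omega) h'; omega

variable {X Y : Set V} {m : ℕ} {s : ℕ → V}

/-- The only new induced cycle created by an ear is the one closed by its edge. -/
theorem IsEar.eq_cycle (hear : IsEar H X Y m s) {S : Set V} (hS : IsChordlessCycle H S)
    (hSY : S ⊆ Y) (hSX : ¬ S ⊆ X) : S = {y | ∃ i < m + 2, y = s i} := by
  have hm := hear.one_le
  obtain ⟨x, hx, hxX⟩ := Set.not_subset.1 hSX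
  obtain ⟨i, h1, h2, rfl⟩ := ((hear.mem_iff x).1 (hSY hx)).resolve_left hxX
  have hnext : ∀ l, 1 ≤ l → l ≤ m → s l ∈ S → s (l - 1) ∈ S ∧ s (l + 1) ∈ S := by
    intro l hl hl' h
    obtain ⟨y, hy, z, hz, hyz, hxy, hxz, -⟩ := hS.exists_nbrs h
    have h3 := (hear.nbr l hl hl' y (hSY hy)).1 hxy
    have h4 := (hear.nbr l hl hl' z (hSY hz)).1 hxz
    grind
  have harc := (connOn_arc (H := H) (s := s) hm
    fun l h1 h2 => hear.cycSeq.adj_succ (by omega)).2 S ⟨_, ⟨i, h1, h2, rfl⟩, hx⟩ (by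
      rintro _ ⟨l, hl, hl', rfl⟩ hlS _ ⟨k, hk, hk', rfl⟩ hadj
      have := hnext l hl hl' hlS
      rcases (hear.nbr l hl hl' _ (hear.mem (by omega))).1 hadj with h | h
      exacts [h ▸ this.1, h ▸ this.2])
  refine (hear.isChordlessCycle.eq_of_subset hS ?_).symm
  rintro _ ⟨l, hl, rfl⟩
  rcases Nat.eq_zero_or_pos l with rfl | h0
  · exact (hnext 1 le_rfl hm (harc ⟨1, le_rfl, hm, rfl⟩)).1
  rcases (show l ≤ m + 1 by omega).lt_or_eq with h3 | rfl
  · exact harc ⟨l, h0, by omega, rfl⟩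
  · exact (hnext m hm le_rfl (harc ⟨m, hm, le_rfl, rfl⟩)).2

/-- Two induced cycles sharing an edge of a tree of cycles are separated by the ends of that
edge. -/
theorem TCSet.exists_separation (hX : TCSet H X) : ∀ a b S T, H.Adj a b → IsChordlessCycle H S →
    IsChordlessCycle H T → S ≠ T → a ∈ S → b ∈ S → a ∈ T → b ∈ T → S ⊆ X → T ⊆ X →
    ∃ U : Set V, (∀ x ∈ S, x ≠ a → x ≠ b → x ∈ U) ∧ (∀ x ∈ T, x ∉ U) ∧
      ∀ x ∈ U, ∀ y ∈ X, y ≠ a → y ≠ b → H.Adj x y → y ∈ U := by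
  induction hX using TCSet.induction_ear with
  | cycle X n s h =>
    intro a b S T _ hS hT hST _ _ _ _ hSX hTX
    exact absurd ((hS.eq_of_subset h.isChordlessCycle hSX).trans
      (hT.eq_of_subset h.isChordlessCycle hTX).symm) hST
  | ear X Y m s hX hear ih =>
    intro a b S T hab hS hT hST haS hbS haT hbT hSY hTY
    have hm := hear.one_le
    have hends : ∀ a ∈ X, a ∈ {y | ∃ i < m + 2, y = s i} → a = s 0 ∨ a = s (m + 1) := by
      rintro a ha ⟨i, hi, rfl⟩
      by_contra! hcon
      have : i ≠ 0 := fun h => hcon.1 (by rw [h])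
      have : i ≠ m + 1 := fun h => hcon.2 (by rw [h])
      exact hear.new i (by omega) (by omega) ha
    have hpair : ∀ {T}, a ∈ T → b ∈ T → T ⊆ X → a ∈ {y | ∃ i < m + 2, y = s i} →
        b ∈ {y | ∃ i < m + 2, y = s i} → (∀ x, x = s 0 ∨ x = s (m + 1) → x = a ∨ x = b) := by
      intro T ha hb hT ha' hb' x hx
      have h1 := hends a (hT ha) ha'
      have h2 := hends b (hT hb) hb'
      have := hab.ne
      grind
    have hstep : ∀ i, 1 ≤ i → i ≤ m → ∀ y ∈ Y, H.Adj (s i) y →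
        y = s 0 ∨ y = s (m + 1) ∨ ∃ j, 1 ≤ j ∧ j ≤ m ∧ y = s j := by
      intro i h1 h2 y hy hadj
      rcases (hear.nbr i h1 h2 y hy).1 hadj with rfl | rfl
      · by_cases h : i = 1
        · exact Or.inl (by rw [h])
        · exact Or.inr (Or.inr ⟨i - 1, by omega, by omega, rfl⟩)
      · by_cases h : i = m
        · exact Or.inr (Or.inl (by rw [h]))
        · exact Or.inr (Or.inr ⟨i + 1, by omega, by omega, rfl⟩)
    by_cases hSX : S ⊆ X
    · by_cases hTX : T ⊆ X
      · obtain ⟨U, hSU, hTU, hU⟩ := ih a b S T hab hS hT hST haS hbS haT hbT hSX hTX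
        refine ⟨{x | (x ∈ U ∧ x ∈ X) ∨ ((s 0 ∈ U ∨ s (m + 1) ∈ U) ∧ ∃ j, 1 ≤ j ∧ j ≤ m ∧ x = s j)},
          fun x hx h1 h2 => Or.inl ⟨hSU x hx h1 h2, hSX hx⟩, ?_, ?_⟩
        · rintro x hx (⟨h, -⟩ | ⟨-, j, h1, h2, rfl⟩)
          exacts [hTU x hx h, hear.new j h1 h2 (hTX hx)]
        · rintro x (⟨hx, hxX⟩ | ⟨h0, j, h1, h2, rfl⟩) y hy hya hyb hxy
          · rcases (hear.mem_iff y).1 hy with hyX | ⟨j, h1, h2, rfl⟩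
            · exact Or.inl ⟨hU x hx y hyX hya hyb hxy, hyX⟩
            · refine Or.inr ⟨?_, j, h1, h2, rfl⟩
              rcases hstep j h1 h2 x (hear.subset hxX) hxy.symm with rfl | rfl | ⟨k, h3, h4, rfl⟩
              exacts [Or.inl hx, Or.inr hx, absurd hxX (hear.new k h3 h4)]
          · rcases hstep j h1 h2 y hy hxy with rfl | rfl | ⟨k, h3, h4, rfl⟩
            · refine Or.inl ⟨h0.elim id fun h => ?_, hear.left_mem⟩
              exact hU _ h _ hear.left_mem hya hyb hear.adj.symm
            · refine Or.inl ⟨h0.elim (fun h => ?_) id, hear.right_mem⟩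
              exact hU _ h _ hear.right_mem hya hyb hear.adj
            · exact Or.inr ⟨h0, k, h3, h4, rfl⟩
      · obtain rfl := hear.eq_cycle hT hTY hTX
        have hp := hpair haS hbS hSX haT hbT
        refine ⟨{x | x ∈ X ∧ x ≠ a ∧ x ≠ b}, fun x hx h1 h2 => ⟨hSX hx, h1, h2⟩, ?_, ?_⟩
        · rintro x hx ⟨hxX, h1, h2⟩
          rcases hp x (hends x hxX hx) with h | h
          exacts [h1 h, h2 h]
        · rintro x ⟨hxX, h1, h2⟩ y hy hya hyb hxy
          refine ⟨((hear.mem_iff y).1 hy).resolve_right ?_, hya, hyb⟩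
          rintro ⟨j, h3, h4, rfl⟩
          rcases hstep j h3 h4 x (hear.subset hxX) hxy.symm with h | h | ⟨k, h5, h6, rfl⟩
          · exact (hp x (Or.inl h)).elim h1 h2
          · exact (hp x (Or.inr h)).elim h1 h2
          · exact hear.new k h5 h6 hxX
    · obtain rfl := hear.eq_cycle hS hSY hSX
      have hTX : T ⊆ X := by
        by_contra hTX
        exact hST (hear.eq_cycle hT hTY hTX).symm
      have hp := hpair haT hbT hTX haS hbS
      refine ⟨{x | ∃ j, 1 ≤ j ∧ j ≤ m ∧ x = s j}, ?_, ?_, ?_⟩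
      · rintro _ ⟨i, hi, rfl⟩ h1 h2
        have : i ≠ 0 := by
          rintro rfl
          exact (hp _ (Or.inl rfl)).elim h1 h2
        have : i ≠ m + 1 := by
          rintro rfl
          exact (hp _ (Or.inr rfl)).elim h1 h2
        exact ⟨i, by omega, by omega, rfl⟩
      · rintro x hx ⟨j, h1, h2, rfl⟩
        exact hear.new j h1 h2 (hTX hx)
      · rintro _ ⟨j, h1, h2, rfl⟩ y hy hya hyb hxy
        rcases hstep j h1 h2 y hy hxy with h | h | h
        exacts [((hp y (Or.inl h)).elim hya hyb).elim, ((hp y (Or.inr h)).elim hya hyb).elim, h]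

end arcs

theorem ConnOn.of_hub {V : Type} {G : SimpleGraph V} {h s : Set V} (hh : ConnOn G h) (hs : h ⊆ s)
    (H : ∀ U : Set V, h ⊆ U → (∀ x ∈ s, x ∈ U → ∀ y ∈ s, G.Adj x y → y ∈ U) → s ⊆ U) :
    ConnOn G s := by
  obtain ⟨x, hx⟩ := hh.1
  have key : ∀ U : Set V, (∀ x ∈ s, x ∈ U → ∀ y ∈ s, G.Adj x y → y ∈ U) → x ∈ U → s ⊆ U :=
    fun U hU hxU => H U (hh.2 U ⟨x, hx, hxU⟩ fun a ha haU b hb hab =>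
      hU a (hs ha) haU b (hs hb) hab) hU
  refine ⟨⟨x, hs hx⟩, ?_⟩
  rintro U ⟨y, hy, hyU⟩ hU
  by_cases hxU : x ∈ U
  · exact key U hU hxU
  · exact absurd hyU (key Uᶜ (fun a ha haU b hb hab hbU => haU (hU b hb hbU a ha hab.symm)) hxU hy)

theorem isMinorOf_iff {W V : Type} {H : SimpleGraph W} {G : SimpleGraph V} :
    IsMinorOf H G ↔ ∃ f : W → Set V, (∀ w, ConnOn G (f w)) ∧
      (Pairwise fun w w' => Disjoint (f w) (f w')) ∧
      ∀ ⦃w w'⦄, H.Adj w w' → ∃ u ∈ f w, ∃ v ∈ f w', G.Adj u v :=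
  ⟨fun ⟨f, _, h2, h3⟩ => ⟨f, fun w => connOn_iff.2 (h2 w), h3⟩,
    fun ⟨f, h2, h3⟩ => ⟨f, fun w => (h2 w).1, fun w => connOn_iff.1 (h2 w), h3⟩⟩

theorem exists_forall_eq {ι : Type} [Inhabited ι] {p : ι → Prop} (h : ∀ i j, p i → p j → i = j) :
    ∃ a, ∀ i, p i → i = a := by
  by_cases hp : ∃ a, p a
  · obtain ⟨a, ha⟩ := hp
    exact ⟨a, fun i hi => h i a hi ha⟩
  · exact ⟨default, fun i hi => absurd ⟨i, hi⟩ hp⟩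

/-- Deleting `v` and `w` leaves at least three components. -/
def Sep3 {V : Type} (G : SimpleGraph V) (v w : V) : Prop :=
  ∃ z : Fin 3 → V, (∀ i, z i ∉ ({v, w} : Set V)) ∧ ∀ i j, i ≠ j → z j ∉ comp G {v, w} (z i)

section sep3

variable {V : Type} {G : SimpleGraph V}

theorem reachable_induce_iff {v w : V} {a b : {x // x ≠ v ∧ x ≠ w}} :
    (G.induce {x | x ≠ v ∧ x ≠ w}).Reachable a b ↔ (b : V) ∈ comp G {v, w} a := by
  rw [reachable_iff_reflTransGen]
  constructor
  · intro h
    induction h with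
    | refl => exact mem_comp_self
    | @tail b c _ h ih => exact comp_closed ih h (by have := c.2; simp_all)
  · intro h
    have hsub : comp G {v, w} (a : V) ⊆ {y | ∃ hy : y ≠ v ∧ y ≠ w,
        Relation.ReflTransGen (G.induce {x | x ≠ v ∧ x ≠ w}).Adj a ⟨y, hy⟩} := by
      refine comp_subset ⟨a.2, .refl⟩ ?_
      rintro x ⟨hx, hr⟩ y hy hxy
      exact ⟨by simpa using hy, hr.tail hxy⟩
    exact (hsub h).2

theorem three_le_card_iff [Finite V] {v w : V} :
    3 ≤ Nat.card ((G.induce {x | x ≠ v ∧ x ≠ w}).ConnectedComponent) ↔ Sep3 G v w := by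
  have := Fintype.ofFinite ((G.induce {x | x ≠ v ∧ x ≠ w}).ConnectedComponent)
  constructor
  · intro h
    have h1 : Fintype.card (Fin 3) ≤
        Fintype.card ((G.induce {x | x ≠ v ∧ x ≠ w}).ConnectedComponent) := by
      rwa [Fintype.card_fin, ← Nat.card_eq_fintype_card]
    obtain ⟨c⟩ := Function.Embedding.nonempty_of_card_le h1
    choose z hz using fun i => (c i).exists_rep
    refine ⟨fun i => z i, fun i => ?_, fun i j hij h => hij ?_⟩
    · rintro (h | h)
      exacts [(z i).2.1 h, (z i).2.2 h]
    have := reachable_induce_iff.2 h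
    exact c.injective (by rw [← hz i, ← hz j]; exact ConnectedComponent.sound this)
  · rintro ⟨z, hz, h⟩
    have hz' : ∀ i, z i ≠ v ∧ z i ≠ w := fun i => by simpa using hz i
    rw [Nat.card_eq_fintype_card]
    calc 3 = Fintype.card (Fin 3) := rfl
      _ ≤ _ := Fintype.card_le_of_injective
        (fun i => (G.induce {x | x ≠ v ∧ x ≠ w}).connectedComponentMk ⟨z i, hz' i⟩)
        fun i j hij => by
          by_contra hne
          exact h i j hne (reachable_induce_iff.1 (ConnectedComponent.exact hij))

theorem Sep3.symm {v w : V} (h : Sep3 G v w) : Sep3 G w v := by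
  unfold Sep3
  rwa [Set.pair_comm]

theorem cellCompletion_adj [Finite V] {v w : V} :
    (cellCompletion G).Adj v w ↔ G.Adj v w ∨ (v ≠ w ∧ Sep3 G v w) := by
  unfold cellCompletion
  simp only [fromRel_adj, three_le_card_iff]
  constructor
  · rintro ⟨hne, (h | h) | (h | h)⟩
    exacts [Or.inl h, Or.inr ⟨hne, h⟩, Or.inl h.symm, Or.inr ⟨hne, h.symm⟩]
  · rintro (h | ⟨hne, h⟩)
    exacts [⟨h.ne, Or.inl (Or.inl h)⟩, ⟨hne, Or.inl (Or.inr h)⟩]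

theorem le_cellCompletion [Finite V] : G ≤ cellCompletion G :=
  fun _ _ h => cellCompletion_adj.2 (Or.inl h)

theorem comp_inter {P : Set V} {x y u : V} (hy : y ∉ P) (hx : u ∈ comp G P x)
    (hu : u ∈ comp G P y) : y ∈ comp G P x := comp_trans hx (comp_symm hy hu)

theorem TwoConnected.mono {H : SimpleGraph V} (hG : TwoConnected G) (hGH : G ≤ H) :
    TwoConnected H :=
  ⟨hG.1, fun v => connOn_iff.1 ((hG.connOn v).mono fun _ _ _ _ h => hGH h)⟩

/-- One of the three components witnessing `Sep3 G x y` avoids two given vertices, so `x` and `y`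
cannot be separated by those. -/
theorem TwoConnected.mem_comp_of_sep3 (hG : TwoConnected G) {x y : V} (hxy : x ≠ y)
    (h : Sep3 G x y) {v w : V} (hx : x ∉ ({v, w} : Set V)) (hy : y ∉ ({v, w} : Set V)) :
    y ∈ comp G {v, w} x := by
  obtain ⟨z, hz, hsep⟩ := h
  have huniq : ∀ u i j, u ∈ comp G {x, y} (z i) → u ∈ comp G {x, y} (z j) → i = j := by
    intro u i j hi hj
    by_contra hne
    exact hsep i j hne (comp_inter (hz j) hi hj)
  have : ∃ i, v ∉ comp G {x, y} (z i) ∧ w ∉ comp G {x, y} (z i) := by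
    obtain ⟨a, ha⟩ := exists_forall_eq (huniq v)
    obtain ⟨b, hb⟩ := exists_forall_eq (huniq w)
    obtain ⟨i, hia, hib⟩ := (by decide : ∀ a b : Fin 3, ∃ i, i ≠ a ∧ i ≠ b) a b
    exact ⟨i, fun h => hia (ha i h), fun h => hib (hb i h)⟩
  obtain ⟨i, hv, hw⟩ := this
  have hzi := hz i
  have hzx : z i ≠ x := fun h => hzi (by simp [h])
  have hzy : z i ≠ y := fun h => hzi (by simp [h])
  obtain ⟨p, hp, hpx⟩ := hG.exists_adj_comp hxy subset_rfl (by simp) hzi hzy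
  obtain ⟨q, hq, hqy⟩ := hG.exists_adj_comp (P := {x, y}) hxy.symm (by simp [Set.pair_comm])
    (by simp) hzi hzx
  have hc := ((comp_connOn (G := G) (P := {x, y}) (u := z i)).union (ConnOn.singleton x)
    ⟨p, hp, x, rfl, Or.inr hpx⟩).union (ConnOn.singleton y) ⟨q, Or.inl hq, y, rfl, Or.inr hqy⟩
  refine subset_comp hc (Or.inl (Or.inr rfl)) ?_ (Or.inr rfl)
  rintro u ((hu | rfl) | rfl)
  · rintro (rfl | rfl)
    exacts [hv hu, hw hu]
  · exact hx
  · exact hy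

theorem TwoConnected.comp_eq [Finite V] (hG : TwoConnected G) {H : SimpleGraph V} (h1 : G ≤ H)
    (h2 : H ≤ cellCompletion G) {v w u : V} (hu : u ∉ ({v, w} : Set V)) :
    comp H {v, w} u = comp G {v, w} u := by
  refine (comp_subset mem_comp_self fun x hx y hy hxy => ?_).antisymm
    (comp_subset mem_comp_self fun x hx y hy hxy => comp_closed hx (h1 hxy) hy)
  rcases cellCompletion_adj.1 (h2 hxy) with h | ⟨hne, h⟩
  · exact comp_closed hx h hy
  · exact comp_trans hx (hG.mem_comp_of_sep3 hne h (comp_disjoint hu hx) hy)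

theorem TwoConnected.sep3_iff [Finite V] (hG : TwoConnected G) {H : SimpleGraph V} (h1 : G ≤ H)
    (h2 : H ≤ cellCompletion G) {v w : V} : Sep3 H v w ↔ Sep3 G v w := by
  constructor <;> rintro ⟨z, hz, h⟩
  · exact ⟨z, hz, fun i j hij => by rw [← hG.comp_eq h1 h2 (hz i)]; exact h i j hij⟩
  · exact ⟨z, hz, fun i j hij => by rw [hG.comp_eq h1 h2 (hz i)]; exact h i j hij⟩

/-- Adding an edge between the two vertices of a separation into three parts creates no new
`K₄` minor. -/
theorem TwoConnected.isMinorOf_K4_of_edge (hG : TwoConnected G) {v w : V} (hvw : v ≠ w)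
    (hsep : Sep3 G v w) (h : IsMinorOf K4 (G ⊔ edge v w)) : IsMinorOf K4 G := by
  obtain ⟨z, hz, hsep⟩ := hsep
  obtain ⟨f, hf, hdis, hadj⟩ := isMinorOf_iff.1 h
  have hfu : ∀ u i j, u ∈ f i → u ∈ f j → i = j := fun u i j hi hj => by
    by_contra hne
    exact Set.disjoint_left.1 (hdis hne) hi hj
  have hadj : ∀ i j, i ≠ j → ∃ u ∈ f i, ∃ u' ∈ f j, (G ⊔ edge v w).Adj u u' := fun i j hij =>
    hadj (by simpa [K4] using hij)
  have hedge : ∀ x y, (G ⊔ edge v w).Adj x y → G.Adj x y ∨ (x = v ∧ y = w) ∨ (x = w ∧ y = v) := by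
    intro x y hxy
    rcases hxy with h | h
    · exact Or.inl h
    · rw [edge_adj] at h
      grind
  have : ∃ i j, i ≠ j ∧ v ∉ f i ∧ w ∉ f i ∧ v ∉ f j ∧ w ∉ f j := by
    obtain ⟨a, ha⟩ := exists_forall_eq (hfu v)
    obtain ⟨b, hb⟩ := exists_forall_eq (hfu w)
    obtain ⟨i, j, hij, hia, hib, hja, hjb⟩ :=
      (by decide : ∀ a b : Fin 4, ∃ i j, i ≠ j ∧ i ≠ a ∧ i ≠ b ∧ j ≠ a ∧ j ≠ b) a b
    exact ⟨i, j, hij, fun h => hia (ha i h), fun h => hib (hb i h), fun h => hja (ha j h),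
      fun h => hjb (hb j h)⟩
  obtain ⟨i, j, hij, hvi, hwi, hvj, hwj⟩ := this
  have hfG : ∀ k, v ∉ f k → ConnOn G (f k) := fun k hk => (hf k).mono fun x hx y hy hxy => by
    rcases hedge x y hxy with h | ⟨rfl, -⟩ | ⟨-, rfl⟩
    exacts [h, absurd hx hk, absurd hy hk]
  obtain ⟨p, hp⟩ := (hf i).1
  set P : Set V := {v, w} with hP
  have hnP : ∀ k, v ∉ f k → w ∉ f k → ∀ x ∈ f k, x ∉ P := by
    rintro k hv hw x hx (rfl | rfl)
    exacts [hv hx, hw hx]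
  set K := comp G P p with hK
  have hfi : f i ⊆ K := subset_comp (hfG i hvi) hp (hnP i hvi hwi)
  have hfk : ∀ k, v ∉ f k → w ∉ f k → f k ⊆ K := by
    intro k hv hw
    by_cases hki : k = i
    · exact hki ▸ hfi
    obtain ⟨x, hx, y, hy, hxy⟩ := hadj i k (Ne.symm hki)
    have : G.Adj x y := by
      rcases hedge x y hxy with h | ⟨rfl, -⟩ | ⟨-, rfl⟩
      exacts [h, absurd hx hvi, absurd hy hv]
    have hyK : y ∈ K := comp_closed (hfi hx) this (hnP k hv hw y hy)
    exact fun u hu => comp_trans hyK (subset_comp (hfG k hv) hy (hnP k hv hw) hu)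
  have hpP := hnP i hvi hwi p hp
  obtain ⟨m, hm⟩ : ∃ m, z m ∉ K := by
    by_contra! hcon
    exact hsep 0 1 (by decide) (comp_trans (comp_symm hpP (hcon 0)) (hcon 1))
  set L := comp G P (z m) with hL
  have hLc : ConnOn G L := comp_connOn
  have hLP : ∀ x ∈ L, x ∉ P := fun x hx => comp_disjoint (hz m) hx
  have hLK : ∀ x ∈ L, x ∉ K := fun x hx hxK => hm (comp_inter (hz m) hxK hx)
  have hzv : z m ≠ v := fun h => hz m (by simp [h, hP])
  have hzw : z m ≠ w := fun h => hz m (by simp [h, hP])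
  obtain ⟨a, haL, hav⟩ := hG.exists_adj_comp hvw subset_rfl (by simp) (hz m) hzw
  obtain ⟨b, hbL, hbw⟩ := hG.exists_adj_comp (P := P) hvw.symm (by simp [hP, Set.pair_comm])
    (by simp [hP]) (hz m) hzv
  let g : Fin 4 → Set V := fun k => {x | (x ∈ f k ∧ (x ∈ K ∨ x ∈ P)) ∨ (x ∈ L ∧ v ∈ f k)}
  have hconn : ∀ k h, ConnOn G h → h ⊆ g k → (∀ x ∈ f k, x ∈ P → x ∈ h) →
      (v ∈ f k → L ⊆ h) → (∃ x ∈ h, x ∈ f k) → ConnOn G (g k) := by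
    rintro k h hh hhg hP' hL' ⟨x, hxh, hxf⟩
    refine ConnOn.of_hub hh hhg fun U hhU hU => ?_
    have := (hf k).2 {x | (x ∈ K ∨ x ∈ P) → x ∈ U} ⟨x, hxf, fun _ => hhU hxh⟩ (by
      intro x hx hxU y hy hxy hyKP
      by_cases hyP : y ∈ P
      · exact hhU (hP' y hy hyP)
      have hadj : G.Adj x y := by
        rcases hedge x y hxy with h | ⟨-, rfl⟩ | ⟨-, rfl⟩
        exacts [h, absurd (by simp [hP]) hyP, absurd (by simp [hP]) hyP]
      have hyK := hyKP.resolve_right hyP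
      have hxKP : x ∈ K ∨ x ∈ P := by
        by_cases hxP : x ∈ P
        · exact Or.inr hxP
        · exact Or.inl (comp_closed hyK hadj.symm hxP)
      exact hU x (Or.inl ⟨hx, hxKP⟩) (hxU hxKP) y (Or.inl ⟨hy, hyKP⟩) hadj)
    rintro y (⟨hy, hyKP⟩ | ⟨hy, hv⟩)
    exacts [this hy hyKP, hhU (hL' hv hy)]
  have hvw_adj : ∀ k l, v ∈ f k → w ∈ f l → ∃ x ∈ g k, ∃ y ∈ g l, G.Adj x y :=
    fun k l hv hw => ⟨b, Or.inr ⟨hbL, hv⟩, w, Or.inl ⟨hw, Or.inr (by simp [hP])⟩, hbw⟩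
  refine isMinorOf_iff.2 ⟨g, fun k => ?_, fun k l hkl => ?_, fun k l hkl => ?_⟩
  · by_cases hv : v ∈ f k
    · have h1 := hLc.union (ConnOn.singleton v) ⟨a, haL, v, rfl, Or.inr hav⟩
      have hvg : v ∈ g k := Or.inl ⟨hv, Or.inr (by simp [hP])⟩
      by_cases hw : w ∈ f k
      · have h2 := h1.union (ConnOn.singleton w) ⟨b, Or.inl hbL, w, rfl, Or.inr hbw⟩
        refine hconn k _ h2 ?_ ?_ (fun _ x hx => Or.inl (Or.inl hx)) ⟨v, Or.inl (Or.inr rfl), hv⟩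
        · rintro x ((hx | rfl) | rfl)
          exacts [Or.inr ⟨hx, hv⟩, hvg, Or.inl ⟨hw, Or.inr (by simp [hP])⟩]
        · rintro x - (rfl | rfl)
          exacts [Or.inl (Or.inr rfl), Or.inr rfl]
      · refine hconn k _ h1 ?_ ?_ (fun _ x hx => Or.inl hx) ⟨v, Or.inr rfl, hv⟩
        · rintro x (hx | rfl)
          exacts [Or.inr ⟨hx, hv⟩, hvg]
        · rintro x hx (rfl | rfl)
          exacts [Or.inr rfl, absurd hx hw]
    · by_cases hw : w ∈ f k
      · refine hconn k {w} (ConnOn.singleton w) ?_ ?_ (fun h => absurd h hv) ⟨w, rfl, hw⟩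
        · rintro x rfl
          exact Or.inl ⟨hw, Or.inr (by simp [hP])⟩
        · rintro x hx (rfl | rfl)
          exacts [absurd hx hv, rfl]
      · obtain ⟨x, hx⟩ := (hf k).1
        refine hconn k {x} (ConnOn.singleton x) ?_ ?_ (fun h => absurd h hv) ⟨x, rfl, hx⟩
        · rintro y rfl
          exact Or.inl ⟨hx, Or.inl (hfk k hv hw hx)⟩
        · exact fun y hy hyP => absurd hyP (hnP k hv hw y hy)
  · refine Set.disjoint_left.2 ?_
    rintro x (⟨hx, hx'⟩ | ⟨hx, hv⟩) (⟨hy, hy'⟩ | ⟨hy, hv'⟩)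
    · exact hkl (hfu x k l hx hy)
    · exact hx'.elim (hLK x hy) (hLP x hy)
    · exact hy'.elim (hLK x hx) (hLP x hx)
    · exact hkl (hfu v k l hv hv')
  · have hne : k ≠ l := by simpa [K4] using hkl
    obtain ⟨x, hx, y, hy, hxy⟩ := hadj k l hne
    have hsymm : v ∈ f l → w ∈ f k → ∃ x ∈ g k, ∃ y ∈ g l, G.Adj x y := by
      intro h1 h2
      obtain ⟨x, hx, y, hy, hxy⟩ := hvw_adj l k h1 h2
      exact ⟨y, hy, x, hx, hxy.symm⟩
    rcases hedge x y hxy with h | ⟨rfl, rfl⟩ | ⟨rfl, rfl⟩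
    · by_cases hxg : x ∈ K ∨ x ∈ P
      · by_cases hyg : y ∈ K ∨ y ∈ P
        · exact ⟨x, Or.inl ⟨hx, hxg⟩, y, Or.inl ⟨hy, hyg⟩, h⟩
        · have hxP : x ∈ P := hxg.resolve_left fun hxK =>
            hyg (Or.inl (comp_closed hxK h fun hyP => hyg (Or.inr hyP)))
          have hfl : v ∈ f l ∨ w ∈ f l := by
            by_contra! hcon
            exact hyg (Or.inl (hfk l hcon.1 hcon.2 hy))
          have h1 := hfu v k l
          have h2 := hfu w k l
          rcases hxP with rfl | rfl
          · exact hvw_adj k l hx (hfl.resolve_left fun h => hne (h1 hx h))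
          · exact hsymm (hfl.resolve_right fun h => hne (h2 hx h)) hx
      · have hfk' : v ∈ f k ∨ w ∈ f k := by
          by_contra! hcon
          exact hxg (Or.inl (hfk k hcon.1 hcon.2 hx))
        have hfl : v ∈ f l ∨ w ∈ f l := by
          by_contra! hcon
          exact hxg (Or.inl (comp_closed (hfk l hcon.1 hcon.2 hy) h.symm fun hxP =>
            hxg (Or.inr hxP)))
        have h1 := hfu v k l
        have h2 := hfu w k l
        grind
    · exact hvw_adj k l hx hy
    · exact hsymm hy hx

/-- The cell completion of a 2-connected graph without `K₄` minor has no `K₄` minor. -/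
theorem TwoConnected.not_isMinorOf_K4_cellCompletion [Finite V] (hG : TwoConnected G)
    (h : ¬ IsMinorOf K4 G) : ¬ IsMinorOf K4 (cellCompletion G) := by
  obtain ⟨H, hGH, ⟨⟨-, hH, hK⟩, hmax⟩⟩ := (Set.toFinite
    {H : SimpleGraph V | G ≤ H ∧ H ≤ cellCompletion G ∧ ¬ IsMinorOf K4 H}).exists_le_maximal
      (a := G) ⟨le_rfl, le_cellCompletion, h⟩
  suffices H = cellCompletion G by rwa [← this]
  refine hH.antisymm fun v w hvw => ?_
  rcases cellCompletion_adj.1 hvw with h | ⟨hne, h⟩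
  · exact hGH h
  refine hmax (y := H ⊔ edge v w) ⟨hGH.trans le_sup_left,
      sup_le hH ((edge_le_iff _).2 (Or.inr hvw)),
    fun h' => hK ((hG.mono hGH).isMinorOf_K4_of_edge hne ((hG.sep3_iff hGH hH).2 h) h')⟩
    le_sup_left (Or.inr ?_)
  simp [edge_adj, hne]

end sep3

/-- Some edge joins `A` to `B`. -/
def Touch {V : Type} (G : SimpleGraph V) (A B : Set V) : Prop := ∃ u ∈ A, ∃ v ∈ B, G.Adj u v

section touch

variable {V : Type} {G : SimpleGraph V} {A B C D : Set V}

theorem Touch.symm (h : Touch G A B) : Touch G B A := by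
  obtain ⟨u, hu, v, hv, h⟩ := h
  exact ⟨v, hv, u, hu, h.symm⟩

theorem Touch.mono (h : Touch G A B) (hC : A ⊆ C) (hD : B ⊆ D) : Touch G C D := by
  obtain ⟨u, hu, v, hv, h⟩ := h
  exact ⟨u, hC hu, v, hD hv, h⟩

theorem ConnOn.union_of_touch (hA : ConnOn G A) (hB : ConnOn G B) (h : Touch G A B) :
    ConnOn G (A ∪ B) := by
  obtain ⟨u, hu, v, hv, h⟩ := h
  exact hA.union hB ⟨u, hu, v, hv, Or.inr h⟩

theorem isMinorOf_K4 (hA : ConnOn G A) (hB : ConnOn G B) (hC : ConnOn G C) (hD : ConnOn G D)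
    (dAB : Disjoint A B) (dAC : Disjoint A C) (dAD : Disjoint A D) (dBC : Disjoint B C)
    (dBD : Disjoint B D) (dCD : Disjoint C D) (tAB : Touch G A B) (tAC : Touch G A C)
    (tAD : Touch G A D) (tBC : Touch G B C) (tBD : Touch G B D) (tCD : Touch G C D) :
    IsMinorOf K4 G := by
  refine isMinorOf_iff.2 ⟨![A, B, C, D], fun i => ?_, fun i j hij => ?_, fun i j hij => ?_⟩
  · fin_cases i
    exacts [hA, hB, hC, hD]
  · fin_cases i <;> fin_cases j <;> first
      | exact absurd rfl hij
      | exact dAB | exact dAC | exact dAD | exact dBC | exact dBD | exact dCD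
      | exact dAB.symm | exact dAC.symm | exact dAD.symm | exact dBC.symm | exact dBD.symm
      | exact dCD.symm
  · fin_cases i <;> fin_cases j <;> first
      | exact absurd rfl hij.ne
      | exact tAB | exact tAC | exact tAD | exact tBC | exact tBD | exact tCD
      | exact tAB.symm | exact tAC.symm | exact tAD.symm | exact tBC.symm | exact tBD.symm
      | exact tCD.symm

/-- Three disjoint connections between `c` and `d` of which two are not separated by `c` and `d`
yield a `K₄` minor. -/
theorem isMinorOf_K4_of_mem_comp {c d p q : V} {P Q R : Set V} (hcd : c ≠ d) (hP : ConnOn G P)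
    (hQ : ConnOn G Q) (hR : ConnOn G R) (dPQ : Disjoint P Q) (dPR : Disjoint P R)
    (dQR : Disjoint Q R) (hcP : c ∉ P) (hdP : d ∉ P) (hcQ : c ∉ Q) (hdQ : d ∉ Q) (hcR : c ∉ R)
    (hdR : d ∉ R) (tcP : Touch G {c} P) (tdP : Touch G {d} P) (tcQ : Touch G {c} Q)
    (tdQ : Touch G {d} Q) (tcR : Touch G {c} R) (tdR : Touch G {d} R) (hp : p ∈ P) (hq : q ∈ Q)
    (hpq : q ∈ comp G {c, d} p) : IsMinorOf K4 G := by
  have hW : ∀ x ∈ P, x ∉ {c, d} ∪ (Q ∪ R) := by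
    rintro x hx ((rfl | rfl) | h | h)
    exacts [hcP hx, hdP hx, Set.disjoint_left.1 dPQ hx h, Set.disjoint_left.1 dPR hx h]
  set S := comp G ({c, d} ∪ (Q ∪ R)) p with hS
  have hSW : ∀ x ∈ S, x ∉ {c, d} ∪ (Q ∪ R) := fun x hx => comp_disjoint (hW p hp) hx
  have hPS : P ⊆ S := subset_comp hP hp hW
  obtain ⟨x, -, hx, y, hy, hyS, hxy⟩ := (comp_connOn (G := G) (P := {c, d}) (u := p)).exists_cross
    (U := S) ⟨p, mem_comp_self, mem_comp_self⟩ ⟨q, hpq, fun h => hSW q h (Or.inr (Or.inl hq))⟩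
  have hycd : y ∉ ({c, d} : Set V) :=
    comp_disjoint (fun h => hW p hp (Or.inl h)) hy
  have hyQR : y ∈ Q ∪ R := by
    by_contra h
    exact hyS (comp_closed hx hxy fun h' => h'.elim hycd h)
  have key : ∀ {A B : Set V}, ConnOn G A → ConnOn G B → Disjoint A B → c ∉ A → d ∉ A → c ∉ B →
      d ∉ B → Touch G {c} A → Touch G {d} A → Touch G {c} B → Touch G {d} B → Disjoint S A →
      Disjoint S B → Touch G S A → IsMinorOf K4 G := by
    intro A B hA hB dAB hcA hdA hcB hdB tcA tdA tcB tdB dSA dSB tSA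
    refine isMinorOf_K4 (ConnOn.singleton c) ((ConnOn.singleton d).union_of_touch hB tdB)
      comp_connOn hA ?_ ?_ ?_ ?_ ?_ dSA (tcB.mono subset_rfl Set.subset_union_right)
      (tcP.mono subset_rfl hPS) tcA (tdP.mono Set.subset_union_left hPS)
      (tdA.mono Set.subset_union_left subset_rfl) tSA
    · rw [Set.disjoint_singleton_left]
      rintro (h | h)
      exacts [hcd h, hcB h]
    · exact Set.disjoint_singleton_left.2 fun h => hSW c h (Or.inl (Or.inl rfl))
    · exact Set.disjoint_singleton_left.2 hcA
    · exact Set.disjoint_union_left.2 ⟨Set.disjoint_singleton_left.2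
        fun h => hSW d h (Or.inl (Or.inr rfl)), dSB.symm⟩
    · exact Set.disjoint_union_left.2 ⟨Set.disjoint_singleton_left.2 hdA, dAB.symm⟩
  have dSQ : Disjoint S Q := Set.disjoint_left.2 fun x h h' => hSW x h (Or.inr (Or.inl h'))
  have dSR : Disjoint S R := Set.disjoint_left.2 fun x h h' => hSW x h (Or.inr (Or.inr h'))
  rcases hyQR with hyQ | hyR
  · exact key hQ hR dQR hcQ hdQ hcR hdR tcQ tdQ tcR tdR dSQ dSR ⟨x, hx, y, hyQ, hxy⟩
  · exact key hR hQ dQR.symm hcR hdR hcQ hdQ tcR tdR tcQ tdQ dSR dSQ ⟨x, hx, y, hyR, hxy⟩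

theorem sep3_of_disjoint_links {c d : V} {P Q R : Set V} (hG : ¬ IsMinorOf K4 G) (hcd : c ≠ d)
    (hP : ConnOn G P) (hQ : ConnOn G Q) (hR : ConnOn G R) (dPQ : Disjoint P Q)
    (dPR : Disjoint P R) (dQR : Disjoint Q R) (hcP : c ∉ P) (hdP : d ∉ P) (hcQ : c ∉ Q)
    (hdQ : d ∉ Q) (hcR : c ∉ R) (hdR : d ∉ R) (tcP : Touch G {c} P) (tdP : Touch G {d} P)
    (tcQ : Touch G {c} Q) (tdQ : Touch G {d} Q) (tcR : Touch G {c} R) (tdR : Touch G {d} R) :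
    Sep3 G c d := by
  obtain ⟨p, hp⟩ := hP.1
  obtain ⟨q, hq⟩ := hQ.1
  obtain ⟨r, hr⟩ := hR.1
  have hp' : p ∉ ({c, d} : Set V) := by rintro (rfl | rfl) <;> contradiction
  have hq' : q ∉ ({c, d} : Set V) := by rintro (rfl | rfl) <;> contradiction
  have hr' : r ∉ ({c, d} : Set V) := by rintro (rfl | rfl) <;> contradiction
  have hpq : q ∉ comp G {c, d} p := fun h => hG <|
    isMinorOf_K4_of_mem_comp hcd hP hQ hR dPQ dPR dQR hcP hdP hcQ hdQ hcR hdR tcP tdP tcQ tdQ tcR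
      tdR hp hq h
  have hpr : r ∉ comp G {c, d} p := fun h => hG <|
    isMinorOf_K4_of_mem_comp hcd hP hR hQ dPR dPQ dQR.symm hcP hdP hcR hdR hcQ hdQ tcP tdP tcR tdR
      tcQ tdQ hp hr h
  have hqr : r ∉ comp G {c, d} q := fun h => hG <|
    isMinorOf_K4_of_mem_comp hcd hQ hR hP dQR dPQ.symm dPR.symm hcQ hdQ hcR hdR hcP hdP tcQ tdQ tcR
      tdR tcP tdP hq hr h
  refine ⟨![p, q, r], fun i => ?_, fun i j hij => ?_⟩
  · fin_cases i
    exacts [hp', hq', hr']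
  · fin_cases i <;> fin_cases j <;> first
      | exact absurd rfl hij
      | exact hpq | exact hpr | exact hqr
      | exact fun h => hpq (comp_symm hq' h) | exact fun h => hpr (comp_symm hr' h)
      | exact fun h => hqr (comp_symm hr' h)

/-- A shortest path from `c` to `d` through the connected set `K`. -/
theorem ConnOn.exists_path {K : Set V} {c d : V} (hK : ConnOn G K) (hc : c ∉ K) (hd : d ∉ K)
    (hcd : c ≠ d) (tc : Touch G K {c}) (td : Touch G K {d}) :
    ∃ (m : ℕ) (s : ℕ → V), 1 ≤ m ∧ s 0 = c ∧ s (m + 1) = d ∧ (∀ i, 1 ≤ i → i ≤ m → s i ∈ K) ∧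
      (∀ i j, i < j → j ≤ m + 1 → s i ≠ s j) ∧ (∀ i ≤ m, G.Adj (s i) (s (i + 1))) ∧
      ∀ i j, i < j → j ≤ m + 1 → G.Adj (s i) (s j) → j = i + 1 ∨ (i = 0 ∧ j = m + 1) := by
  classical
  have hex : ∃ m, 1 ≤ m ∧ ∃ s : ℕ → V, s 0 = c ∧ s (m + 1) = d ∧ (∀ i, 1 ≤ i → i ≤ m → s i ∈ K) ∧
      ∀ i ≤ m, G.Adj (s i) (s (i + 1)) := by
    obtain ⟨x, hx, _, rfl, hxc⟩ := tc
    obtain ⟨y, hy, _, rfl, hyd⟩ := td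
    rename_i c d
    have hstep : ∀ (m : ℕ) (s : ℕ → V) (z : V), s 0 = c → (∀ i, 1 ≤ i → i ≤ m → s i ∈ K) →
        (∀ i < m, G.Adj (s i) (s (i + 1))) → G.Adj (s m) z →
        ∃ t : ℕ → V, t 0 = c ∧ t (m + 1) = z ∧ (∀ i, 1 ≤ i → i ≤ m → t i ∈ K) ∧
          ∀ i ≤ m, G.Adj (t i) (t (i + 1)) := by
      intro m s z h0 hK hadj hz
      refine ⟨fun i => if i ≤ m then s i else z, by simpa using h0, by simp, fun i h1 h2 => ?_,
        fun i hi => ?_⟩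
      · simpa [h2] using hK i h1 h2
      · rcases hi.lt_or_eq with h | rfl
        · simpa [hi, Nat.succ_le_of_lt h] using hadj i h
        · simpa using hz
    have hall := hK.2 {z | ∃ m, 1 ≤ m ∧ ∃ s : ℕ → V, s 0 = c ∧ s m = z ∧
        (∀ i, 1 ≤ i → i ≤ m → s i ∈ K) ∧ ∀ i < m, G.Adj (s i) (s (i + 1))} ⟨x, hx, by
      obtain ⟨t, h0, h1, -, h3⟩ := hstep 0 (fun _ => c) x rfl (by omega) (by omega) hxc.symm
      refine ⟨1, le_rfl, t, h0, h1, fun i h2 h3 => ?_, fun i hi => h3 i (by omega)⟩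
      obtain rfl : i = 1 := by omega
      exact h1 ▸ hx⟩ (by
      rintro a ha ⟨m, hm, s, h0, rfl, h2, h3⟩ b hb hab
      obtain ⟨t, h0, h1, h2, h3⟩ := hstep m s b h0 h2 h3 hab
      refine ⟨m + 1, by omega, t, h0, h1, fun i h4 h5 => ?_, fun i hi => h3 i (by omega)⟩
      rcases h5.lt_or_eq with h | rfl
      exacts [h2 i h4 (by omega), h1 ▸ hb])
    obtain ⟨m, hm, s, h0, rfl, h2, h3⟩ := hall hy
    exact ⟨m, hm, hstep m s d h0 h2 h3 hyd⟩
  obtain ⟨hm, s, h0, h1, h2, h3⟩ := Nat.find_spec hex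
  set m := Nat.find hex with hm_def
  have hshort : ∀ i j, i < j → j ≤ m + 1 → G.Adj (s i) (s j) → j = i + 1 ∨ (i = 0 ∧ j = m + 1) := by
    intro i j hij hj hadj
    by_contra! hcon
    refine Nat.find_min hex (m := m - (j - i - 1)) (by omega) ⟨by omega,
      fun k => if k ≤ i then s k else s (k + (j - i - 1)), by simpa using h0, ?_,
      fun k hk hk' => ?_,
      fun k hk => ?_⟩
    · dsimp only
      rw [if_neg (by omega), ← h1]
      congr 1
      omega
    · dsimp only
      split_ifs
      exacts [h2 k hk (by omega), h2 _ (by omega) (by omega)]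
    · rcases lt_trichotomy k i with h | rfl | h
      · simpa [h.le, Nat.succ_le_of_lt h] using h3 k (by omega)
      · have : k + 1 + (j - k - 1) = j := by omega
        simpa [this] using hadj
      · have e : k + 1 + (j - i - 1) = k + (j - i - 1) + 1 := by omega
        simpa [not_le.2 h, not_le.2 (Nat.lt_succ_of_lt h), e] using
          h3 (k + (j - i - 1)) (by omega)
  refine ⟨m, s, hm, h0, h1, h2, fun i j hij hj he => ?_, h3, hshort⟩
  rcases hj.lt_or_eq with hj | rfl
  · have hadj := h3 j (by omega)
    rw [← he] at hadj
    rcases hshort i (j + 1) (by omega) (by omega) hadj with h | ⟨rfl, h⟩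
    · omega
    · exact hc (h0 ▸ he ▸ h2 j (by omega) (by omega))
  · rw [h1] at he
    rcases Nat.eq_zero_or_pos i with rfl | hi
    · exact hcd (h0.symm.trans he)
    · exact hd (he ▸ h2 i hi (by omega))

/-- A component attached to the two ends of an edge provides an ear. -/
theorem ConnOn.exists_isEar {K X : Set V} {c d : V} (hK : ConnOn G K) (hKX : Disjoint K X)
    (hc : c ∈ X) (hd : d ∈ X) (hcd : G.Adj c d) (tc : Touch G K {c}) (td : Touch G K {d})
    (hN : ∀ x ∈ K, ∀ y ∈ X, G.Adj x y → y = c ∨ y = d) : ∃ Y m s, IsEar G X Y m s := by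
  have hK' := Set.disjoint_left.1 hKX
  obtain ⟨m, s, hm, rfl, rfl, hs, hinj, hadj, hind⟩ := hK.exists_path (fun h => hK' h hc)
    (fun h => hK' h hd) hcd.ne tc td
  refine ⟨X ∪ {y | ∃ i, 1 ≤ i ∧ i ≤ m ∧ y = s i}, m, s, hm, hc, hd, hcd,
    fun i j hi hi' hj hj' he => ?_, fun i h1 h2 => hK' (hs i h1 h2), fun y => Iff.rfl,
    fun i h1 h2 y hy => ⟨fun h => ?_, ?_⟩⟩
  · rcases lt_trichotomy i j with h | h | h
    exacts [absurd he (hinj i j h (by omega)), h, absurd he.symm (hinj j i h (by omega))]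
  · obtain ⟨j, hj, rfl⟩ : ∃ j ≤ m + 1, y = s j := by
      rcases hy with hy | ⟨j, -, hj, rfl⟩
      · rcases hN _ (hs i h1 h2) y hy h with rfl | rfl
        exacts [⟨0, by omega, rfl⟩, ⟨m + 1, le_rfl, rfl⟩]
      · exact ⟨j, by omega, rfl⟩
    rcases lt_trichotomy i j with hij | rfl | hij
    · rcases hind i j hij hj h with rfl | h'
      · exact Or.inr rfl
      · omega
    · exact absurd rfl h.ne
    · rcases hind j i hij (by omega) h.symm with rfl | h'
      · exact Or.inl rfl
      · omega
  · rintro (rfl | rfl)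
    · simpa [Nat.sub_add_cancel h1] using (hadj (i - 1) (by omega)).symm
    · exact hadj i h2

end touch

section linked

variable {V : Type} {H : SimpleGraph V} {X Y : Set V} {m : ℕ} {s : ℕ → V}

/-- Two disjoint connected subsets of `X` join the ends of `ab` to the ends of `cd`. -/
def Link (H : SimpleGraph V) (X : Set V) (a b c d : V) : Prop :=
  ∃ P Q : Set V, P ⊆ X ∧ Q ⊆ X ∧ ConnOn H P ∧ ConnOn H Q ∧ Disjoint P Q ∧ a ∈ P ∧ b ∈ Q ∧
    ((c ∈ P ∧ d ∈ Q) ∨ (d ∈ P ∧ c ∈ Q))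

theorem Link.swap_left {a b c d : V} (h : Link H X a b c d) : Link H X b a c d := by
  obtain ⟨P, Q, hP, hQ, cP, cQ, hPQ, ha, hb, h⟩ := h
  exact ⟨Q, P, hQ, hP, cQ, cP, hPQ.symm, hb, ha, h.symm.imp And.symm And.symm⟩

theorem Link.symm {a b c d : V} (h : Link H X a b c d) : Link H X c d a b := by
  obtain ⟨P, Q, hP, hQ, cP, cQ, hPQ, ha, hb, ⟨hc, hd⟩ | ⟨hd, hc⟩⟩ := h
  · exact ⟨P, Q, hP, hQ, cP, cQ, hPQ, hc, hd, Or.inl ⟨ha, hb⟩⟩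
  · exact ⟨Q, P, hQ, hP, cQ, cP, hPQ.symm, hc, hd, Or.inr ⟨hb, ha⟩⟩

theorem Link.mono {a b c d : V} (h : Link H X a b c d) (hXY : X ⊆ Y) : Link H Y a b c d := by
  obtain ⟨P, Q, hP, hQ, h⟩ := h
  exact ⟨P, Q, hP.trans hXY, hQ.trans hXY, h⟩

theorem Link.congr_left {a b a' b' c d : V} (h : Link H X a b c d) (he : s(a', b') = s(a, b)) :
    Link H X a' b' c d := by
  rcases Sym2.eq_iff.1 he with ⟨rfl, rfl⟩ | ⟨rfl, rfl⟩
  exacts [h, h.swap_left]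

theorem Link.congr_right {a b c d c' d' : V} (h : Link H X a b c d) (he : s(c', d') = s(c, d)) :
    Link H X a b c' d' := (h.symm.congr_left he).symm

theorem Link.refl {a b : V} (ha : a ∈ X) (hb : b ∈ X) (hab : a ≠ b) : Link H X a b a b :=
  ⟨{a}, {b}, by simpa, by simpa, ConnOn.singleton a, ConnOn.singleton b, by simpa, rfl, rfl,
    Or.inl ⟨rfl, rfl⟩⟩

/-- Any two edges inside `X` are linked. -/
def Linked (H : SimpleGraph V) (X : Set V) : Prop :=
  ∀ a ∈ X, ∀ b ∈ X, ∀ c ∈ X, ∀ d ∈ X, H.Adj a b → H.Adj c d → Link H X a b c d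

theorem Linked.pair (a b : V) : Linked H {a, b} := by
  have key : ∀ c ∈ ({a, b} : Set V), ∀ d ∈ ({a, b} : Set V), H.Adj c d → s(c, d) = s(a, b) := by
    rintro c (rfl | rfl) d (rfl | rfl) h
    exacts [absurd rfl h.ne, rfl, Sym2.eq_swap, absurd rfl h.ne]
  intro c hc d hd e he f hf hcd hef
  exact (Link.refl hc hd hcd.ne).congr_right ((key e he f hf hef).trans (key c hc d hd hcd).symm)

theorem IsEar.linked (h : IsEar H X Y m s) (hX : Linked H X) : Linked H Y := by
  have hadj : ∀ i ≤ m, H.Adj (s i) (s (i + 1)) := fun i hi => h.cycSeq.adj_succ (by omega)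
  have hmixed : ∀ a ∈ X, ∀ b ∈ X, H.Adj a b → ∀ i ≤ m, Link H Y a b (s i) (s (i + 1)) := by
    intro a ha b hb hab i hi
    obtain ⟨P, Q, hP, hQ, cP, cQ, hPQ, h0, h1, hPQ'⟩ :=
      (hX a ha b hb _ h.left_mem _ h.right_mem hab h.adj).symm
    have hL := connOn_arc (H := H) (s := s) (i := 0) (j := i) (by omega)
      fun l _ hl => hadj l (by omega)
    have hR := connOn_arc (H := H) (s := s) (i := i + 1) (j := m + 1) (by omega)
      fun l _ hl => hadj l (by omega)
    refine Link.symm ⟨_, _, ?_, ?_, hL.union cP ⟨s 0, ⟨0, by omega, by omega, rfl⟩, s 0, h0,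
      Or.inl rfl⟩, hR.union cQ ⟨s (m + 1), ⟨m + 1, by omega, le_rfl, rfl⟩, s (m + 1), h1,
      Or.inl rfl⟩, ?_, Or.inl ⟨i, by omega, le_rfl, rfl⟩, Or.inl ⟨i + 1, le_rfl, by omega, rfl⟩,
      hPQ'.imp (fun h => ⟨Or.inr h.1, Or.inr h.2⟩) fun h => ⟨Or.inr h.1, Or.inr h.2⟩⟩
    · rintro _ (⟨l, -, hl, rfl⟩ | hx)
      exacts [h.mem (by omega), h.subset (hP hx)]
    · rintro _ (⟨l, -, hl, rfl⟩ | hx)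
      exacts [h.mem (by omega), h.subset (hQ hx)]
    · refine Set.disjoint_left.2 ?_
      rintro _ (⟨l, -, hl, rfl⟩ | hx) (⟨k, hk, hk', he⟩ | hx')
      · have := h.inj' (by omega) (by omega) he
        omega
      · rcases Nat.eq_zero_or_pos l with rfl | hl0
        · exact Set.disjoint_left.1 hPQ h0 hx'
        · exact h.new l hl0 (by omega) (hQ hx')
      · subst he
        rcases hk'.lt_or_eq with hk' | rfl
        · exact h.new k (by omega) (by omega) (hP hx)
        · exact Set.disjoint_left.1 hPQ hx h1
      · exact Set.disjoint_left.1 hPQ hx hx'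
  have hboth : ∀ i j, i ≤ j → j ≤ m → Link H Y (s i) (s (i + 1)) (s j) (s (j + 1)) := by
    intro i j hij hj
    rcases hij.eq_or_lt with rfl | hij
    · exact Link.refl (h.mem (by omega)) (h.mem (by omega)) (hadj i hj).ne
    have hL := connOn_arc (H := H) (s := s) (i := 0) (j := i) (by omega)
      fun l _ hl => hadj l (by omega)
    have hR := connOn_arc (H := H) (s := s) (i := j + 1) (j := m + 1) (by omega)
      fun l _ hl => hadj l (by omega)
    refine ⟨_, _, ?_, ?_, hL.union hR ⟨s 0, ⟨0, by omega, by omega, rfl⟩, s (m + 1),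
      ⟨m + 1, by omega, le_rfl, rfl⟩, Or.inr h.adj⟩,
      connOn_arc (H := H) (s := s) (i := i + 1) (j := j) (by omega) fun l _ hl => hadj l (by omega),
      ?_, Or.inl ⟨i, by omega, le_rfl, rfl⟩, ⟨i + 1, le_rfl, by omega, rfl⟩,
      Or.inr ⟨Or.inr ⟨j + 1, le_rfl, by omega, rfl⟩, ⟨j, by omega, le_rfl, rfl⟩⟩⟩
    · rintro _ (⟨l, -, hl, rfl⟩ | ⟨l, -, hl, rfl⟩) <;> exact h.mem (by omega)
    · rintro _ ⟨l, -, hl, rfl⟩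
      exact h.mem (by omega)
    · refine Set.disjoint_left.2 ?_
      rintro _ (⟨l, _, _, rfl⟩ | ⟨l, _, _, rfl⟩) ⟨k, hk, hk', he⟩ <;>
      · have := h.inj' (by omega) (by omega) he
        omega
  intro a ha b hb c hc d hd hab hcd
  rcases h.edge_cases ha hb hab with ⟨ha', hb'⟩ | ⟨i, hi, he⟩ <;>
    rcases h.edge_cases hc hd hcd with ⟨hc', hd'⟩ | ⟨j, hj, he'⟩
  · exact (hX a ha' b hb' c hc' d hd' hab hcd).mono h.subset
  · exact (hmixed a ha' b hb' hab j hj).congr_right he'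
  · exact ((hmixed c hc' d hd' hcd i hi).congr_right he).symm
  · rcases le_total i j with hij | hij
    · exact ((hboth i j hij hj).congr_left he).congr_right he'
    · exact ((hboth j i hij hi).congr_left he').congr_right he |>.symm

theorem TCSet.linked (hX : TCSet H X) : Linked H X := by
  induction hX using TCSet.induction_ear with
  | cycle X n s h => exact h.isEar.linked (Linked.pair _ _)
  | ear X Y m s hX hear ih => exact hear.linked ih

/-- A connected set contains a connected part joining two of its nonadjacent vertices. -/
theorem ConnOn.exists_between {P : Set V} {c d : V} (hP : ConnOn H P) (hc : c ∈ P) (hd : d ∈ P)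
    (hcd : c ≠ d) (h : ¬ H.Adj c d) : ∃ Q ⊆ P, ConnOn H Q ∧ c ∉ Q ∧ d ∉ Q ∧ Touch H {c} Q ∧
      Touch H {d} Q := by
  by_contra! hcon
  have hcomp : ∀ x ∈ P, x ≠ c → x ≠ d → x ∉ Pᶜ ∪ {c, d} := by
    rintro x hx h1 h2 (h | rfl | rfl)
    exacts [h hx, h1 rfl, h2 rfl]
  have := hP.2 {x | x = c ∨ (x ≠ d ∧ x ≠ c ∧ Touch H {c} (comp H (Pᶜ ∪ {c, d}) x))}
    ⟨c, hc, Or.inl rfl⟩ (by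
    rintro x hx hxU y hy hxy
    by_cases hyc : y = c
    · exact Or.inl hyc
    rcases hxU with rfl | ⟨hxd, hxc, ht⟩
    · by_cases hyd : y = d
      · exact absurd (hyd ▸ hxy) h
      · exact Or.inr ⟨hyd, hyc, x, rfl, y, mem_comp_self, hxy⟩
    · have hxP := hcomp x hx hxc hxd
      by_cases hyd : y = d
      · subst hyd
        refine absurd ⟨y, rfl, x, mem_comp_self, hxy.symm⟩ (hcon _ (fun z hz => ?_) comp_connOn
          (fun hz => comp_disjoint hxP hz (Or.inr (Or.inl rfl)))
          (fun hz => comp_disjoint hxP hz (Or.inr (Or.inr rfl))) ht)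
        by_contra hzP
        exact comp_disjoint hxP hz (Or.inl hzP)
      · exact Or.inr ⟨hyd, hyc, ht.mono subset_rfl fun z hz => comp_trans
          (comp_symm hxP (comp_closed mem_comp_self hxy (hcomp y hy hyc hyd))) hz⟩) hd
  rcases this with h | ⟨h, -⟩
  exacts [hcd h.symm, h rfl]

/-- Removing a vertex from a connected set, some connected part touching it contains `d`. -/
theorem ConnOn.exists_touch {P : Set V} {c d : V} (hP : ConnOn H P) (hc : c ∈ P) (hd : d ∈ P)
    (hcd : c ≠ d) : ∃ Q ⊆ P, ConnOn H Q ∧ c ∉ Q ∧ Touch H {c} Q ∧ d ∈ Q := by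
  have hdP : d ∉ Pᶜ ∪ {c} := by
    rintro (h | rfl)
    exacts [h hd, hcd rfl]
  have hcQ : c ∉ comp H (Pᶜ ∪ {c}) d := fun h => comp_disjoint hdP h (Or.inr rfl)
  obtain ⟨x, hx, hxQ, y, hy, hyQ, hxy⟩ := hP.exists_cross (U := comp H (Pᶜ ∪ {c}) d)
    ⟨d, hd, mem_comp_self⟩ ⟨c, hc, hcQ⟩
  obtain rfl : y = c := by
    by_contra hyc
    refine hyQ (comp_closed hxQ hxy ?_)
    rintro (h | h)
    exacts [h hy, hyc h]
  refine ⟨_, fun z hz => ?_, comp_connOn, hcQ, ⟨y, rfl, x, hxQ, hxy.symm⟩, mem_comp_self⟩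
  by_contra hzP
  exact comp_disjoint hdP hz (Or.inl hzP)

/-- Two nonadjacent vertices of a tree of cycles are joined by two disjoint connected sets. -/
theorem TCSet.exists_disjoint_links (hX : TCSet H X) {c d : V} (hc : c ∈ X) (hd : d ∈ X)
    (hcd : c ≠ d) (h : ¬ H.Adj c d) : ∃ P ⊆ X, ∃ Q ⊆ X, ConnOn H P ∧ ConnOn H Q ∧ Disjoint P Q ∧
      c ∉ P ∧ d ∉ P ∧ c ∉ Q ∧ d ∉ Q ∧ Touch H {c} P ∧ Touch H {d} P ∧ Touch H {c} Q ∧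
      Touch H {d} Q := by
  obtain ⟨c', hc', -, hcc'⟩ := hX.exists_adj_ne c hc c
  obtain ⟨d', hd', -, hdd'⟩ := hX.exists_adj_ne d hd d
  obtain ⟨P, Q, hP, hQ, cP, cQ, hPQ, hcP, hc'Q, h'⟩ := hX.linked c hc c' hc' d hd d' hd' hcc' hdd'
  have hdis := Set.disjoint_left.1 hPQ
  rcases h' with ⟨hdP, hd'Q⟩ | ⟨hd'P, hdQ⟩
  · obtain ⟨P', hP', cP', h1, h2, h3, h4⟩ := cP.exists_between hcP hdP hcd h
    exact ⟨P', hP'.trans hP, Q, hQ, cP', cQ, hPQ.mono_left hP', h1, h2, hdis hcP, hdis hdP, h3, h4,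
      ⟨c, rfl, c', hc'Q, hcc'⟩, ⟨d, rfl, d', hd'Q, hdd'⟩⟩
  · have h1 : c ≠ d' := fun e => h (e ▸ hdd'.symm)
    have h2 : d ≠ c' := fun e => h (e ▸ hcc')
    obtain ⟨P', hP', cP', h3, h4, h5⟩ := cP.exists_touch hcP hd'P h1
    obtain ⟨Q', hQ', cQ', h6, h7, h8⟩ := cQ.exists_touch hdQ hc'Q h2
    exact ⟨P', hP'.trans hP, Q', hQ'.trans hQ, cP', cQ', hPQ.mono hP' hQ', h3,
      fun hx => hdis (hP' hx) hdQ, fun hx => hdis hcP (hQ' hx), h6, h4, ⟨d, rfl, d', h5, hdd'⟩,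
      ⟨c, rfl, c', h8, hcc'⟩, h7⟩

/-- A 2-connected graph without `K₄` minor in which pairs separating three parts are adjacent is a
tree of cycles. -/
theorem TwoConnected.isTreeOfCycles [Finite V] (hH : TwoConnected H) (hK4 : ¬ IsMinorOf K4 H)
    (hcell : ∀ c d, c ≠ d → Sep3 H c d → H.Adj c d) : IsTreeOfCycles H := by
  rw [isTreeOfCycles_iff]
  let F : Set (Set V) := {X | (∃ a b, H.Adj a b ∧ X = {a, b}) ∨ TCSet H X}
  have hF : F.Nonempty := by
    have : Nontrivial V := Finite.one_lt_card_iff_nontrivial.1 (lt_of_lt_of_le (by omega) hH.1)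
    obtain ⟨a, b, hab⟩ := exists_pair_ne V
    have h3 : ∃ c, c ≠ a ∧ c ≠ b := by
      by_contra! hcon
      have : (Set.univ : Set V) ⊆ {a, b} := fun c _ => or_iff_not_imp_left.2 (hcon c)
      have := Set.ncard_le_ncard this
      rw [Set.ncard_univ, Set.ncard_pair hab] at this
      exact absurd hH.1 (by omega)
    obtain ⟨c, hca, hcb⟩ := h3
    obtain ⟨x, -, rfl, y, -, -, hxy⟩ := (hH.connOn c).exists_cross (U := {a}) ⟨a, hca.symm, rfl⟩
      ⟨b, hcb.symm, hab.symm⟩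
    exact ⟨{x, y}, Or.inl ⟨x, y, hxy, rfl⟩⟩
  obtain ⟨X, hX, hmax⟩ := (Set.toFinite F).exists_maximal hF
  have hno : ∀ Y m s, ¬ IsEar H X Y m s := by
    intro Y m s h
    have hm := h.one_le
    refine h.new 1 le_rfl hm (hmax (y := Y) (Or.inr ?_) h.subset (h.mem (by omega)))
    rcases hX with ⟨a, b, hab, rfl⟩ | hX
    · have h0 := h.left_mem
      have h1 := h.right_mem
      have hne := h.adj.ne
      have hab' : ∀ x, x ∈ ({a, b} : Set V) → x = s 0 ∨ x = s (m + 1) := by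
        rintro x (rfl | rfl) <;> grind
      convert TCSet.cycle h.cycSeq using 1
      ext y
      rw [h.mem_iff]
      constructor
      · rintro (hy | ⟨i, h1, h2, rfl⟩)
        · rcases hab' y hy with rfl | rfl
          exacts [⟨0, by omega, rfl⟩, ⟨m + 1, by omega, rfl⟩]
        · exact ⟨i, by omega, rfl⟩
      · rintro ⟨i, hi, rfl⟩
        exact (h.mem_iff _).1 (h.mem (by omega))
    · exact hX.of_isEar h
  obtain ⟨a, ha, b, hb, hab⟩ : ∃ a ∈ X, ∃ b ∈ X, a ≠ b := by
    rcases hX with ⟨a, b, hab, rfl⟩ | hX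
    · exact ⟨a, Or.inl rfl, b, Or.inr rfl, hab.ne⟩
    · have : X.Nonempty := by
        cases hX with
        | cycle h => exact ⟨_, h.mem (i := 0) (by have := h.three_le; omega)⟩
        | ear _ _ h0 _ _ _ _ hmem _ => exact ⟨_, (hmem _).2 (Or.inl h0)⟩
      obtain ⟨a, ha⟩ := this
      obtain ⟨b, hb, -, h⟩ := hX.exists_adj_ne a ha a
      exact ⟨a, ha, b, hb, h.ne⟩
  by_cases hu : ∃ u, u ∉ X
  · exfalso
    obtain ⟨u, hu⟩ := hu
    set K := comp H X u
    have hKc : ConnOn H K := comp_connOn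
    have hKX : ∀ x ∈ K, x ∉ X := fun x hx => comp_disjoint hu hx
    have hatt : ∀ v ∈ X, ∀ w ∈ X, w ≠ v → ∃ c ∈ X, c ≠ v ∧ Touch H K {c} := by
      intro v hv w hw hwv
      obtain ⟨x, -, hxK, y, hy, hyK, hxy⟩ := (hH.connOn v).exists_cross (U := K)
        ⟨u, fun h => hu (h ▸ hv), mem_comp_self⟩ ⟨w, hwv, fun h => hKX w h hw⟩
      refine ⟨y, ?_, hy, x, hxK, y, rfl, hxy⟩
      by_contra hyX
      exact hyK (comp_closed hxK hxy hyX)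
    obtain ⟨c, hc, -, tc⟩ := hatt a ha b hb hab.symm
    obtain ⟨d, hd, hdc, td⟩ : ∃ d ∈ X, d ≠ c ∧ Touch H K {d} := by
      by_cases hac : a = c
      · exact hatt c hc b hb (hac ▸ hab.symm)
      · exact hatt c hc a ha hac
    have hadj : ∀ c ∈ X, ∀ d ∈ X, c ≠ d → Touch H K {c} → Touch H K {d} → H.Adj c d := by
      intro c hc d hd hcd tc td
      by_contra h
      have hXT : TCSet H X := by
        refine hX.resolve_left ?_
        rintro ⟨a, b, hab, rfl⟩
        rcases hc with rfl | rfl <;> rcases hd with rfl | rfl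
        exacts [hcd rfl, h hab, h hab.symm, hcd rfl]
      obtain ⟨P, hP, Q, hQ, cP, cQ, hPQ, h1, h2, h3, h4, h5, h6, h7, h8⟩ :=
        hXT.exists_disjoint_links hc hd hcd h
      refine h (hcell c d hcd (sep3_of_disjoint_links hK4 hcd cP cQ hKc hPQ ?_ ?_ h1 h2 h3 h4
        (fun h => hKX c h hc) (fun h => hKX d h hd) h5 h6 h7 h8 tc.symm td.symm))
      · exact Set.disjoint_left.2 fun x hx hx' => hKX x hx' (hP hx)
      · exact Set.disjoint_left.2 fun x hx hx' => hKX x hx' (hQ hx)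
    have hcd := hadj c hc d hd hdc.symm tc td
    obtain ⟨Y, m, s, h⟩ := hKc.exists_isEar (Set.disjoint_left.2 hKX) hc hd hcd tc td (by
      intro x hx e he hxe
      by_contra! hcon
      have te : Touch H K {e} := ⟨x, hx, e, rfl, hxe⟩
      have hce := hadj c hc e he hcon.1.symm tc te
      have hde := hadj d hd e he hcon.2.symm td te
      refine hK4 (isMinorOf_K4 (ConnOn.singleton c) (ConnOn.singleton d) (ConnOn.singleton e) hKc
        ?_ ?_ ?_ ?_ ?_ ?_ ⟨c, rfl, d, rfl, hcd⟩ ⟨c, rfl, e, rfl, hce⟩ tc.symm ⟨d, rfl, e, rfl, hde⟩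
        td.symm te.symm)
      · simpa using hdc.symm
      · simpa using hcon.1.symm
      · exact Set.disjoint_singleton_left.2 fun h => hKX c h hc
      · simpa using hcon.2.symm
      · exact Set.disjoint_singleton_left.2 fun h => hKX d h hd
      · exact Set.disjoint_singleton_left.2 fun h => hKX e h he)
    exact hno Y m s h
  · push Not at hu
    obtain rfl : X = Set.univ := Set.eq_univ_of_forall hu
    refine hX.resolve_left ?_
    rintro ⟨a, b, hab, he⟩
    have := Set.ncard_univ V
    rw [he, Set.ncard_pair hab.ne] at this
    exact absurd hH.1 (by omega)

end linked

section paths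

variable {V : Type} {G : SimpleGraph V} {a b : V} {S T : Set V}

theorem TwoConnected.mem_comp_of_isChordlessCycle [Finite V] (hG : TwoConnected G)
    (hS : IsChordlessCycle (cellCompletion G) S) (ha : a ∈ S) (hb : b ∈ S)
    (hab : (cellCompletion G).Adj a b) {x y : V} (hx : x ∈ S) (hx' : x ∉ ({a, b} : Set V))
    (hy : y ∈ S) (hy' : y ∉ ({a, b} : Set V)) : y ∈ comp G {a, b} x := by
  rw [← hG.comp_eq le_cellCompletion le_rfl hx']
  refine subset_comp (hS.connOn_diff ha hb hab) ⟨hx, ?_⟩ ?_ ⟨hy, ?_⟩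
  · simpa using hx'
  · rintro z ⟨-, h⟩
    simpa using h
  · simpa using hy'

theorem TwoConnected.notMem_comp_of_ne [Finite V] (hG : TwoConnected G)
    (hT : TCSet (cellCompletion G) Set.univ) (hab : (cellCompletion G).Adj a b)
    (h1 : IsChordlessCycle (cellCompletion G) S) (h2 : IsChordlessCycle (cellCompletion G) T)
    (hne : S ≠ T) (haS : a ∈ S) (hbS : b ∈ S) (haT : a ∈ T) (hbT : b ∈ T) {x y : V} (hx : x ∈ S)
    (hx' : x ∉ ({a, b} : Set V)) (hy : y ∈ T) : y ∉ comp G {a, b} x := by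
  obtain ⟨U, hSU, hTU, hU⟩ := hT.exists_separation a b S T hab h1 h2 hne haS hbS haT hbT
    (Set.subset_univ _) (Set.subset_univ _)
  rw [← hG.comp_eq le_cellCompletion le_rfl hx']
  have hx'' : x ≠ a ∧ x ≠ b := by simpa using hx'
  refine fun h => hTU y hy (comp_subset (U := U) (hSU x hx hx''.1 hx''.2) ?_ h)
  intro u hu v hv huv
  have hv' : v ≠ a ∧ v ≠ b := by simpa using hv
  exact hU u hu v trivial hv'.1 hv'.2 huv

/-- A component of `G - {a, b}` with at least two vertices contains a path on two parts
from `a` to `b`. -/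
theorem TwoConnected.exists_two_parts (hG : TwoConnected G) (hab : a ≠ b) {z z' : V}
    (hz : z ∉ ({a, b} : Set V)) (hz' : z' ∈ comp G {a, b} z) (hne : z' ≠ z) :
    ∃ P ⊆ comp G {a, b} z, ∃ Q ⊆ comp G {a, b} z, ConnOn G P ∧ ConnOn G Q ∧ Disjoint P Q ∧
      Touch G {a} P ∧ Touch G P Q ∧ Touch G Q {b} := by
  suffices ∃ u ∈ comp G {a, b} z, ∃ w ∈ comp G {a, b} z, u ≠ w ∧ G.Adj u a ∧ G.Adj w b by
    obtain ⟨u, hu, w, hw, huw, hua, hwb⟩ := this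
    obtain ⟨Q, hQ, cQ, huQ, ht, hwQ⟩ := ConnOn.exists_touch comp_connOn hu hw huw
    exact ⟨{u}, by simpa, Q, hQ, ConnOn.singleton u, cQ, by simpa, ⟨a, rfl, u, rfl, hua.symm⟩, ht,
      ⟨w, hwQ, b, rfl, hwb⟩⟩
  have hza : z ≠ a := fun h => hz (by simp [h])
  have hzb : z ≠ b := fun h => hz (by simp [h])
  obtain ⟨u, hu, hua⟩ := hG.exists_adj_comp hab subset_rfl (by simp) hz hzb
  obtain ⟨w, hw, hwb⟩ := hG.exists_adj_comp (P := {a, b}) hab.symm (by simp [Set.pair_comm])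
    (by simp) hz hza
  rcases ne_or_eq u w with h | rfl
  · exact ⟨u, hu, w, hw, h, hua, hwb⟩
  obtain ⟨x₀, hx₀, hx₀u⟩ : ∃ x ∈ comp G {a, b} z, x ≠ u := by
    rcases ne_or_eq z u with h | rfl
    exacts [⟨z, mem_comp_self, h⟩, ⟨z', hz', hne⟩]
  obtain ⟨x, hxu, hx, y, hyu, hy, hxy⟩ := (hG.connOn u).exists_cross (U := comp G {a, b} z)
    ⟨x₀, hx₀u, hx₀⟩ ⟨a, hua.ne', fun h => comp_disjoint hz h (by simp)⟩
  have hyP : y ∈ ({a, b} : Set V) := by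
    by_contra h
    exact hy (comp_closed hx hxy h)
  rcases hyP with rfl | rfl
  exacts [⟨x, hx, u, hu, hxu, hxy, hwb⟩, ⟨u, hu, x, hx, Ne.symm hxu, hua, hxy⟩]

theorem exists_mem_comp_ne [Finite V] (hG : TwoConnected G)
    (hS : IsChordlessCycle (cellCompletion G) S) (hsimp : ¬ IsSimplicialTriangle (cellCompletion G) S) (ha : a ∈ S) (hb : b ∈ S)
    (hab : (cellCompletion G).Adj a b) {z : V} (hz : z ∈ S) (hz' : z ∉ ({a, b} : Set V)) :
    ∃ z' ∈ comp G {a, b} z, z' ≠ z := by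
  by_contra! hcon
  have hza : z ≠ a := fun h => hz' (by simp [h])
  have hzb : z ≠ b := fun h => hz' (by simp [h])
  refine hsimp ⟨hS, Set.ncard_eq_three.2 ⟨a, b, z, hab.ne, hza.symm, hzb.symm, ?_⟩, z, hz, ?_⟩
  · refine Set.Subset.antisymm (fun x hx => ?_) ?_
    · by_cases hx' : x ∈ ({a, b} : Set V)
      · rcases hx' with rfl | rfl <;> simp
      · simp [hcon x (hG.mem_comp_of_isChordlessCycle hS ha hb hab hz hz' hx hx')]
    · rintro x (rfl | rfl | rfl)
      exacts [ha, hb, hz]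
  · have hN : ∀ x, (cellCompletion G).Adj z x → x = a ∨ x = b := by
      intro x hx
      by_contra h
      have h' : x ∉ ({a, b} : Set V) := by simpa using h
      have := comp_closed (G := cellCompletion G) mem_comp_self hx h'
      rw [hG.comp_eq le_cellCompletion le_rfl hz'] at this
      exact hx.ne (hcon x this).symm
    intro x hx y hy hxy
    rcases hN x hx with rfl | rfl <;> rcases hN y hy with rfl | rfl
    exacts [absurd rfl hxy, hab, hab.symm, absurd rfl hxy]

theorem isMinorOf_D3 {P Q : Fin 3 → Set V} (hP : ∀ i, ConnOn G (P i)) (hQ : ∀ i, ConnOn G (Q i))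
    (hab : a ≠ b) (haP : ∀ i, a ∉ P i) (haQ : ∀ i, a ∉ Q i) (hbP : ∀ i, b ∉ P i)
    (hbQ : ∀ i, b ∉ Q i) (hPP : ∀ i j, i ≠ j → Disjoint (P i) (P j))
    (hQQ : ∀ i j, i ≠ j → Disjoint (Q i) (Q j)) (hPQ : ∀ i j, Disjoint (P i) (Q j))
    (h1 : ∀ i, Touch G {a} (P i)) (h2 : ∀ i, Touch G (P i) (Q i)) (h3 : ∀ i, Touch G (Q i) {b}) :
    IsMinorOf D3 G := by
  refine isMinorOf_iff.2 ⟨![{a}, {b}, P 0, Q 0, P 1, Q 1, P 2, Q 2], fun i => ?_,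
    fun i j hij => ?_, fun i j hij => ?_⟩
  · fin_cases i
    exacts [ConnOn.singleton a, ConnOn.singleton b, hP 0, hQ 0, hP 1, hQ 1, hP 2, hQ 2]
  · have h1 : Disjoint {a} ({b} : Set V) := by simpa
    have h2 : ∀ i, Disjoint {a} (P i) := fun i => by simpa using haP i
    have h3 : ∀ i, Disjoint {a} (Q i) := fun i => by simpa using haQ i
    have h4 : ∀ i, Disjoint {b} (P i) := fun i => by simpa using hbP i
    have h5 : ∀ i, Disjoint {b} (Q i) := fun i => by simpa using hbQ i
    fin_cases i <;> fin_cases j <;> first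
      | exact absurd rfl hij
      | exact h1 | exact h2 _ | exact h3 _ | exact h4 _ | exact h5 _ | exact hPQ _ _
      | exact h1.symm | exact (h2 _).symm | exact (h3 _).symm | exact (h4 _).symm
      | exact (h5 _).symm | exact (hPQ _ _).symm
      | exact hPP _ _ (by decide) | exact hQQ _ _ (by decide)
  · fin_cases i <;> fin_cases j <;> first
      | exact h1 _ | exact h2 _ | exact h3 _
      | exact (h1 _).symm | exact (h2 _).symm | exact (h3 _).symm
      | exact absurd hij (by simp [D3])

theorem isMinorOf_S3 {A B C D E F : Set V} (hA : ConnOn G A) (hB : ConnOn G B) (hC : ConnOn G C)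
    (hD : ConnOn G D) (hE : ConnOn G E) (hF : ConnOn G F) (dAB : Disjoint A B)
    (dAC : Disjoint A C) (dBC : Disjoint B C) (dDE : Disjoint D E) (dDF : Disjoint D F)
    (dEF : Disjoint E F) (dAD : Disjoint A D) (dAE : Disjoint A E) (dAF : Disjoint A F)
    (dBD : Disjoint B D) (dBE : Disjoint B E) (dBF : Disjoint B F) (dCD : Disjoint C D)
    (dCE : Disjoint C E) (dCF : Disjoint C F) (tAB : Touch G A B) (tAC : Touch G A C)
    (tBC : Touch G B C) (tAD : Touch G A D) (tBD : Touch G B D) (tBE : Touch G B E)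
    (tCE : Touch G C E) (tCF : Touch G C F) (tAF : Touch G A F) : IsMinorOf S3 G := by
  refine isMinorOf_iff.2 ⟨![F, A, D, B, E, C], fun i => ?_, fun i j hij => ?_, fun i j hij => ?_⟩
  · fin_cases i
    exacts [hF, hA, hD, hB, hE, hC]
  · fin_cases i <;> fin_cases j <;> first
      | exact absurd rfl hij
      | assumption
      | (refine Disjoint.symm ?_; assumption)
  · fin_cases i <;> fin_cases j <;> first
      | assumption
      | (refine Touch.symm ?_; assumption)
      | exact absurd hij (by simp [S3])

theorem ncard_le_two_of_not_isMinorOf_D3 [Finite V] (hG : TwoConnected G)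
    (hT : TCSet (cellCompletion G) Set.univ) (hD3 : ¬ IsMinorOf D3 G)
    (hab : (cellCompletion G).Adj a b) :
    {S : Set V | IsChordlessCycle (cellCompletion G) S ∧ a ∈ S ∧ b ∈ S ∧
      ¬ IsSimplicialTriangle (cellCompletion G) S}.ncard ≤ 2 := by
  by_contra! hcon
  obtain ⟨S₀, S₁, S₂, h₀, h₁, h₂, h01, h02, h12⟩ := (Set.two_lt_ncard_iff (Set.toFinite _)).1 hcon
  obtain ⟨S, hS, hSS⟩ : ∃ S : Fin 3 → Set V, (∀ i, IsChordlessCycle (cellCompletion G) (S i) ∧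
      a ∈ S i ∧ b ∈ S i ∧ ¬ IsSimplicialTriangle (cellCompletion G) (S i)) ∧
      ∀ i j, i ≠ j → S i ≠ S j := by
    refine ⟨![S₀, S₁, S₂], fun i => ?_, fun i j hij => ?_⟩
    · fin_cases i
      exacts [h₀, h₁, h₂]
    · fin_cases i <;> fin_cases j
      exacts [absurd rfl hij, h01, h02, h01.symm, absurd rfl hij, h12, h02.symm, h12.symm,
        absurd rfl hij]
  choose hS ha hb hs using hS
  choose z hz using fun i => ((hS i).connOn_diff (ha i) (hb i) hab).1
  have hzP : ∀ i, z i ∉ ({a, b} : Set V) := fun i => by simpa using (hz i).2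
  choose z' hz' hne using fun i => exists_mem_comp_ne hG (hS i) (hs i) (ha i) (hb i) hab (hz i).1
    (hzP i)
  choose P hP Q hQ cP cQ hPQ t1 t2 t3 using fun i =>
    hG.exists_two_parts hab.ne (hzP i) (hz' i) (hne i)
  have hdis : ∀ i j, i ≠ j → Disjoint (comp G {a, b} (z i)) (comp G {a, b} (z j)) := by
    refine fun i j hij => Set.disjoint_left.2 fun x hi hj => ?_
    exact hG.notMem_comp_of_ne hT hab (hS i) (hS j) (hSS i j hij) (ha i) (hb i) (ha j) (hb j)
      (hz i).1 (hzP i) (hz j).1 (comp_inter (hzP j) hi hj)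
  have hnot : ∀ i, ∀ x ∈ comp G {a, b} (z i), x ∉ ({a, b} : Set V) := fun i x hx =>
    comp_disjoint (hzP i) hx
  refine hD3 (isMinorOf_D3 cP cQ hab.ne (fun i h => hnot i a (hP i h) (by simp))
    (fun i h => hnot i a (hQ i h) (by simp)) (fun i h => hnot i b (hP i h) (by simp))
    (fun i h => hnot i b (hQ i h) (by simp)) (fun i j hij => (hdis i j hij).mono (hP i) (hP j))
    (fun i j hij => (hdis i j hij).mono (hQ i) (hQ j)) (fun i j => ?_) t1 t2 t3)
  rcases eq_or_ne i j with rfl | hij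
  exacts [hPQ i, (hdis i j hij).mono (hP i) (hQ j)]

/-- A component of `G - {a, b}` that avoids `S`. -/
def Flap (G : SimpleGraph V) (S : Set V) (a b : V) (D : Set V) : Prop :=
  (∃ z ∉ ({a, b} : Set V), D = comp G {a, b} z) ∧ Disjoint D S

theorem Flap.connOn {D : Set V} (h : Flap G S a b D) : ConnOn G D := by
  obtain ⟨⟨z, -, rfl⟩, -⟩ := h
  exact comp_connOn

theorem Flap.symm {D : Set V} (h : Flap G S a b D) : Flap G S b a D := by
  unfold Flap
  rwa [Set.pair_comm]

theorem Flap.touch {D : Set V} (hG : TwoConnected G) (hab : a ≠ b) (h : Flap G S a b D) :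
    Touch G {a} D := by
  obtain ⟨⟨z, hz, rfl⟩, -⟩ := h
  obtain ⟨u, hu, hua⟩ := hG.exists_adj_comp hab subset_rfl (by simp) hz fun h => hz (by simp [h])
  exact ⟨a, rfl, u, hu, hua.symm⟩

theorem Flap.subset {D D' : Set V} {c d x : V} (h : Flap G S a b D) (h' : Flap G S c d D')
    (ha : a ∈ S) (hb : b ∈ S) (hx : x ∈ D) (hx' : x ∈ D') : D' ⊆ D := by
  have hc := h'.connOn
  obtain ⟨⟨z, hz, rfl⟩, -⟩ := h
  have hsub := subset_comp (P := {a, b}) hc hx' (by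
    rintro y hy (rfl | rfl)
    exacts [Set.disjoint_left.1 h'.2 hy ha, Set.disjoint_left.1 h'.2 hy hb])
  exact fun y hy => comp_trans hx (hsub hy)

theorem Flap.mem_pair {D D' : Set V} {c d x : V} (hG : TwoConnected G) (hab : a ≠ b)
    (h : Flap G S a b D) (h' : Flap G S c d D') (ha : a ∈ S) (hc : c ∈ S)
    (hd : d ∈ S) (hx : x ∈ D) (hx' : x ∈ D') : a ∈ ({c, d} : Set V) := by
  have hsub := h'.subset h hc hd hx' hx
  obtain ⟨_, rfl, u, hu, hua⟩ := h.touch hG hab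
  by_contra hcd
  have hu' := hsub hu
  have hdis := Set.disjoint_left.1 h'.2
  obtain ⟨⟨z, hz, rfl⟩, -⟩ := h'
  exact hdis (comp_closed hu' hua.symm hcd) ha

theorem Flap.eq_of_mem {D D' : Set V} {c d x : V} (hG : TwoConnected G) (hab : a ≠ b)
    (h : Flap G S a b D) (h' : Flap G S c d D') (ha : a ∈ S) (hb : b ∈ S) (hc : c ∈ S)
    (hd : d ∈ S) (hx : x ∈ D) (hx' : x ∈ D') : s(a, b) = s(c, d) := by
  have h1 := h.mem_pair hG hab h' ha hc hd hx hx'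
  have h2 := h.symm.mem_pair hG hab.symm h' hb hc hd hx hx'
  rw [Sym2.eq_iff]
  rcases h1 with rfl | rfl <;> rcases h2 with rfl | rfl
  exacts [absurd rfl hab, Or.inl ⟨rfl, rfl⟩, Or.inr ⟨rfl, rfl⟩, absurd rfl hab]

/-- Every edge of an induced cycle of the cell completion is an edge of `G` or can be routed
through a flap; at edge separators there is one further flap. -/
theorem TwoConnected.exists_flap [Finite V] (hG : TwoConnected G)
    (hT : TCSet (cellCompletion G) Set.univ)
    (hS : IsChordlessCycle (cellCompletion G) S) (ha : a ∈ S) (hb : b ∈ S)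
    (hab : (cellCompletion G).Adj a b) :
    ∃ F : Set V, ConnOn G ({a} ∪ F) ∧ Touch G ({a} ∪ F) {b} ∧ (F = ∅ ∨ Flap G S a b F) ∧
      (IsEdgeSeparator (cellCompletion G) a b → ∃ D, Flap G S a b D ∧ Disjoint D F) := by
  obtain ⟨x, hx, hx'⟩ := (hS.connOn_diff ha hb hab).1
  have hxP : x ∉ ({a, b} : Set V) := by simpa using hx'
  have hflap : ∀ z ∉ ({a, b} : Set V), z ∉ comp G {a, b} x → Flap G S a b (comp G {a, b} z) := by
    refine fun z hz hzx => ⟨⟨z, hz, rfl⟩, Set.disjoint_left.2 fun y hy hyS => hzx ?_⟩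
    exact comp_inter hz (hG.mem_comp_of_isChordlessCycle hS ha hb hab hx hxP hyS
      (comp_disjoint hz hy)) hy
  by_cases hadj : G.Adj a b
  · refine ⟨∅, by simpa using ConnOn.singleton a, ⟨a, by simp, b, rfl, hadj⟩, Or.inl rfl, ?_⟩
    rintro ⟨-, S₁, S₂, hne, h₁, h₂, ha₁, hb₁, ha₂, hb₂⟩
    obtain ⟨T, hTS, h, haT, hbT⟩ : ∃ T, S ≠ T ∧ IsChordlessCycle (cellCompletion G) T ∧ a ∈ T ∧
        b ∈ T := by
      rcases ne_or_eq S S₁ with h | rfl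
      exacts [⟨S₁, h, h₁, ha₁, hb₁⟩, ⟨S₂, hne, h₂, ha₂, hb₂⟩]
    obtain ⟨y, hy, hy'⟩ := (h.connOn_diff haT hbT hab).1
    exact ⟨_, hflap y (by simpa using hy')
      (hG.notMem_comp_of_ne hT hab hS h hTS ha hb haT hbT hx hxP hy), by simp⟩
  · obtain ⟨-, z, hz, hsep⟩ := (cellCompletion_adj.1 hab).resolve_left hadj
    obtain ⟨k, hk⟩ := exists_forall_eq (p := fun i => z i ∈ comp G {a, b} x) fun i j hi hj => by
      by_contra hne
      exact hsep i j hne (comp_trans (comp_symm hxP hi) hj)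
    obtain ⟨i, j, hij, hi, hj⟩ :=
      (by decide : ∀ a : Fin 3, ∃ i j, i ≠ j ∧ i ≠ a ∧ j ≠ a) k
    have hFi := hflap (z i) (hz i) fun h => hi (hk i h)
    have hFj := hflap (z j) (hz j) fun h => hj (hk j h)
    refine ⟨_, (ConnOn.singleton a).union_of_touch hFi.connOn (hFi.touch hG hab.ne),
      (hFi.symm.touch hG hab.ne').symm.mono Set.subset_union_right subset_rfl, Or.inr hFi,
      fun _ => ⟨_, hFj, Set.disjoint_left.2 fun y hy hy' => ?_⟩⟩
    exact hsep i j hij (comp_inter (hz j) hy' hy)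

end paths

section paths

variable {V : Type} {G : SimpleGraph V} {S : Set V}

/-- The successor of `i` in the cyclic order on `{0, …, n - 1}`. -/
def cycSucc (n i : ℕ) : ℕ := if i + 1 < n then i + 1 else 0

theorem CycSeq.adj_cycSucc {H : SimpleGraph V} {n : ℕ} {s : ℕ → V} (h : CycSeq H S n s) {i : ℕ}
    (hi : i < n) : H.Adj (s i) (s (cycSucc n i)) := by
  unfold cycSucc
  split_ifs with h'
  · exact h.adj_succ h'
  · obtain rfl : i = n - 1 := by omega
    exact h.adj_zero_last.symm

theorem CycSeq.edge_inj {H : SimpleGraph V} {n : ℕ} {s : ℕ → V} (h : CycSeq H S n s) {i j : ℕ}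
    (hi : i < n) (hj : j < n) (he : s(s i, s (cycSucc n i)) = s(s j, s (cycSucc n j))) : i = j := by
  have h3 := h.three_le
  have hlt : ∀ i, cycSucc n i < n := fun i => by unfold cycSucc; split_ifs <;> omega
  rcases Sym2.eq_iff.1 he with ⟨h1, -⟩ | ⟨h1, h2⟩
  · exact h.inj _ _ hi hj h1
  · have h1 := h.inj _ _ hi (hlt j) h1
    have h2 := h.inj _ _ (hlt i) hj h2
    unfold cycSucc at h1 h2
    split_ifs at h1 h2 <;> omega

theorem CycSeq.exists_edge_eq {H : SimpleGraph V} {n : ℕ} {s : ℕ → V} (h : CycSeq H S n s) {x y : V}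
    (hx : x ∈ S) (hy : y ∈ S) (hxy : H.Adj x y) : ∃ i < n, s(s i, s (cycSucc n i)) = s(x, y) := by
  obtain ⟨i, hi, rfl⟩ := (h.mem_iff x).1 hx
  obtain ⟨j, hj, rfl⟩ := (h.mem_iff y).1 hy
  have key : ∀ k < n, ∀ l, l = cycSucc n k → s(s k, s (cycSucc n k)) = s(s k, s l) := by
    rintro k - l rfl
    rfl
  have : j = cycSucc n i ∨ i = cycSucc n j := by
    unfold cycSucc
    have := (h.adj_iff' hi hj).1 hxy
    split_ifs <;> omega
  rcases this with h' | h'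
  exacts [⟨i, hi, key i hi j h'⟩, ⟨j, hj, (key j hj i h').trans Sym2.eq_swap⟩]

theorem isMinorOf_S3_of_isEdgeSeparator [Finite V] (hG : TwoConnected G)
    (hT : TCSet (cellCompletion G) Set.univ) {n : ℕ} {s : ℕ → V}
    (h : CycSeq (cellCompletion G) S n s) {i j : ℕ} (hij : i < j) (hj : j + 1 < n)
    (hi' : IsEdgeSeparator (cellCompletion G) (s i) (s (i + 1)))
    (hj' : IsEdgeSeparator (cellCompletion G) (s j) (s (j + 1)))
    (hn' : IsEdgeSeparator (cellCompletion G) (s (n - 1)) (s 0)) : IsMinorOf S3 G := by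
  have hlt : ∀ i < n, cycSucc n i < n := fun i hi => by unfold cycSucc; split_ifs <;> omega
  have hsucc : ∀ i, i + 1 < n → cycSucc n i = i + 1 := fun i hi => if_pos hi
  have hlast : cycSucc n (n - 1) = 0 := if_neg (by omega)
  have hex : ∀ l, ∃ F : Set V, l < n → ConnOn G ({s l} ∪ F) ∧
      Touch G ({s l} ∪ F) {s (cycSucc n l)} ∧ (F = ∅ ∨ Flap G S (s l) (s (cycSucc n l)) F) ∧
      (IsEdgeSeparator (cellCompletion G) (s l) (s (cycSucc n l)) →
        ∃ D, Flap G S (s l) (s (cycSucc n l)) D ∧ Disjoint D F) := by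
    intro l
    by_cases hl : l < n
    · obtain ⟨F, hF⟩ := hG.exists_flap hT h.isChordlessCycle (h.mem hl) (h.mem (hlt l hl))
        (h.adj_cycSucc hl)
      exact ⟨F, fun _ => hF⟩
    · exact ⟨∅, fun h => absurd h hl⟩
  choose F hF using hex
  have hflap : ∀ k l D D', k < n → l < n → Flap G S (s k) (s (cycSucc n k)) D →
      Flap G S (s l) (s (cycSucc n l)) D' → ∀ x ∈ D, x ∈ D' → k = l := by
    intro k l D D' hk hl hD hD' x hx hx'
    exact h.edge_inj hk hl (hD.eq_of_mem hG (h.adj_cycSucc hk).ne hD' (h.mem hk)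
      (h.mem (hlt k hk)) (h.mem hl) (h.mem (hlt l hl)) hx hx')
  have hmemF : ∀ l < n, ∀ x ∈ F l, Flap G S (s l) (s (cycSucc n l)) (F l) := fun l hl x hx =>
    ((hF l hl).2.2.1).resolve_left fun h => by simp [h] at hx
  let W : ℕ → Set V := fun l => {s l} ∪ F l
  have hWW : ∀ k l x, k < n → l < n → x ∈ W k → x ∈ W l → k = l := by
    rintro k l x hk hl (rfl | hx) (hx' | hx')
    · exact h.inj _ _ hk hl hx'
    · exact absurd (h.mem hk) (Set.disjoint_left.1 (hmemF l hl _ hx').2 hx')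
    · exact absurd (hx' ▸ h.mem hl) (Set.disjoint_left.1 (hmemF k hk _ hx).2 hx)
    · exact hflap k l _ _ hk hl (hmemF k hk x hx) (hmemF l hl x hx') x hx hx'
  have hWD : ∀ k l D, k < n → l < n → Flap G S (s l) (s (cycSucc n l)) D → Disjoint D (F l) →
      ∀ x ∈ W k, x ∉ D := by
    rintro k l D hk hl hD hdis x (rfl | hx) hxD
    · exact Set.disjoint_left.1 hD.2 hxD (h.mem hk)
    · obtain rfl := hflap k l _ _ hk hl (hmemF k hk x hx) hD x hx hxD
      exact Set.disjoint_left.1 hdis hxD hx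
  let A : ℕ → ℕ → Set V := fun p q => {y | ∃ l, p ≤ l ∧ l ≤ q ∧ y ∈ W l}
  have hWtouch : ∀ l, l + 1 < n → Touch G (W l) {s (l + 1)} := fun l hl =>
    hsucc l hl ▸ (hF l (by omega)).2.1
  have hA : ∀ p q, p ≤ q → q < n → ConnOn G (A p q) := fun p q hpq hq =>
    connOn_chain hpq (fun l _ h2 => (hF l (by omega)).1) fun l _ h2 =>
      (hWtouch l (by omega)).mono subset_rfl Set.subset_union_left
  have hAA : ∀ p q p' q', q < p' → q' < n → Disjoint (A p q) (A p' q') := by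
    intro p q p' q' hq hq'
    refine Set.disjoint_left.2 ?_
    rintro x ⟨l, h1, h2, hx⟩ ⟨l', h1', h2', hx'⟩
    have := hWW l l' x (by omega) (by omega) hx hx'
    omega
  have hsA : ∀ l p q, p ≤ l → l ≤ q → {s l} ⊆ A p q := by
    rintro l p q h1 h2 _ rfl
    exact ⟨l, h1, h2, Or.inl rfl⟩
  have hWA : ∀ l p q, p ≤ l → l ≤ q → W l ⊆ A p q := fun l p q h1 h2 x hx => ⟨l, h1, h2, hx⟩
  have hAD : ∀ p q l D, q < n → l < n → Flap G S (s l) (s (cycSucc n l)) D → Disjoint D (F l) →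
      Disjoint (A p q) D := by
    intro p q l D hq hl hD hdis
    refine Set.disjoint_left.2 ?_
    rintro x ⟨k, -, hk, hx⟩
    exact hWD k l D (by omega) hl hD hdis x hx
  have hDl : ∀ l D, l < n → Flap G S (s l) (s (cycSucc n l)) D → Touch G {s l} D := fun l D hl hD =>
    hD.touch hG (h.adj_cycSucc hl).ne
  have hDr : ∀ l D, l < n → Flap G S (s l) (s (cycSucc n l)) D → Touch G {s (cycSucc n l)} D :=
    fun l D hl hD => hD.symm.touch hG (h.adj_cycSucc hl).ne'
  have hDD : ∀ k l D D', k < n → l < n → k ≠ l → Flap G S (s k) (s (cycSucc n k)) D →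
      Flap G S (s l) (s (cycSucc n l)) D' → Disjoint D D' := fun k l D D' hk hl hkl hD hD' =>
    Set.disjoint_left.2 fun x hx hx' => hkl (hflap k l D D' hk hl hD hD' x hx hx')
  obtain ⟨D₁, f₁, d₁⟩ := (hF i (by omega)).2.2.2 (by rwa [hsucc i (by omega)])
  obtain ⟨D₂, f₂, d₂⟩ := (hF j (by omega)).2.2.2 (by rwa [hsucc j (by omega)])
  obtain ⟨D₃, f₃, d₃⟩ := (hF (n - 1) (by omega)).2.2.2 (by rwa [hlast])
  have hi₁ := hDr i D₁ (by omega) f₁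
  have hj₂ := hDr j D₂ (by omega) f₂
  have hn₃ := hDr (n - 1) D₃ (by omega) f₃
  have hW₃ := (hF (n - 1) (by omega)).2.1
  rw [hsucc i (by omega)] at hi₁
  rw [hsucc j (by omega)] at hj₂
  rw [hlast] at hn₃ hW₃
  refine isMinorOf_S3 (A := A 0 i) (B := A (i + 1) j) (C := A (j + 1) (n - 1)) (D := D₁) (E := D₂)
    (F := D₃) (hA _ _ (by omega) (by omega)) (hA _ _ (by omega) (by omega))
    (hA _ _ (by omega) (by omega)) f₁.connOn f₂.connOn f₃.connOn
    (hAA _ _ _ _ (by omega) (by omega)) (hAA _ _ _ _ (by omega) (by omega))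
    (hAA _ _ _ _ (by omega) (by omega))
    (hDD i j _ _ (by omega) (by omega) (by omega) f₁ f₂)
    (hDD i (n - 1) _ _ (by omega) (by omega) (by omega) f₁ f₃)
    (hDD j (n - 1) _ _ (by omega) (by omega) (by omega) f₂ f₃)
    (hAD _ _ i _ (by omega) (by omega) f₁ d₁) (hAD _ _ j _ (by omega) (by omega) f₂ d₂)
    (hAD _ _ (n - 1) _ (by omega) (by omega) f₃ d₃)
    (hAD _ _ i _ (by omega) (by omega) f₁ d₁) (hAD _ _ j _ (by omega) (by omega) f₂ d₂)
    (hAD _ _ (n - 1) _ (by omega) (by omega) f₃ d₃)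
    (hAD _ _ i _ (by omega) (by omega) f₁ d₁) (hAD _ _ j _ (by omega) (by omega) f₂ d₂)
    (hAD _ _ (n - 1) _ (by omega) (by omega) f₃ d₃) ?_ ?_ ?_ ?_ ?_ ?_ ?_ ?_ ?_
  · exact (hWtouch i (by omega)).mono (hWA _ _ _ (by omega) le_rfl) (hsA _ _ _ le_rfl (by omega))
  · exact (hW₃.mono (hWA _ _ _ (by omega) le_rfl) (hsA _ _ _ le_rfl (by omega))).symm
  · exact (hWtouch j (by omega)).mono (hWA _ _ _ (by omega) le_rfl) (hsA _ _ _ le_rfl (by omega))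
  · exact (hDl i _ (by omega) f₁).mono (hsA _ _ _ (by omega) le_rfl) subset_rfl
  · exact hi₁.mono (hsA _ _ _ le_rfl (by omega)) subset_rfl
  · exact (hDl j _ (by omega) f₂).mono (hsA _ _ _ (by omega) le_rfl) subset_rfl
  · exact hj₂.mono (hsA _ _ _ le_rfl (by omega)) subset_rfl
  · exact (hDl (n - 1) _ (by omega) f₃).mono (hsA _ _ _ (by omega) le_rfl) subset_rfl
  · exact hn₃.mono (hsA _ _ _ le_rfl (by omega)) subset_rfl

theorem ncard_le_two_of_not_isMinorOf_S3 [Finite V] (hG : TwoConnected G)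
    (hT : TCSet (cellCompletion G) Set.univ) (hS3 : ¬ IsMinorOf S3 G)
    (hS : IsChordlessCycle (cellCompletion G) S) :
    {e : Sym2 V | ∃ u v : V, e = s(u, v) ∧ u ∈ S ∧ v ∈ S ∧
      IsEdgeSeparator (cellCompletion G) u v}.ncard ≤ 2 := by
  by_contra! hcon
  obtain ⟨_, _, _, ⟨u₁, v₁, rfl, hu₁, hv₁, h₁⟩, ⟨u₂, v₂, rfl, hu₂, hv₂, h₂⟩,
    ⟨u₃, v₃, rfl, hu₃, hv₃, h₃⟩, h12, h13, h23⟩ := (Set.two_lt_ncard_iff (Set.toFinite _)).1 hcon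
  obtain ⟨n, s, h, he⟩ := hS.exists_cycSeq_of_adj hu₃ hv₃ h₃.1
  have h3 := h.three_le
  have hcongr : ∀ {x y u v : V}, s(x, y) = s(u, v) → IsEdgeSeparator (cellCompletion G) u v →
      IsEdgeSeparator (cellCompletion G) x y := by
    intro x y u v he h
    rcases Sym2.eq_iff.1 he with ⟨rfl, rfl⟩ | ⟨rfl, rfl⟩
    exacts [h, h.symm]
  have hlast : ∀ {u v : V}, s(u, v) ≠ s(u₃, v₃) → u ∈ S → v ∈ S →
      IsEdgeSeparator (cellCompletion G) u v → ∃ i, i + 1 < n ∧ s(s i, s (i + 1)) = s(u, v) := by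
    intro u v hne hu hv huv
    obtain ⟨i, hi, hiuv⟩ := h.exists_edge_eq hu hv huv.1
    unfold cycSucc at hiuv
    split_ifs at hiuv with hi'
    · exact ⟨i, hi', hiuv⟩
    · obtain rfl : i = n - 1 := by omega
      exact absurd (hiuv.symm.trans (Sym2.eq_swap.trans he)) hne
  obtain ⟨i, hi, hi'⟩ := hlast h13 hu₁ hv₁ h₁
  obtain ⟨j, hj, hj'⟩ := hlast h23 hu₂ hv₂ h₂
  have h₃' := hcongr (Sym2.eq_swap.trans he) h₃
  rcases lt_trichotomy i j with hij | rfl | hij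
  · exact hS3 (isMinorOf_S3_of_isEdgeSeparator hG hT h hij hj (hcongr hi' h₁) (hcongr hj' h₂) h₃')
  · exact h12 (hi'.symm.trans hj')
  · exact hS3 (isMinorOf_S3_of_isEdgeSeparator hG hT h hij hi (hcongr hj' h₂) (hcongr hi' h₁) h₃')

theorem isPathOfCycles_of_not_isMinorOf [Finite V] (hG : TwoConnected G) (hK4 : ¬ IsMinorOf K4 G)
    (hD3 : ¬ IsMinorOf D3 G) (hS3 : ¬ IsMinorOf S3 G) : IsPathOfCycles (cellCompletion G) := by
  have hT := (hG.mono le_cellCompletion).isTreeOfCycles (hG.not_isMinorOf_K4_cellCompletion hK4)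
    fun c d hcd h => cellCompletion_adj.2
      (Or.inr ⟨hcd, (hG.sep3_iff le_cellCompletion le_rfl).1 h⟩)
  exact ⟨hT, fun S hS => ncard_le_two_of_not_isMinorOf_S3 hG (isTreeOfCycles_iff.1 hT) hS3 hS,
    fun a b hab => ncard_le_two_of_not_isMinorOf_D3 hG (isTreeOfCycles_iff.1 hT) hD3 hab⟩

end paths

/-- For a 2-connected finite simple graph `G`, TFAE: (1) `pw G = 2`;
(2) `spctw G = 2`; (3) `dptw G = 2`; (4) `G` has no minor isomorphic to `K₄`, `D₃`
or `S₃`; (5) the cell completion of `G` is a path of cycles. -/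
theorem statement15 {V : Type} [Fintype V] (G : SimpleGraph V) (hG : TwoConnected G) :
    List.TFAE
      [pw G = 2,
       spctw G = 2,
       dptw G = 2,
       ¬ IsMinorOf K4 G ∧ ¬ IsMinorOf D3 G ∧ ¬ IsMinorOf S3 G,
       IsPathOfCycles (cellCompletion G)] := by
  tfae_have 1 → 2 := fun h => by
    obtain ⟨pd, hpd⟩ := (pw_eq_two_iff hG).1 h
    exact (spctw_eq_two_iff hG).2 (pd.exists_specialTD hpd)
  tfae_have 2 → 3 := fun h => by
    obtain ⟨td, htd⟩ := (spctw_eq_two_iff hG).1 h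
    exact (dptw_eq_two_iff hG).2 (td.exists_dirSpaghettiTD htd)
  tfae_have 3 → 4 := fun h => by
    obtain ⟨td, htd⟩ := (dptw_eq_two_iff hG).1 h
    exact ⟨td.toTreeDecomp.not_isMinorOf_K4 htd, td.not_isMinorOf_D3 htd, td.not_isMinorOf_S3 htd⟩
  tfae_have 4 → 5 := fun ⟨h₁, h₂, h₃⟩ => isPathOfCycles_of_not_isMinorOf hG h₁ h₂ h₃
  tfae_have 5 → 1 := pw_eq_two_of_isPathOfCycles hG
  tfae_finish
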